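/- Let 1 < q ≤ p < ∞. There exist a constant c > 0 and an integer N₀ (depending only on p, q and φ₀) with the following property. Let N ≥ N₀, let A be a set of nonnegative integers, and let I₁, …, I_{4^N} be pairwise disjoint real intervals, each of length N and each containing an element of A; set Z = 4^{−N} ∑_{κ=1}^{4^N} #(I_κ ∩ A). Then there exist a finite set E of Haar indices with HF(E) ⊆ A and a nonzero Schwartz function f : ℝ → ℂ with ‖P_E f‖_{F^{−1+1/q}_{p,q}} ≥ c · N^{1−1/q} · Z^{1/q} · ‖f‖_{F^{−1+1/q}_{p,q}}. -/

import Mathlib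

open MeasureTheory Real FourierTransform
open scoped ENNReal

noncomputable section

def haarFn (j : ℕ) (μ : ℤ) : ℝ → ℂ := fun x =>
  (Set.Ico ((2:ℝ)^(-(j:ℤ)) * μ) ((2:ℝ)^(-(j:ℤ)) * (μ + 1/2))).indicator (fun _ => (1:ℂ)) x
  - (Set.Ico ((2:ℝ)^(-(j:ℤ)) * (μ + 1/2)) ((2:ℝ)^(-(j:ℤ)) * (μ + 1))).indicator (fun _ => (1:ℂ)) x

def haarProj (E : Finset (ℕ × ℤ)) (f : ℝ → ℂ) : ℝ → ℂ := fun x =>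
  ∑ e ∈ E, (2:ℂ)^e.1 * (∫ y : ℝ, f y * haarFn e.1 e.2 y) * haarFn e.1 e.2 x

def HFset (E : Finset (ℕ × ℤ)) : Finset ℕ := E.image Prod.fst

def conv (f g : ℝ → ℂ) : ℝ → ℂ := fun x => ∫ t : ℝ, f t * g (x - t)

def LPop (φ₀ : ℝ → ℂ) (k : ℕ) (g : ℝ → ℂ) : ℝ → ℂ :=
  if k = 0 then conv g (𝓕⁻ φ₀)
  else conv g (fun x => (2:ℂ)^k * (𝓕⁻ (fun ξ => φ₀ ξ - φ₀ (2*ξ))) ((2:ℝ)^k * x))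

def FNorm (φ₀ : ℝ → ℂ) (p q s : ℝ) (g : ℝ → ℂ) : ℝ≥0∞ :=
  (∫⁻ x : ℝ, (∑' k : ℕ, ENNReal.ofReal ((2:ℝ)^((k:ℝ)*s*q)) *
      (ENNReal.ofReal ‖LPop φ₀ k g x‖)^q)^(p/q) ∂volume)^(1/p)

/-- Rapid decay of Schwartz functions, in a convenient form. -/
theorem SchwartzMap.exists_norm_mul_pow_le (θ : SchwartzMap ℝ ℂ) (n : ℕ) :
    ∃ K : ℝ, 0 < K ∧ ∀ x, ‖θ x‖ ≤ K * ((1 + |x|) ^ n)⁻¹ := by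
  set K := 2 ^ (n, 0).1 * (Finset.Iic (n, 0)).sup
    (fun m : ℕ × ℕ => SchwartzMap.seminorm ℝ m.1 m.2) θ with hK
  refine ⟨K + 1, ?_, fun x => ?_⟩
  · have : 0 ≤ K := by rw [hK]; positivity
    linarith
  · have h := SchwartzMap.one_add_le_sup_seminorm_apply (𝕜 := ℝ) (m := (n, 0)) (k := n) (n := 0)
      le_rfl le_rfl θ x
    rw [norm_iteratedFDeriv_zero, Real.norm_eq_abs] at h
    rw [← div_eq_mul_inv, le_div_iff₀ (by positivity), mul_comm]
    linarith

theorem fourier_scale_shift (g : ℝ → ℂ) {a : ℝ} (ha : 0 < a) (y ξ : ℝ) :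
    𝓕 (fun x => g (a * (x - y))) ξ
      = ((𝐞 (-(y * ξ)) : Circle) : ℂ) * ((a⁻¹ : ℝ) : ℂ) * 𝓕 g (ξ / a) := by
  rw [Real.fourier_real_eq, Real.fourier_real_eq]
  have h1 : (∫ v, 𝐞 (-(v * ξ)) • g (a * (v - y)))
      = ∫ v, 𝐞 (-((v + y) * ξ)) • g (a * v) := by
    rw [← integral_sub_right_eq_self (fun v => 𝐞 (-((v + y) * ξ)) • g (a * v)) y]
    simp
  have h2 : (∫ v, 𝐞 (-((v + y) * ξ)) • g (a * v))
      = ∫ v, (fun u => 𝐞 (-((u / a + y) * ξ)) • g u) (a * v) := by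
    congr 1; ext v
    simp only
    rw [mul_div_cancel_left₀ _ ha.ne']
  rw [h1, h2, Measure.integral_comp_mul_left (fun u => 𝐞 (-((u / a + y) * ξ)) • g u) a,
    abs_of_pos (inv_pos.2 ha), mul_comm ((𝐞 _ : Circle) : ℂ), mul_assoc,
    ← integral_const_mul, Complex.real_smul]
  congr 2; ext v
  rw [Circle.smul_def, Circle.smul_def, smul_eq_mul, smul_eq_mul, ← mul_assoc, ← Circle.coe_mul,
    ← AddChar.map_add_eq_mul]
  congr 3
  ring

theorem conv_fourierInv (g m : SchwartzMap ℝ ℂ) (x : ℝ) :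
    conv g (𝓕⁻ (m : ℝ → ℂ)) x = 𝓕⁻ (fun ξ => 𝓕 (g : ℝ → ℂ) ξ * m ξ) x := by
  set G : SchwartzMap ℝ ℂ := SchwartzMap.compSubConstCLM ℝ x
    (SchwartzMap.compCLMOfContinuousLinearEquiv ℝ (ContinuousLinearEquiv.neg ℝ) g) with hG
  have hGx : ∀ t, G t = g (x - t) := by
    intro t
    simp [hG]
  have h1 : conv g (𝓕⁻ (m : ℝ → ℂ)) x = ∫ t, (𝓕⁻ m) t * G t := by
    rw [conv, ← integral_sub_left_eq_self (fun t : ℝ => g t * (𝓕⁻ (m : ℝ → ℂ) : ℝ → ℂ) (x - t)) volume x]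
    congr 1; ext t
    rw [hGx, sub_sub_cancel, mul_comm, SchwartzMap.fourierInv_coe]
  rw [h1, SchwartzMap.integral_fourierInv_mul_eq, Real.fourierInv_eq']
  congr 1; ext ξ
  rw [SchwartzMap.fourierInv_coe, Real.fourierInv_eq', Real.fourier_real_eq, smul_eq_mul, mul_comm (m ξ),
    ← mul_assoc]
  congr 1
  rw [← integral_const_mul,
    ← integral_sub_left_eq_self (fun t => _ * (𝐞 (-(t * ξ)) • g t)) volume x]
  congr 1; ext t
  rw [hGx, Circle.smul_def, smul_eq_mul, smul_eq_mul, ← mul_assoc, Real.fourierChar_apply,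
    ← Complex.exp_add]
  congr 2
  simp
  ring

/-- The Fourier multiplier of `LPop φ₀ l`. -/
def lpMult (φ₀ : ℝ → ℂ) (l : ℕ) (ξ : ℝ) : ℂ :=
  if l = 0 then φ₀ ξ else φ₀ (ξ / 2 ^ l) - φ₀ (2 * (ξ / 2 ^ l))

theorem contDiff_lpMult {φ₀ : ℝ → ℂ} (hφsmooth : ContDiff ℝ (⊤ : ℕ∞) φ₀) (l : ℕ) : ContDiff ℝ (⊤ : ℕ∞) (lpMult φ₀ l) := by
  unfold lpMult
  split_ifs
  · exact hφsmooth
  · fun_prop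

theorem hasCompactSupport_lpMult {φ₀ : ℝ → ℂ} (hφcpt : HasCompactSupport φ₀) (l : ℕ) : HasCompactSupport (lpMult φ₀ l) := by
  unfold lpMult
  split_ifs
  · exact hφcpt
  · have h (c : ℝ) (hc : c ≠ 0) : HasCompactSupport (fun ξ => φ₀ (c * ξ)) :=
      hφcpt.comp_homeomorph (Homeomorph.mulLeft₀ c hc)
    have h1 := h ((2 ^ l)⁻¹) (by positivity)
    have h2 := h (2 * (2 ^ l)⁻¹) (by positivity)
    have e : (fun ξ : ℝ => φ₀ (ξ / 2 ^ l) - φ₀ (2 * (ξ / 2 ^ l)))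
        = (fun ξ => φ₀ ((2 ^ l)⁻¹ * ξ)) - fun ξ => φ₀ (2 * (2 ^ l)⁻¹ * ξ) := by
      ext ξ
      simp only [Pi.sub_apply, div_eq_inv_mul, mul_assoc]
    rw [e]
    exact h1.sub h2

theorem LPop_eq_fourierInv {φ₀ : ℝ → ℂ} (hφsmooth : ContDiff ℝ (⊤ : ℕ∞) φ₀)
    (hφcpt : HasCompactSupport φ₀) (l : ℕ) (g : SchwartzMap ℝ ℂ) (x : ℝ) :
    LPop φ₀ l g x = 𝓕⁻ (fun ξ => 𝓕 (g : ℝ → ℂ) ξ * lpMult φ₀ l ξ) x := by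
  refine Eq.trans ?_ (conv_fourierInv g ((hasCompactSupport_lpMult hφcpt l).toSchwartzMap
    (contDiff_lpMult hφsmooth l)) x)
  change _ = conv g (𝓕⁻ (lpMult φ₀ l)) x
  unfold LPop lpMult
  split_ifs with hl
  · rfl
  · congr 1
    ext y
    have h := fourier_scale_shift (fun ξ => φ₀ ξ - φ₀ (2 * ξ)) (a := (2 ^ l)⁻¹) (by positivity) 0 (-y)
    rw [Real.fourierInv_eq_fourier_neg, Real.fourierInv_eq_fourier_neg]
    have e : (fun ξ : ℝ => φ₀ (ξ / 2 ^ l) - φ₀ (2 * (ξ / 2 ^ l)))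
        = fun x => (fun ξ => φ₀ ξ - φ₀ (2 * ξ)) ((2 ^ l)⁻¹ * (x - 0)) := by
      ext ξ
      simp only [sub_zero, div_eq_inv_mul]
    rw [e, h]
    simp only [zero_mul, neg_zero, AddChar.map_zero_eq_one, Circle.coe_one, one_mul, inv_inv,
      div_inv_eq_mul]
    push_cast
    congr 2
    ring_nf

theorem lpMult_eq_ite {φ₀ : ℝ → ℂ} (hφone : ∀ ξ : ℝ, |ξ| ≤ 4/3 → φ₀ ξ = 1)
    (hφzero : ∀ ξ : ℝ, 3/2 ≤ |ξ| → φ₀ ξ = 0) {k l : ℕ} (hk : k ≠ 0) {ξ : ℝ}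
    (h1 : 3 / 4 * 2 ^ k ≤ |ξ|) (h2 : |ξ| ≤ 4 / 3 * 2 ^ k) :
    lpMult φ₀ l ξ = if l = k then 1 else 0 := by
  have ha : ∀ l : ℕ, |ξ / 2 ^ l| = |ξ| / 2 ^ l := fun l => by
    rw [abs_div, abs_of_pos (by positivity : (0:ℝ) < 2 ^ l)]
  have hb : ∀ l : ℕ, |2 * (ξ / 2 ^ l)| = 2 * (|ξ| / 2 ^ l) := fun l => by
    rw [abs_mul, ha, abs_of_pos (by norm_num : (0:ℝ) < 2)]
  unfold lpMult
  rcases lt_trichotomy l k with h | h | h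
  · rw [if_neg h.ne]
    have hlk : (2:ℝ) ^ l * 2 ≤ 2 ^ k := by
      rw [← pow_succ]; exact pow_le_pow_right₀ (by norm_num) h
    have h3 : 3 / 2 ≤ |ξ| / 2 ^ l := by
      rw [le_div_iff₀ (by positivity)]; linarith
    split_ifs with h0
    · subst h0; exact hφzero _ (by simpa using h3)
    · rw [hφzero _ (by rw [ha]; exact h3), hφzero _ (by rw [hb]; linarith), sub_zero]
  · subst h
    rw [if_neg hk, if_pos rfl, hφone _ (by rw [ha, div_le_iff₀ (by positivity)]; exact h2),
      hφzero, sub_zero]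
    rw [hb]
    have : 3 / 4 ≤ |ξ| / 2 ^ l := by rw [le_div_iff₀ (by positivity)]; linarith
    linarith
  · rw [if_neg h.ne', if_neg (by omega)]
    have hlk : (2:ℝ) ^ k * 2 ≤ 2 ^ l := by
      rw [← pow_succ]; exact pow_le_pow_right₀ (by norm_num) h
    have h3 : |ξ| / 2 ^ l ≤ 2 / 3 := by
      rw [div_le_iff₀ (by positivity)]; linarith
    rw [hφone _ (by rw [ha]; linarith), hφone _ (by rw [hb]; linarith), sub_self]

/-- Littlewood–Paley operators act as the identity or as zero on pieces with Fourier
support in dyadic annuli. -/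
theorem LPop_sum_of_annuli {φ₀ : ℝ → ℂ} (hφsmooth : ContDiff ℝ (⊤ : ℕ∞) φ₀)
    (hφcpt : HasCompactSupport φ₀) (hφone : ∀ ξ : ℝ, |ξ| ≤ 4/3 → φ₀ ξ = 1)
    (hφzero : ∀ ξ : ℝ, 3/2 ≤ |ξ| → φ₀ ξ = 0) {ι : Type*} (I : Finset ι) (k : ι → ℕ)
    (hk : ∀ i ∈ I, k i ≠ 0) (f : ι → SchwartzMap ℝ ℂ)
    (hf : ∀ i ∈ I, ∀ ξ, 𝓕 (f i : ℝ → ℂ) ξ ≠ 0 →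
      3 / 4 * 2 ^ (k i) ≤ |ξ| ∧ |ξ| ≤ 4 / 3 * 2 ^ (k i)) (l : ℕ) (x : ℝ) :
    LPop φ₀ l (∑ i ∈ I, f i : SchwartzMap ℝ ℂ) x = ∑ i ∈ I with k i = l, f i x := by
  have hsum : ∀ (T : Finset ι) (ξ : ℝ), 𝓕 ((∑ i ∈ T, f i : SchwartzMap ℝ ℂ) : ℝ → ℂ) ξ
      = ∑ i ∈ T, 𝓕 (f i : ℝ → ℂ) ξ := by
    intro T ξ
    have := map_sum (SchwartzMap.fourierTransformCLM ℂ (V := ℝ) (E := ℂ)) f T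
    have h2 := congrArg (fun g : SchwartzMap ℝ ℂ => g ξ) this
    simp only [SchwartzMap.fourierTransformCLM_apply, sum_apply] at h2
    exact h2
  rw [LPop_eq_fourierInv hφsmooth hφcpt]
  have hm : (fun ξ => 𝓕 ((∑ i ∈ I, f i : SchwartzMap ℝ ℂ) : ℝ → ℂ) ξ * lpMult φ₀ l ξ)
      = 𝓕 ((∑ i ∈ I with k i = l, f i : SchwartzMap ℝ ℂ) : ℝ → ℂ) := by
    ext ξ
    rw [hsum, hsum, Finset.sum_mul, Finset.sum_filter]
    refine Finset.sum_congr rfl fun i hi => ?_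
    by_cases h0 : 𝓕 (f i : ℝ → ℂ) ξ = 0
    · simp [h0]
    · obtain ⟨h1, h2⟩ := hf i hi ξ h0
      rw [lpMult_eq_ite hφone hφzero (hk i hi) h1 h2]
      by_cases hl : k i = l
      · simp [hl]
      · simp [hl, Ne.symm hl]
  rw [hm, ← SchwartzMap.fourier_coe, ← SchwartzMap.fourierInv_coe, FourierPair.fourierInv_fourier_eq,
    sum_apply]

theorem exists_annular_schwartz : ∃ θ : SchwartzMap ℝ ℂ, θ 0 ≠ 0 ∧
    ∀ ξ, 𝓕 (θ : ℝ → ℂ) ξ ≠ 0 → 3 / 4 ≤ |ξ| ∧ |ξ| ≤ 4 / 3 := by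
  let ρ : ContDiffBump (1 : ℝ) := ⟨1 / 8, 1 / 5, by norm_num, by norm_num⟩
  have hs : HasCompactSupport (fun x => ((ρ x : ℝ) : ℂ)) :=
    ρ.hasCompactSupport.comp_left (g := fun t : ℝ => (t : ℂ)) (by simp)
  have hd : ContDiff ℝ (⊤ : ℕ∞) (fun x => ((ρ x : ℝ) : ℂ)) :=
    Complex.ofRealCLM.contDiff.comp ρ.contDiff
  refine ⟨𝓕⁻ (hs.toSchwartzMap hd), ?_, ?_⟩
  · rw [SchwartzMap.fourierInv_coe, Real.fourierInv_eq']
    simp only [inner_zero_right, mul_zero, Complex.ofReal_zero, zero_mul, Complex.exp_zero,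
      one_smul]
    change ∫ v, ((ρ v : ℝ) : ℂ) ≠ 0
    rw [integral_complex_ofReal]
    exact_mod_cast (ρ.integral_pos (μ := volume)).ne'
  · intro ξ h
    rw [← SchwartzMap.fourier_coe, FourierInvPair.fourier_fourierInv_eq] at h
    have h2 : ξ ∈ Function.support ρ := by
      intro h0; apply h; simp [h0]
    rw [ρ.support_eq, Metric.mem_ball, Real.dist_eq, abs_lt] at h2
    have : ρ.rOut = 1 / 5 := rfl
    rw [this] at h2
    rw [abs_of_pos (by linarith)]
    constructor <;> linarith

/-- The Littlewood–Paley kernel is the derivative of a nonzero Schwartz function. -/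
theorem exists_primitive_kernel {φ₀ : ℝ → ℂ} (hφsmooth : ContDiff ℝ (⊤ : ℕ∞) φ₀)
    (hφcpt : HasCompactSupport φ₀) (hφone : ∀ ξ : ℝ, |ξ| ≤ 4/3 → φ₀ ξ = 1)
    (hφzero : ∀ ξ : ℝ, 3/2 ≤ |ξ| → φ₀ ξ = 0) : ∃ Ξ : SchwartzMap ℝ ℂ, (∃ u, Ξ u ≠ 0) ∧
    ∀ x, HasDerivAt Ξ (𝓕⁻ (fun ξ => φ₀ ξ - φ₀ (2*ξ)) x) x := by
  set φ : ℝ → ℂ := fun ξ => φ₀ ξ - φ₀ (2*ξ) with hφ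
  have hφs : HasCompactSupport φ := by
    refine hφcpt.sub (hφcpt.comp_homeomorph (Homeomorph.mulLeft₀ (2:ℝ) (by norm_num)))
  have hφd : ContDiff ℝ (⊤ : ℕ∞) φ := by
    rw [hφ]; fun_prop
  set ρ : ℝ → ℂ := fun ξ => (2 * π * Complex.I * ξ)⁻¹ * φ ξ with hρ
  have hρs : HasCompactSupport ρ := hφs.mul_left
  have hρd : ContDiff ℝ (⊤ : ℕ∞) ρ := by
    rw [contDiff_iff_contDiffAt]
    intro ξ
    by_cases h : |ξ| < 2 / 3
    · have : ρ =ᶠ[nhds ξ] fun _ => 0 := by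
        have ho : IsOpen {ξ : ℝ | |ξ| < 2 / 3} := isOpen_lt continuous_abs continuous_const
        filter_upwards [ho.mem_nhds h] with y hy
        have hy : |y| < 2 / 3 := hy
        simp only [hρ, hφ]
        rw [hφone y (by linarith), hφone (2 * y) (by rw [abs_mul, abs_two]; linarith)]
        simp
      exact contDiffAt_const.congr_of_eventuallyEq this
    · have hξ : ξ ≠ 0 := by rintro rfl; apply h; norm_num
      refine ContDiffAt.mul (ContDiffAt.inv ?_ ?_) hφd.contDiffAt
      · exact contDiffAt_const.mul Complex.ofRealCLM.contDiff.contDiffAt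
      · have := Real.pi_ne_zero
        simp [hξ]
  set g := hρs.toSchwartzMap hρd with hg
  have hFg : 𝓕 ((𝓕⁻ g : SchwartzMap ℝ ℂ) : ℝ → ℂ) = ρ := by
    rw [← SchwartzMap.fourier_coe, FourierInvPair.fourier_fourierInv_eq]; rfl
  refine ⟨𝓕⁻ g, ?_, ?_⟩
  · by_contra! h
    have h0 : (𝓕⁻ g : SchwartzMap ℝ ℂ) = 0 := by ext u; simp [h u]
    have h1 : ρ 1 = 0 := by
      rw [← hFg, h0, Real.fourier_real_eq]; simp
    simp only [hρ, hφ] at h1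
    rw [hφone 1 (by norm_num), hφzero _ (by norm_num)] at h1
    simp [Real.pi_ne_zero] at h1
  · intro x
    have hd : deriv (𝓕⁻ g : SchwartzMap ℝ ℂ) = 𝓕⁻ φ := by
      set D := SchwartzMap.derivCLM ℝ ℂ (𝓕⁻ g : SchwartzMap ℝ ℂ) with hD
      have hDc : (D : ℝ → ℂ) = deriv (𝓕⁻ g : SchwartzMap ℝ ℂ) := by
        ext x; rw [hD, SchwartzMap.derivCLM_apply]
      have hFD : 𝓕 (D : ℝ → ℂ) = φ := by
        rw [hDc, Real.fourier_deriv (𝓕⁻ g).integrable (𝓕⁻ g).differentiable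
          (by rw [← hDc]; exact D.integrable), hFg]
        ext ξ
        simp only [hρ, smul_eq_mul]
        by_cases hξ : ξ = 0
        · subst hξ
          simp only [hφ]
          rw [hφone 0 (by norm_num)]
          simp [hφone 0 (by norm_num)]
        · rw [mul_inv_cancel_left₀]
          simp [hξ, Real.pi_ne_zero]
      rw [← hDc, ← hFD, ← SchwartzMap.fourier_coe, ← SchwartzMap.fourierInv_coe,
        FourierPair.fourierInv_fourier_eq]
    rw [← hd]
    exact (𝓕⁻ g).differentiableAt.hasDerivAt

/-- Second difference of `G` over the two halves of the `μ`-th dyadic interval of length `2⁻ʲ`. -/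
def haarDiff (G : ℝ → ℂ) (j : ℕ) (μ : ℝ) : ℂ :=
  G (μ / 2 ^ j) - 2 * G ((μ + 1 / 2) / 2 ^ j) + G ((μ + 1) / 2 ^ j)

theorem mul_haarFn_eq (g : ℝ → ℂ) (j : ℕ) (μ : ℤ) :
    (fun y => g y * haarFn j μ y) = fun y =>
      (Set.Ico ((μ : ℝ) / 2 ^ j) ((μ + 1 / 2) / 2 ^ j)).indicator g y
        - (Set.Ico (((μ : ℝ) + 1 / 2) / 2 ^ j) ((μ + 1) / 2 ^ j)).indicator g y := by
  ext y
  simp only [haarFn, zpow_neg, zpow_natCast, ← div_eq_inv_mul, Set.indicator_apply]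
  split_ifs <;> simp

theorem integrable_mul_haarFn {g : ℝ → ℂ} (hg : Continuous g) (j : ℕ) (μ : ℤ) :
    Integrable (fun y => g y * haarFn j μ y) := by
  rw [mul_haarFn_eq]
  have h : ∀ a b : ℝ, Integrable ((Set.Ico a b).indicator g) := fun a b =>
    (integrable_indicator_iff measurableSet_Ico).2
      (hg.integrableOn_Icc.mono_set Set.Ico_subset_Icc_self)
  exact (h _ _).sub (h _ _)

theorem integral_mul_haarFn {G g : ℝ → ℂ} (hG : ∀ x, HasDerivAt G (g x) x) (hg : Continuous g)
    (j : ℕ) (μ : ℤ) : ∫ y, g y * haarFn j μ y = - haarDiff G j μ := by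
  have h : ∀ a b : ℝ, Integrable ((Set.Ico a b).indicator g) := fun a b =>
    (integrable_indicator_iff measurableSet_Ico).2
      (hg.integrableOn_Icc.mono_set Set.Ico_subset_Icc_self)
  have h' : ∀ a b : ℝ, a ≤ b → ∫ y, (Set.Ico a b).indicator g y = G b - G a := fun a b hab => by
    rw [integral_indicator measurableSet_Ico, integral_Ico_eq_integral_Ioc,
      ← intervalIntegral.integral_of_le hab,
      intervalIntegral.integral_eq_sub_of_hasDerivAt (fun x _ => hG x) (hg.intervalIntegrable _ _)]
  rw [mul_haarFn_eq, integral_sub (h _ _) (h _ _), h' _ _ (by gcongr; linarith),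
    h' _ _ (by gcongr; linarith), haarDiff]
  ring

theorem LPop_haarProj {φ₀ Ξ F f : ℝ → ℂ}
    (hΞ : ∀ x, HasDerivAt Ξ (𝓕⁻ (fun ξ => φ₀ ξ - φ₀ (2*ξ)) x) x)
    (hΞc : Continuous (𝓕⁻ (fun ξ => φ₀ ξ - φ₀ (2*ξ)) : ℝ → ℂ))
    (hF : ∀ x, HasDerivAt F (f x) x) (hf : Continuous f) (E : Finset (ℕ × ℤ)) {k : ℕ}
    (hk : k ≠ 0) (x : ℝ) :
    LPop φ₀ k (haarProj E f) x
      = - ∑ e ∈ E, 2 ^ e.1 * haarDiff F e.1 e.2 *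
          haarDiff (fun t => Ξ (2 ^ k * (x - t))) e.1 e.2 := by
  set Φ : ℝ → ℂ := 𝓕⁻ (fun ξ => φ₀ ξ - φ₀ (2*ξ)) with hΦ
  have hK : Continuous fun t => (2:ℂ) ^ k * Φ ((2:ℝ) ^ k * (x - t)) := by fun_prop
  have hG : ∀ t, HasDerivAt (fun t => - Ξ (2 ^ k * (x - t)))
      ((2:ℂ) ^ k * Φ ((2:ℝ) ^ k * (x - t))) t := by
    intro t
    have h1 : HasDerivAt (fun t : ℝ => (2:ℝ) ^ k * (x - t)) ((2:ℝ) ^ k * (-1)) t :=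
      ((hasDerivAt_id t).const_sub x).const_mul _
    have h2 := ((hΞ ((2:ℝ) ^ k * (x - t))).scomp t h1).neg
    refine h2.congr_deriv ?_
    rw [Complex.real_smul]
    push_cast
    ring
  rw [LPop, if_neg hk, conv]
  simp only [haarProj, Finset.sum_mul]
  have hr : ∀ e : ℕ × ℤ, (fun t => (2:ℂ) ^ e.1 * (∫ y, f y * haarFn e.1 e.2 y) * haarFn e.1 e.2 t *
      ((2:ℂ) ^ k * Φ ((2:ℝ) ^ k * (x - t)))) = fun t =>
      ((2:ℂ) ^ e.1 * (∫ y, f y * haarFn e.1 e.2 y)) *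
        ((2:ℂ) ^ k * Φ ((2:ℝ) ^ k * (x - t)) * haarFn e.1 e.2 t) := by
    intro e; ext t; ring
  rw [integral_finsetSum, ← Finset.sum_neg_distrib]
  · refine Finset.sum_congr rfl fun e _ => ?_
    rw [hr, integral_const_mul, integral_mul_haarFn hG hK, integral_mul_haarFn hF hf]
    simp only [haarDiff]
    ring
  · intro e _
    rw [hr]
    exact (integrable_mul_haarFn hK _ _).const_mul _

theorem sum_range_inv_one_add_sq_le {α : ℝ} (hα : 0 < α) (M : ℕ) :
    ∑ n ∈ Finset.range M, ((1 + α * n) ^ 2)⁻¹ ≤ 1 + α⁻¹ := by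
  suffices h : ∀ M : ℕ, ∑ n ∈ Finset.range (M + 1), ((1 + α * (n : ℝ)) ^ 2)⁻¹
      ≤ 1 + α⁻¹ - α⁻¹ * (1 + α * M)⁻¹ by
    refine (Finset.sum_le_sum_of_subset_of_nonneg (Finset.range_mono (Nat.le_succ M))
      (fun _ _ _ => by positivity)).trans ((h M).trans ?_)
    have : 0 ≤ α⁻¹ * (1 + α * M)⁻¹ := by positivity
    linarith
  intro M
  induction M with
  | zero => simp
  | succ M ih =>
    rw [Finset.sum_range_succ]
    have hM : 0 < 1 + α * (M : ℝ) := by positivity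
    have hM' : 0 < 1 + α * ((M + 1 : ℕ) : ℝ) := by positivity
    have key : ((1 + α * ((M + 1 : ℕ) : ℝ)) ^ 2)⁻¹
        ≤ α⁻¹ * (1 + α * M)⁻¹ - α⁻¹ * (1 + α * ((M + 1 : ℕ) : ℝ))⁻¹ := by
      have e : α⁻¹ * (1 + α * M)⁻¹ - α⁻¹ * (1 + α * ((M + 1 : ℕ) : ℝ))⁻¹
          = ((1 + α * M) * (1 + α * ((M + 1 : ℕ) : ℝ)))⁻¹ := by
        field_simp
        push_cast
        ring
      rw [e]
      apply inv_anti₀ (by positivity)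
      rw [sq]
      gcongr
      linarith
    linarith

theorem sum_inv_one_add_sq_le_of_injOn {ι : Type*} {α : ℝ} (hα : 0 < α) (T : Finset ι)
    (n : ι → ℕ) (hn : Set.InjOn n T) :
    ∑ i ∈ T, ((1 + α * n i) ^ 2)⁻¹ ≤ 1 + α⁻¹ := by
  classical
  rw [← Finset.sum_image (f := fun m : ℕ => ((1 + α * (m : ℝ)) ^ 2)⁻¹) hn]
  refine (Finset.sum_le_sum_of_subset_of_nonneg (t := Finset.range ((T.image n).sup id + 1))
    ?_ (fun _ _ _ => by positivity)).trans (sum_range_inv_one_add_sq_le hα _)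
  intro m hm
  rw [Finset.mem_range, Nat.lt_succ_iff]
  exact Finset.le_sup (f := id) hm

/-- Sums of quadratically decaying bumps over a lattice. -/
theorem sum_lattice_le {ι : Type*} {α : ℝ} (hα : 0 < α) (T : Finset ι) (ν : ι → ℤ)
    (hν : Set.InjOn ν T) (y : ℝ) :
    ∑ i ∈ T, ((1 + α * |y - ν i|) ^ 2)⁻¹ ≤ 2 * (1 + α⁻¹) := by
  classical
  rw [← Finset.sum_filter_add_sum_filter_not T (fun i => ⌈y⌉ ≤ ν i), two_mul]
  apply add_le_add
  · refine (Finset.sum_le_sum fun i hi => ?_).trans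
      (sum_inv_one_add_sq_le_of_injOn hα _ (fun i => (ν i - ⌈y⌉).toNat) ?_)
    · rw [Finset.mem_filter] at hi
      have h1 : (((ν i - ⌈y⌉).toNat : ℕ) : ℝ) = (ν i : ℝ) - ⌈y⌉ := by
        have := Int.toNat_of_nonneg (sub_nonneg.2 hi.2)
        exact_mod_cast congrArg (Int.cast (R := ℝ)) this
      have h2 := Int.le_ceil y
      have h3 : ((ν i - ⌈y⌉).toNat : ℝ) ≤ |y - ν i| := by
        rw [h1, abs_sub_comm]
        exact le_trans (by linarith) (le_abs_self _)
      gcongr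
    · intro i hi k hk h
      simp only [Finset.coe_filter, Set.mem_ofPred_eq] at hi hk
      apply hν hi.1 hk.1
      simp only at h
      omega
  · refine (Finset.sum_le_sum fun i hi => ?_).trans
      (sum_inv_one_add_sq_le_of_injOn hα _ (fun i => (⌈y⌉ - 1 - ν i).toNat) ?_)
    · rw [Finset.mem_filter, not_le] at hi
      have h1 : (((⌈y⌉ - 1 - ν i).toNat : ℕ) : ℝ) = (⌈y⌉ : ℝ) - 1 - ν i := by
        have := Int.toNat_of_nonneg (a := ⌈y⌉ - 1 - ν i) (by omega)
        exact_mod_cast congrArg (Int.cast (R := ℝ)) this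
      have h2 := Int.ceil_lt_add_one y
      have h3 : ((⌈y⌉ - 1 - ν i).toNat : ℝ) ≤ |y - ν i| := by
        rw [h1]
        exact le_trans (by linarith) (le_abs_self _)
      gcongr
    · intro i hi k hk h
      simp only [Finset.coe_filter, Set.mem_ofPred_eq] at hi hk
      apply hν hi.1 hk.1
      simp only at h
      omega

theorem lintegral_Ico_natCast (v : ℝ → ℝ≥0∞) (D : ℕ) :
    ∫⁻ z in Set.Ico (0:ℝ) D, v z = ∑ n ∈ Finset.range D, ∫⁻ y in Set.Ico (0:ℝ) 1, v (y + n) := by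
  induction D with
  | zero => simp
  | succ D ih =>
    have hu : Set.Ico (0:ℝ) ((D + 1 : ℕ) : ℝ) = Set.Ico 0 (D:ℝ) ∪ Set.Ico (D:ℝ) ((D + 1 : ℕ) : ℝ) :=
      (Set.Ico_union_Ico_eq_Ico (by positivity) (by push_cast; linarith)).symm
    have hd : Disjoint (Set.Ico (0:ℝ) (D:ℝ)) (Set.Ico (D:ℝ) ((D + 1 : ℕ) : ℝ)) := by
      rw [Set.disjoint_left]; intro x hx hx'; exact absurd hx.2 (not_lt.2 hx'.1)
    rw [hu, lintegral_union measurableSet_Ico hd, ih, Finset.sum_range_succ]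
    congr 1
    rw [← lintegral_indicator measurableSet_Ico, ← lintegral_indicator measurableSet_Ico,
      ← lintegral_add_right_eq_self _ (D:ℝ)]
    congr 1; ext y
    by_cases hy : y ∈ Set.Ico (0:ℝ) 1
    · rw [Set.indicator_of_mem hy, Set.indicator_of_mem]
      exact ⟨by linarith [hy.1], by push_cast; linarith [hy.2]⟩
    · rw [Set.indicator_of_notMem hy, Set.indicator_of_notMem]
      intro h
      exact hy ⟨by linarith [h.1], by have := h.2; push_cast at this; linarith⟩

theorem lintegral_comp_mul_pos {v : ℝ → ℝ≥0∞} (hv : Measurable v) {a : ℝ} (ha : 0 < a) :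
    ∫⁻ x, v x = ENNReal.ofReal a * ∫⁻ x, v (a * x) := by
  conv_lhs => rw [← Real.smul_map_volume_mul_left ha.ne']
  rw [lintegral_smul_measure, lintegral_map hv (measurable_const_mul a), abs_of_pos ha, smul_eq_mul]

/-- Splitting an integral over the unit interval into dyadic cells. -/
theorem lintegral_unit_eq_sum_cells {u : ℝ → ℝ≥0∞} (hu : Measurable u) {D : ℕ} (hD : 0 < D) :
    ∫⁻ x in Set.Ico (0:ℝ) 1, u x
      = (D : ℝ≥0∞)⁻¹ * ∑ n ∈ Finset.range D, ∫⁻ y in Set.Ico (0:ℝ) 1, u ((y + n) / D) := by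
  have hD' : (0:ℝ) < D := by exact_mod_cast hD
  rw [← lintegral_Ico_natCast (fun z => u (z / D)), ← lintegral_indicator measurableSet_Ico,
    ← lintegral_indicator measurableSet_Ico,
    lintegral_comp_mul_pos (hu.indicator measurableSet_Ico) (inv_pos.2 hD'),
    ENNReal.ofReal_inv_of_pos hD', ENNReal.ofReal_natCast]
  congr 2; ext z
  simp only [Set.indicator_apply, Set.mem_Ico, ← div_eq_inv_mul, div_lt_one hD']
  have : 0 ≤ z / D ↔ 0 ≤ z := by
    constructor
    · intro h
      have := mul_nonneg h hD'.le
      rwa [div_mul_cancel₀ _ hD'.ne'] at this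
    · intro h; positivity
  simp only [this]

/-- Functions of disjoint blocks of binary digits are independent. -/
theorem lintegral_prod_digit_blocks (M : ℕ) (e : ℤ → ℝ≥0∞) (he : ∀ z n : ℤ, e (z + 2 ^ M * n) = e z)
    (S : Finset ℕ) (hS : ∀ b ∈ S, ∀ b' ∈ S, b < b' → b + M ≤ b') :
    ∫⁻ x in Set.Ico (0:ℝ) 1, ∏ b ∈ S, e ⌊2 ^ M * (2 ^ b * x)⌋
      = ((2 ^ M : ℝ≥0∞)⁻¹ * ∑ n ∈ Finset.range (2 ^ M), e n) ^ S.card := by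
  have hmeas : ∀ b : ℕ, Measurable fun x : ℝ => e ⌊2 ^ M * (2 ^ b * x)⌋ := fun b =>
    (measurable_of_countable e).comp (Int.measurable_floor.comp (by fun_prop))
  have hfloor : ∀ (y : ℝ), y ∈ Set.Ico (0:ℝ) 1 → ∀ n : ℕ, ⌊y + n⌋ = (n : ℤ) := by
    intro y hy n
    rw [Int.floor_add_natCast, Int.floor_eq_zero_iff.2 hy, zero_add]
  have hsingle : ∫⁻ y in Set.Ico (0:ℝ) 1, e ⌊2 ^ M * y⌋
      = (2 ^ M : ℝ≥0∞)⁻¹ * ∑ n ∈ Finset.range (2 ^ M), e n := by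
    have := lintegral_unit_eq_sum_cells (u := fun y => e ⌊2 ^ M * y⌋)
      (by simpa using hmeas 0) (D := 2 ^ M) (by positivity)
    rw [this]
    push_cast
    congr 1
    refine Finset.sum_congr rfl fun n _ => ?_
    have : ∀ y ∈ Set.Ico (0:ℝ) 1, e ⌊(2:ℝ) ^ M * ((y + n) / 2 ^ M)⌋ = e n := fun y hy => by
      rw [mul_div_cancel₀ _ (by positivity), hfloor y hy]
    rw [setLIntegral_congr_fun measurableSet_Ico this]
    simp
  induction S using Finset.induction_on_max with
  | empty => simp
  | insert B S hB ih =>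
    have hBS : B ∉ S := fun h => lt_irrefl _ (hB B h)
    rw [Finset.card_insert_of_notMem hBS, pow_succ, ← ih (fun b hb b' hb' => hS b
      (Finset.mem_insert_of_mem hb) b' (Finset.mem_insert_of_mem hb')), ← hsingle]
    simp only [Finset.prod_insert hBS]
    have hP : Measurable fun x : ℝ => ∏ b ∈ S, e ⌊2 ^ M * (2 ^ b * x)⌋ :=
      Finset.measurable_fun_prod _ fun b _ => hmeas b
    have hconst : ∀ n : ℕ, ∀ y ∈ Set.Ico (0:ℝ) 1,
        ∏ b ∈ S, e ⌊2 ^ M * (2 ^ b * ((y + n) / ((2 ^ B : ℕ) : ℝ)))⌋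
          = ∏ b ∈ S, e ⌊2 ^ M * (2 ^ b * ((n : ℝ) / ((2 ^ B : ℕ) : ℝ)))⌋ := by
      intro n y hy
      refine Finset.prod_congr rfl fun b hb => ?_
      have hb' : b + M ≤ B := hS b (Finset.mem_insert_of_mem hb) B (Finset.mem_insert_self _ _) (hB b hb)
      obtain ⟨d, rfl⟩ := Nat.exists_eq_add_of_le hb'
      have key : ∀ w : ℝ, (2:ℝ) ^ M * (2 ^ b * (w / ((2 ^ (b + M + d) : ℕ) : ℝ)))
          = w / ((2 ^ d : ℕ) : ℝ) := by
        intro w; push_cast; rw [pow_add, pow_add]; field_simp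
      have hfd : ∀ w : ℝ, ⌊w / ((2 ^ d : ℕ) : ℝ)⌋ = ⌊w⌋ / ((2 ^ d : ℕ) : ℤ) := fun w =>
        Int.floor_div_natCast w _
      rw [key, key, hfd, hfd, hfloor y hy, Int.floor_natCast]
    have hBP : Measurable fun x : ℝ =>
        e ⌊2 ^ M * (2 ^ B * x)⌋ * ∏ b ∈ S, e ⌊2 ^ M * (2 ^ b * x)⌋ := (hmeas B).mul hP
    rw [lintegral_unit_eq_sum_cells hBP (D := 2 ^ B) (by positivity),
      lintegral_unit_eq_sum_cells hP (D := 2 ^ B) (by positivity), mul_assoc, Finset.sum_mul]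
    congr 1
    refine Finset.sum_congr rfl fun n _ => ?_
    rw [setLIntegral_congr_fun measurableSet_Ico (hconst n)]
    have h2 : ∀ y ∈ Set.Ico (0:ℝ) 1,
        e ⌊2 ^ M * (2 ^ B * ((y + n) / ((2 ^ B : ℕ) : ℝ)))⌋ *
          ∏ b ∈ S, e ⌊2 ^ M * (2 ^ b * ((y + n) / ((2 ^ B : ℕ) : ℝ)))⌋
        = (∏ b ∈ S, e ⌊2 ^ M * (2 ^ b * ((n : ℝ) / ((2 ^ B : ℕ) : ℝ)))⌋) * e ⌊2 ^ M * y⌋ := by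
      intro y hy
      rw [hconst n y hy, mul_comm]
      congr 1
      rw [← he ⌊2 ^ M * y⌋ n, ← Int.floor_add_intCast]
      congr 2
      push_cast
      field_simp
    rw [setLIntegral_congr_fun measurableSet_Ico h2, lintegral_const_mul _ (by simpa using hmeas 0)]
    simp

/-- A one-periodic sum of bumps at the scales `2⁻ᵐ`, `N < m ≤ 2N`, centred at the integers. -/
def bumpSum (N : ℕ) (y : ℝ) : ℝ :=
  ∑ m ∈ Finset.Icc (N + 1) (2 * N), 2 ^ m * ((1 + 2 ^ m * |y - round y|) ^ 2)⁻¹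

theorem bumpSum_nonneg (N : ℕ) (y : ℝ) : 0 ≤ bumpSum N y :=
  Finset.sum_nonneg fun _ _ => by positivity

theorem measurable_bumpSum (N : ℕ) : Measurable (bumpSum N) := by
  unfold bumpSum
  have : Measurable (fun y : ℝ => (round y : ℝ)) := by
    simp only [round_eq]
    exact (measurable_of_countable (fun z : ℤ => (z : ℝ))).comp
      (Int.measurable_floor.comp (by fun_prop))
  fun_prop

theorem bumpSum_add_int (N : ℕ) (y : ℝ) (n : ℤ) : bumpSum N (y + n) = bumpSum N y := by
  simp [bumpSum, round_add_intCast]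

theorem sum_Icc_two_pow_le (a b : ℕ) : ∑ m ∈ Finset.Icc a b, (2:ℝ) ^ m ≤ 2 * 2 ^ b := by
  refine (Finset.sum_le_sum_of_subset_of_nonneg (t := Finset.range (b + 1))
    (fun m hm => by simp at hm ⊢; omega) (fun _ _ _ => by positivity)).trans ?_
  rw [geom_sum_eq (by norm_num)]
  rw [pow_succ]
  linarith

theorem bumpSum_le (N : ℕ) (y : ℝ) : bumpSum N y ≤ 2 * 4 ^ N := by
  have h := sum_Icc_two_pow_le (N + 1) (2 * N)
  rw [pow_mul] at h
  norm_num at h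
  refine (Finset.sum_le_sum fun m _ => ?_).trans h
  refine mul_le_of_le_one_right (by positivity) (inv_le_one_of_one_le₀ ?_)
  have : 0 ≤ (2:ℝ) ^ m * |y - round y| := by positivity
  nlinarith

theorem bumpSum_le_floor (N : ℕ) (y : ℝ) :
    bumpSum N y ≤ 4 * bumpSum N ((⌊2 ^ (2 * N) * y⌋ : ℝ) / 2 ^ (2 * N)) := by
  set R : ℝ := 2 ^ (2 * N) with hR
  have hR0 : 0 < R := by positivity
  set y' : ℝ := (⌊R * y⌋ : ℝ) / R with hy'
  have hyy : |y' - y| ≤ 1 / R := by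
    have h1 := Int.floor_le (R * y)
    have h2 := Int.lt_floor_add_one (R * y)
    have : y' - y = (⌊R * y⌋ - R * y) / R := by rw [hy']; field_simp
    rw [this, abs_div, abs_of_pos hR0]
    gcongr
    rw [abs_le]; constructor <;> linarith
  rw [bumpSum, bumpSum, Finset.mul_sum]
  refine Finset.sum_le_sum fun m hm => ?_
  have hm : (2:ℝ) ^ m ≤ R := by
    rw [hR]; exact pow_le_pow_right₀ (by norm_num) (Finset.mem_Icc.1 hm).2
  have h1 : |y' - round y'| ≤ |y - round y| + 1 / R := by
    refine (round_le y' (round y)).trans ?_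
    have := abs_add_le (y' - y) (y - round y)
    rw [sub_add_sub_cancel] at this
    linarith
  have h2 : 1 + 2 ^ m * |y' - round y'| ≤ 2 * (1 + 2 ^ m * |y - round y|) := by
    have : (2:ℝ) ^ m * (1 / R) ≤ 1 := by rw [mul_one_div, div_le_one hR0]; exact hm
    have h3 : 2 ^ m * |y' - round y'| ≤ 2 ^ m * (|y - round y| + 1 / R) := by gcongr
    have : 0 ≤ (2:ℝ) ^ m * |y - round y| := by positivity
    rw [mul_add] at h3
    linarith
  have h3 : (1 + 2 ^ m * |y' - round y'|) ^ 2 ≤ 4 * (1 + 2 ^ m * |y - round y|) ^ 2 := by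
    refine (pow_le_pow_left₀ (by positivity) h2 2).trans_eq (by ring)
  rw [mul_left_comm]
  gcongr
  rw [inv_le_iff_one_le_mul₀ (by positivity), mul_comm (4:ℝ), mul_assoc, ← div_eq_inv_mul,
    one_le_div (by positivity)]
  exact h3

theorem sum_bumpSum_le (N : ℕ) :
    ∑ n ∈ Finset.range (2 ^ (2 * N)), bumpSum N ((n : ℝ) / 2 ^ (2 * N))
      ≤ 8 * N * 2 ^ (2 * N) := by
  set R : ℝ := 2 ^ (2 * N) with hR
  have hR0 : 0 < R := by positivity
  simp only [bumpSum]
  rw [Finset.sum_comm]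
  have hm : ∀ m ∈ Finset.Icc (N + 1) (2 * N), ∑ n ∈ Finset.range (2 ^ (2 * N)),
      (2:ℝ) ^ m * ((1 + 2 ^ m * |(n : ℝ) / R - round ((n : ℝ) / R)|) ^ 2)⁻¹ ≤ 8 * R := by
    intro m hm
    have hmR : (2:ℝ) ^ m ≤ R := by
      rw [hR]; exact pow_le_pow_right₀ (by norm_num) (Finset.mem_Icc.1 hm).2
    have hα : 0 < (2:ℝ) ^ m / R := by positivity
    have hinj : Set.InjOn (fun n : ℕ => (n : ℤ)) (Finset.range (2 ^ (2 * N)) : Set ℕ) :=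
      fun _ _ _ _ h => by simpa using h
    have hs := fun y => sum_lattice_le hα (Finset.range (2 ^ (2 * N))) (fun n : ℕ => (n : ℤ)) hinj y
    have hb : ∀ n ∈ Finset.range (2 ^ (2 * N)),
        ((1 + 2 ^ m * |(n : ℝ) / R - round ((n : ℝ) / R)|) ^ 2)⁻¹
          ≤ ((1 + 2 ^ m / R * |0 - ((n : ℤ) : ℝ)|) ^ 2)⁻¹
            + ((1 + 2 ^ m / R * |R - ((n : ℤ) : ℝ)|) ^ 2)⁻¹ := by
      intro n hn
      have hn1 : (n : ℝ) / R < 1 := by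
        rw [div_lt_one hR0, hR]; exact_mod_cast Finset.mem_range.1 hn
      have hn0 : 0 ≤ (n : ℝ) / R := by positivity
      have hr : round ((n : ℝ) / R) = 0 ∨ round ((n : ℝ) / R) = 1 := by
        rw [round_eq]
        have h1 : 0 ≤ ⌊(n : ℝ) / R + 1 / 2⌋ := Int.floor_nonneg.2 (by positivity)
        have h2 : ⌊(n : ℝ) / R + 1 / 2⌋ < 2 := Int.floor_lt.2 (by push_cast; linarith)
        omega
      have hab : ∀ z : ℝ, 2 ^ m * |(n : ℝ) / R - z| = 2 ^ m / R * |R * z - ((n : ℤ) : ℝ)| := by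
        intro z
        rw [abs_sub_comm, show R * z - ((n : ℤ) : ℝ) = R * (z - n / R) by push_cast; field_simp,
          abs_mul, abs_of_pos hR0]
        field_simp
      rcases hr with h | h
      · rw [h, hab]; simp only [Int.cast_zero, mul_zero]
        exact le_add_of_nonneg_right (by positivity)
      · rw [h, hab]; simp only [Int.cast_one, mul_one]
        exact le_add_of_nonneg_left (by positivity)
    rw [← Finset.mul_sum]
    have hsum := (Finset.sum_le_sum hb).trans_eq Finset.sum_add_distrib
    have h4 : ∑ n ∈ Finset.range (2 ^ (2 * N)),
        ((1 + 2 ^ m * |(n : ℝ) / R - round ((n : ℝ) / R)|) ^ 2)⁻¹ ≤ 4 * (1 + R / 2 ^ m) := by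
      have := hs 0
      have := hs R
      rw [inv_div] at *
      linarith
    calc (2:ℝ) ^ m * _ ≤ 2 ^ m * (4 * (1 + R / 2 ^ m)) := by gcongr
      _ = 4 * (2 ^ m + R) := by field_simp
      _ ≤ 8 * R := by linarith
  refine (Finset.sum_le_card_nsmul _ _ _ hm).trans_eq ?_
  rw [nsmul_eq_mul, Nat.card_Icc, show 2 * N + 1 - (N + 1) = N by omega]
  ring

theorem rpow_le_rpow_self_mul_exp {r x : ℝ} (hr : 0 < r) (hx : 0 ≤ x) :
    x ^ r ≤ r ^ r * Real.exp x := by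
  have h1 : x / r ≤ Real.exp (x / r) := by linarith [Real.add_one_le_exp (x / r)]
  calc x ^ r = r ^ r * (x / r) ^ r := by
        rw [← Real.mul_rpow hr.le (by positivity), mul_div_cancel₀ _ hr.ne']
    _ ≤ r ^ r * Real.exp (x / r) ^ r := by gcongr
    _ = r ^ r * Real.exp x := by rw [← Real.exp_mul, div_mul_cancel₀ _ hr.ne']

/-- Moment bound for sums of bump functions at widely separated frequencies. -/
theorem lintegral_sum_bumpSum_rpow_le {r : ℝ} (hr : 0 < r) {N : ℕ} (hN : 0 < N) (S : Finset ℕ)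
    (hS : ∀ b ∈ S, ∀ b' ∈ S, b < b' → b + 2 * N ≤ b') (hcard : S.card ≤ 4 ^ N) :
    ∫⁻ x in Set.Ico (0:ℝ) 1, ENNReal.ofReal ((∑ b ∈ S, bumpSum N (2 ^ b * x)) ^ r)
      ≤ ENNReal.ofReal ((8 * 4 ^ N * N) ^ r * (r ^ r * Real.exp 8)) := by
  have hN' : (1:ℝ) ≤ N := by exact_mod_cast hN
  set t : ℝ := (8 * 4 ^ N * N)⁻¹ with ht
  have ht0 : 0 < t := by positivity
  set e : ℤ → ℝ≥0∞ := fun z => ENNReal.ofReal (Real.exp (4 * t * bumpSum N (z / 2 ^ (2 * N))))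
    with he
  have hper : ∀ z n : ℤ, e (z + 2 ^ (2 * N) * n) = e z := by
    intro z n
    simp only [he]
    rw [← bumpSum_add_int N ((z : ℝ) / 2 ^ (2 * N)) n]
    congr 5
    push_cast
    field_simp
  have hmean : (2 ^ (2 * N) : ℝ≥0∞)⁻¹ * ∑ n ∈ Finset.range (2 ^ (2 * N)), e n
      ≤ ENNReal.ofReal (Real.exp (8 / 4 ^ N)) := by
    have hx : ∀ n : ℕ, Real.exp (4 * t * bumpSum N ((n : ℝ) / 2 ^ (2 * N)))
        ≤ 1 + 8 * t * bumpSum N ((n : ℝ) / 2 ^ (2 * N)) := by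
      intro n
      set u := 4 * t * bumpSum N ((n : ℝ) / 2 ^ (2 * N)) with hu
      have hb := bumpSum_le N ((n : ℝ) / 2 ^ (2 * N))
      have hb0 := bumpSum_nonneg N ((n : ℝ) / 2 ^ (2 * N))
      have hu0 : 0 ≤ u := by positivity
      have hu1 : u ≤ 1 := by
        calc u ≤ 4 * t * (2 * 4 ^ N) := by rw [hu]; gcongr
          _ = 1 / N := by rw [ht]; field_simp; norm_num
          _ ≤ 1 := by rw [div_le_one (by linarith)]; exact hN'
      have := Real.abs_exp_sub_one_le (x := u) (by rw [abs_of_nonneg hu0]; exact hu1)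
      rw [abs_of_nonneg hu0] at this
      have := (abs_le.1 this).2
      have h8 : 8 * t * bumpSum N ((n : ℝ) / 2 ^ (2 * N)) = 2 * u := by rw [hu]; ring
      rw [h8]; linarith
    have hsum : ∑ n ∈ Finset.range (2 ^ (2 * N)),
        Real.exp (4 * t * bumpSum N ((n : ℝ) / 2 ^ (2 * N)))
          ≤ 2 ^ (2 * N) * Real.exp (8 / 4 ^ N) := by
      refine (Finset.sum_le_sum fun n _ => hx n).trans ?_
      rw [Finset.sum_add_distrib, ← Finset.mul_sum]
      have h1 := sum_bumpSum_le N
      have h2 : 8 * t * ∑ n ∈ Finset.range (2 ^ (2 * N)), bumpSum N ((n : ℝ) / 2 ^ (2 * N))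
          ≤ 8 * t * (8 * N * 2 ^ (2 * N)) := by gcongr
      have h3 : 8 * t * (8 * N * 2 ^ (2 * N)) = 2 ^ (2 * N) * (8 / 4 ^ N) := by
        rw [ht]; field_simp
      have h4 := Real.add_one_le_exp (8 / (4:ℝ) ^ N)
      simp only [Finset.sum_const, Finset.card_range, nsmul_eq_mul, mul_one]
      push_cast
      have h5 : (2:ℝ) ^ (2 * N) * (8 / 4 ^ N + 1) ≤ 2 ^ (2 * N) * Real.exp (8 / 4 ^ N) := by gcongr
      linarith
    simp only [he, Int.cast_natCast]
    rw [← ENNReal.ofReal_sum_of_nonneg (fun _ _ => (Real.exp_pos _).le)]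
    have h2 : (2 ^ (2 * N) : ℝ≥0∞)⁻¹ = ENNReal.ofReal ((2 ^ (2 * N))⁻¹) := by
      rw [ENNReal.ofReal_inv_of_pos (by positivity), ENNReal.ofReal_pow (by norm_num)]
      norm_num
    rw [h2, ← ENNReal.ofReal_mul (by positivity)]
    apply ENNReal.ofReal_le_ofReal
    rw [inv_mul_le_iff₀ (by positivity)]
    exact hsum
  have hpt : ∀ x : ℝ, ENNReal.ofReal ((∑ b ∈ S, bumpSum N (2 ^ b * x)) ^ r)
      ≤ ENNReal.ofReal ((8 * 4 ^ N * N) ^ r * r ^ r) *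
          ∏ b ∈ S, e ⌊2 ^ (2 * N) * (2 ^ b * x)⌋ := by
    intro x
    simp only [he]
    rw [← ENNReal.ofReal_prod_of_nonneg (fun _ _ => (Real.exp_pos _).le),
      ← ENNReal.ofReal_mul (by positivity), ← Real.exp_sum, ← Finset.mul_sum]
    apply ENNReal.ofReal_le_ofReal
    set G := ∑ b ∈ S, bumpSum N (2 ^ b * x) with hG
    have hG0 : 0 ≤ G := Finset.sum_nonneg fun _ _ => bumpSum_nonneg _ _
    have h1 : G ^ r = (8 * 4 ^ N * N) ^ r * (t * G) ^ r := by
      rw [← Real.mul_rpow (x := 8 * 4 ^ N * N) (y := t * G) (by positivity) (by positivity), ht,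
        mul_inv_cancel_left₀ (by positivity : (8 * 4 ^ N * N : ℝ) ≠ 0)]
    rw [h1, mul_assoc (_ ^ r) (r ^ r)]
    refine mul_le_mul_of_nonneg_left ?_ (by positivity)
    refine (rpow_le_rpow_self_mul_exp hr (x := t * G) (by positivity)).trans ?_
    refine mul_le_mul_of_nonneg_left (Real.exp_le_exp.2 ?_) (by positivity)
    have h2 : G ≤ 4 * ∑ b ∈ S, bumpSum N ((⌊(2:ℝ) ^ (2 * N) * (2 ^ b * x)⌋ : ℝ) / 2 ^ (2 * N)) := by
      rw [Finset.mul_sum]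
      exact Finset.sum_le_sum fun b _ => bumpSum_le_floor N _
    have h3 := mul_le_mul_of_nonneg_left h2 ht0.le
    linarith
  refine (lintegral_mono hpt).trans ?_
  rw [lintegral_const_mul', lintegral_prod_digit_blocks (2 * N) e hper S hS,
    ← mul_assoc, ENNReal.ofReal_mul (q := Real.exp 8) (by positivity)]
  · gcongr
    refine (pow_le_pow_left₀ (by positivity) hmean _).trans ?_
    rw [← ENNReal.ofReal_pow (Real.exp_pos _).le]
    apply ENNReal.ofReal_le_ofReal
    rw [← Real.exp_nat_mul]
    gcongr
    have : (S.card : ℝ) ≤ 4 ^ N := by exact_mod_cast hcard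
    calc (S.card : ℝ) * (8 / 4 ^ N) ≤ 4 ^ N * (8 / 4 ^ N) := by gcongr
      _ = 8 := by field_simp
  · exact ENNReal.ofReal_ne_top

/-- Integrating a periodic function against a quadratically decaying weight. -/
theorem lintegral_weight_mul_periodic_le {g : ℝ → ℝ≥0∞} (hg : Measurable g)
    (hper : ∀ (x : ℝ) (n : ℤ), g (x + n) = g x) :
    ∫⁻ x : ℝ, ENNReal.ofReal (((1 + |x|) ^ 2)⁻¹) * g x ≤ 4 * ∫⁻ x in Set.Ico (0:ℝ) 1, g x := by
  set w : ℝ → ℝ≥0∞ := fun x => ENNReal.ofReal (((1 + |x|) ^ 2)⁻¹) with hw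
  have hwm : Measurable w := by fun_prop
  have hcell : ∀ n : ℤ, ∫⁻ x in Set.Ico (n:ℝ) (n + 1), w x * g x
      = ∫⁻ x in Set.Ico (0:ℝ) 1, w (x + n) * g x := by
    intro n
    rw [← lintegral_indicator measurableSet_Ico, ← lintegral_indicator measurableSet_Ico,
      ← lintegral_add_right_eq_self _ (n:ℝ)]
    congr 1; ext x
    have : x + n ∈ Set.Ico (n:ℝ) (n + 1) ↔ x ∈ Set.Ico (0:ℝ) 1 := by
      simp only [Set.mem_Ico]; constructor <;> rintro ⟨h1, h2⟩ <;> constructor <;> linarith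
    simp only [Set.indicator_apply, this, hper]
  change ∫⁻ x : ℝ, w x * g x ≤ _
  rw [← setLIntegral_univ, ← iUnion_Ico_intCast ℝ,
    lintegral_iUnion (fun _ => measurableSet_Ico) (Set.pairwise_disjoint_Ico_intCast ℝ)]
  simp only [hcell]
  rw [← lintegral_tsum (fun n => by fun_prop), ← lintegral_const_mul _ hg]
  refine lintegral_mono fun x => ?_
  simp only [ENNReal.tsum_mul_right]
  gcongr
  rw [ENNReal.tsum_eq_iSup_sum]
  refine iSup_le fun T => ?_
  simp only [hw]
  rw [← ENNReal.ofReal_sum_of_nonneg (fun _ _ => by positivity)]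
  have h := sum_lattice_le one_pos T (fun n : ℤ => -n) (fun a _ b _ h => by simpa using h) x
  simp only [Int.cast_neg, sub_neg_eq_add, one_mul, inv_one] at h
  refine (ENNReal.ofReal_le_ofReal h).trans ?_
  norm_num

/-- The sum of the `2^b + 1` dilated copies of `g` centred at the points of `2⁻ᵇℤ ∩ [0, 1]`. -/
def blockSum (g : ℝ → ℂ) (b m : ℕ) (x : ℝ) : ℂ :=
  ∑ ν ∈ Finset.range (2 ^ b + 1), g (2 ^ (b + m) * (x - ν / 2 ^ b))

theorem norm_blockSum_le {g : ℝ → ℂ} {K : ℝ} (hK : 0 ≤ K)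
    (hg : ∀ x, ‖g x‖ ≤ K * ((1 + |x|) ^ 6)⁻¹) (b m : ℕ) (x : ℝ) :
    ‖blockSum g b m x‖ ≤ 16 * K * (((1 + |x|) ^ 2)⁻¹ *
      ((1 + 2 ^ m * |2 ^ b * x - round (2 ^ b * x)|) ^ 2)⁻¹) := by
  set Y := 1 + 2 ^ m * |2 ^ b * x - round (2 ^ b * x)| with hY
  have hY0 : 0 < Y := by positivity
  have hterm : ∀ ν ∈ Finset.range (2 ^ b + 1), ‖g (2 ^ (b + m) * (x - ν / 2 ^ b))‖
      ≤ (4 * K * (((1 + |x|) ^ 2)⁻¹ * (Y ^ 2)⁻¹)) *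
        ((1 + 2 ^ m * |2 ^ b * x - ((ν : ℤ) : ℝ)|) ^ 2)⁻¹ := by
    intro ν hν
    have hν' : (ν : ℝ) / 2 ^ b ≤ 1 := by
      rw [div_le_one (by positivity)]
      exact_mod_cast Nat.lt_succ_iff.1 (Finset.mem_range.1 hν)
    have hν0 : 0 ≤ (ν : ℝ) / 2 ^ b := by positivity
    have harg : (2:ℝ) ^ (b + m) * (x - ν / 2 ^ b) = 2 ^ m * (2 ^ b * x - ((ν : ℤ) : ℝ)) := by
      rw [pow_add]; push_cast; field_simp
    set V := 1 + 2 ^ m * |2 ^ b * x - ((ν : ℤ) : ℝ)| with hV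
    have hV0 : 0 < V := by positivity
    have hVY : Y ≤ V := by
      exact add_le_add le_rfl (mul_le_mul_of_nonneg_left (round_le (2 ^ b * x) (ν : ℤ)) (by positivity))
    have hVx : 1 + |x| ≤ 2 * V := by
      have h1 : |x| ≤ |x - ν / 2 ^ b| + 1 := by
        have := abs_add_le (x - ν / 2 ^ b) (ν / 2 ^ b)
        rw [sub_add_cancel, abs_of_nonneg hν0] at this
        linarith
      have h2 : |x - ν / 2 ^ b| ≤ 2 ^ m * |2 ^ b * x - ((ν : ℤ) : ℝ)| := by
        have : 2 ^ m * |2 ^ b * x - ((ν : ℤ) : ℝ)| = 2 ^ (b + m) * |x - ν / 2 ^ b| := by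
          rw [← abs_of_pos (show (0:ℝ) < 2 ^ m by positivity), ← abs_mul, ← harg, abs_mul,
            abs_of_pos (show (0:ℝ) < 2 ^ (b + m) by positivity)]
        rw [this]
        exact le_mul_of_one_le_left (abs_nonneg _) (one_le_pow₀ (by norm_num))
      linarith [abs_nonneg (x - ν / 2 ^ b)]
    refine (hg _).trans ?_
    rw [harg, abs_mul, abs_of_pos (show (0:ℝ) < 2 ^ m by positivity), ← hV]
    have h3 : (V ^ 6)⁻¹ = (V ^ 2)⁻¹ * (V ^ 2)⁻¹ * (V ^ 2)⁻¹ := by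
      rw [← mul_inv, ← mul_inv]; congr 1; ring
    have h4 : (V ^ 2)⁻¹ ≤ 4 * ((1 + |x|) ^ 2)⁻¹ := by
      rw [inv_le_iff_one_le_mul₀ (by positivity), mul_assoc, mul_comm, mul_assoc,
        ← div_eq_inv_mul, one_le_div (by positivity)]
      nlinarith [abs_nonneg x]
    have h5 : (V ^ 2)⁻¹ ≤ (Y ^ 2)⁻¹ := by gcongr
    rw [h3]
    calc K * ((V ^ 2)⁻¹ * (V ^ 2)⁻¹ * (V ^ 2)⁻¹)
        ≤ K * (4 * ((1 + |x|) ^ 2)⁻¹ * (Y ^ 2)⁻¹ * (V ^ 2)⁻¹) := by gcongr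
      _ = _ := by ring
  refine (norm_sum_le _ _).trans ((Finset.sum_le_sum hterm).trans ?_)
  rw [← Finset.mul_sum]
  have hs := sum_lattice_le (α := 2 ^ m) (by positivity) (Finset.range (2 ^ b + 1))
    (fun n : ℕ => (n : ℤ)) (fun _ _ _ _ h => by simpa using h) (2 ^ b * x)
  have h2 : ((2:ℝ) ^ m)⁻¹ ≤ 1 := inv_le_one_of_one_le₀ (one_le_pow₀ (by norm_num))
  calc _ ≤ (4 * K * (((1 + |x|) ^ 2)⁻¹ * (Y ^ 2)⁻¹)) * 4 := by
        gcongr; linarith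
    _ = _ := by ring

theorem SchwartzMap.exists_comp_scale_shift (θ : SchwartzMap ℝ ℂ) {a : ℝ} (ha : a ≠ 0) (y : ℝ) :
    ∃ g : SchwartzMap ℝ ℂ, ∀ x, g x = θ (a * (x - y)) := by
  refine ⟨SchwartzMap.compSubConstCLM ℝ y (SchwartzMap.compCLMOfContinuousLinearEquiv ℝ
    (ContinuousLinearEquiv.unitsEquivAut ℝ (Units.mk0 a ha)) θ), fun x => ?_⟩
  simp [mul_comm]

theorem fourier_deriv_support {θ : SchwartzMap ℝ ℂ} {ξ : ℝ}
    (h : 𝓕 (deriv (θ : ℝ → ℂ)) ξ ≠ 0) : 𝓕 (θ : ℝ → ℂ) ξ ≠ 0 := by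
  rw [Real.fourier_deriv θ.integrable θ.differentiable
    (SchwartzMap.derivCLM ℝ ℂ θ).integrable] at h
  intro h0
  simp [h0] at h

/-- The primitive of the test function. -/
def testPot (θ : ℝ → ℂ) (A : ℕ → ℝ) (N : ℕ) (S : Finset ℕ) (x : ℝ) : ℂ :=
  ∑ i ∈ S ×ˢ Finset.Icc (N + 1) (2 * N), A i.1 * blockSum θ i.1 i.2 x

theorem exists_testFn {φ₀ : ℝ → ℂ} (hφsmooth : ContDiff ℝ (⊤ : ℕ∞) φ₀)
    (hφcpt : HasCompactSupport φ₀)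
    (hφone : ∀ ξ : ℝ, |ξ| ≤ 4/3 → φ₀ ξ = 1) (hφzero : ∀ ξ : ℝ, 3/2 ≤ |ξ| → φ₀ ξ = 0)
    {θ : SchwartzMap ℝ ℂ} (hθ : ∀ ξ, 𝓕 (θ : ℝ → ℂ) ξ ≠ 0 → 3/4 ≤ |ξ| ∧ |ξ| ≤ 4/3)
    (A : ℕ → ℝ) (N : ℕ) (S : Finset ℕ) :
    ∃ f : SchwartzMap ℝ ℂ, (∀ x, HasDerivAt (testPot θ A N S) (f x) x) ∧
      ∀ l x, LPop φ₀ l f x = ∑ i ∈ S ×ˢ Finset.Icc (N + 1) (2 * N) with i.1 + i.2 = l,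
        (A i.1 * 2 ^ (i.1 + i.2) : ℂ) * blockSum (deriv θ) i.1 i.2 x := by
  choose atom hatom using fun (i : ℕ × ℕ) (ν : ℕ) =>
    SchwartzMap.exists_comp_scale_shift (SchwartzMap.derivCLM ℝ ℂ θ)
      (a := 2 ^ (i.1 + i.2)) (by positivity) ((ν : ℝ) / 2 ^ i.1)
  simp only [SchwartzMap.derivCLM_apply] at hatom
  set piece : ℕ × ℕ → SchwartzMap ℝ ℂ := fun i =>
    ∑ ν ∈ Finset.range (2 ^ i.1 + 1), (A i.1 * 2 ^ (i.1 + i.2) : ℂ) • atom i ν with hpiece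
  have hpx : ∀ i x, piece i x
      = (A i.1 * 2 ^ (i.1 + i.2) : ℂ) * blockSum (deriv θ) i.1 i.2 x := by
    intro i x
    simp [hpiece, sum_apply, hatom, blockSum, Finset.mul_sum]
  refine ⟨∑ i ∈ S ×ˢ Finset.Icc (N + 1) (2 * N), piece i, fun x => ?_, fun l x => ?_⟩
  · simp only [sum_apply, hpx]
    unfold testPot
    refine HasDerivAt.fun_sum fun i _ => ?_
    rw [mul_assoc]
    refine HasDerivAt.const_mul _ ?_
    unfold blockSum
    rw [Finset.mul_sum]
    refine HasDerivAt.fun_sum fun ν _ => ?_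
    have h1 : HasDerivAt (fun x : ℝ => (2:ℝ) ^ (i.1 + i.2) * (x - ν / 2 ^ i.1))
        ((2:ℝ) ^ (i.1 + i.2) * 1) x := ((hasDerivAt_id x).sub_const _).const_mul _
    have h2 := (θ.differentiable _).hasDerivAt.scomp x h1
    refine h2.congr_deriv ?_
    rw [Complex.real_smul]
    push_cast
    ring
  · rw [LPop_sum_of_annuli hφsmooth hφcpt hφone hφzero _ (fun i : ℕ × ℕ => i.1 + i.2)]
    · simp only [hpx]
    · intro i hi
      have := (Finset.mem_Icc.1 (Finset.mem_product.1 hi).2).1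
      omega
    · intro i hi ξ hξ
      have hF : 𝓕 (piece i : ℝ → ℂ) ξ = ∑ ν ∈ Finset.range (2 ^ i.1 + 1),
          (A i.1 * 2 ^ (i.1 + i.2) : ℂ) * 𝓕 (atom i ν : ℝ → ℂ) ξ := by
        have : 𝓕 (piece i) = ∑ ν ∈ Finset.range (2 ^ i.1 + 1),
            (A i.1 * 2 ^ (i.1 + i.2) : ℂ) • 𝓕 (atom i ν) := by
          change FourierTransform.fourierCLM ℂ (SchwartzMap ℝ ℂ) (piece i) = _
          rw [hpiece]
          simp only [map_sum, map_smul]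
          rfl
        rw [← SchwartzMap.fourier_coe, this]
        simp [sum_apply, SchwartzMap.fourier_coe]
      rw [hF] at hξ
      obtain ⟨ν, _, hν⟩ := Finset.exists_ne_zero_of_sum_ne_zero hξ
      have h1 := right_ne_zero_of_mul hν
      have h2 : (atom i ν : ℝ → ℂ) = fun x => deriv θ (2 ^ (i.1 + i.2) * (x - ν / 2 ^ i.1)) :=
        funext (hatom i ν)
      rw [h2, fourier_scale_shift (deriv θ) (by positivity)] at h1
      have h3 := hθ _ (fourier_deriv_support (right_ne_zero_of_mul h1))
      rw [abs_div, abs_of_pos (show (0:ℝ) < 2 ^ (i.1 + i.2) by positivity),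
        le_div_iff₀ (by positivity), div_le_iff₀ (by positivity)] at h3
      exact h3

/-- A lattice-block of the test function contributes a bump at every point of the lattice. -/
theorem two_rpow_mul_norm_blockSum_rpow_le {g : ℝ → ℂ} {K q : ℝ} (hK : 0 ≤ K) (hq : 1 < q)
    (hg : ∀ x, ‖g x‖ ≤ K * ((1 + |x|) ^ 6)⁻¹) (b m : ℕ) (x : ℝ) :
    (2:ℝ) ^ (((b + m : ℕ) : ℝ) * (-1 + 1 / q) * q) *
        ‖((((2:ℝ) ^ (-(b:ℝ) / q) : ℝ) : ℂ) * 2 ^ (b + m)) * blockSum g b m x‖ ^ q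
      ≤ ((16 * K) ^ q * (((1 + |x|) ^ 2)⁻¹) ^ q) *
        (2 ^ m * ((1 + 2 ^ m * |2 ^ b * x - round (2 ^ b * x)|) ^ 2)⁻¹) := by
  have hq0 : 0 < q := by linarith
  set B := ‖blockSum g b m x‖ with hB
  set Y := ((1 + 2 ^ m * |2 ^ b * x - round (2 ^ b * x)|) ^ 2)⁻¹ with hY
  have hY0 : 0 ≤ Y := by positivity
  have hY1 : Y ≤ 1 := by
    refine inv_le_one_of_one_le₀ (one_le_pow₀ ?_)
    have : 0 ≤ (2:ℝ) ^ m * |2 ^ b * x - round (2 ^ b * x)| := by positivity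
    linarith
  have hBle : B ≤ 16 * K * (((1 + |x|) ^ 2)⁻¹ * Y) := norm_blockSum_le hK hg b m x
  have hnorm : ‖((((2:ℝ) ^ (-(b:ℝ) / q) : ℝ) : ℂ) * 2 ^ (b + m)) * blockSum g b m x‖
      = (2:ℝ) ^ (-(b:ℝ) / q) * (2:ℝ) ^ ((b + m : ℕ) : ℝ) * B := by
    rw [norm_mul, norm_mul, Complex.norm_real, Real.norm_of_nonneg (by positivity), norm_pow,
      Real.rpow_natCast]
    simp [hB]
  have hpow : (2:ℝ) ^ (((b + m : ℕ) : ℝ) * (-1 + 1 / q) * q) *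
      ((2:ℝ) ^ (-(b:ℝ) / q) * (2:ℝ) ^ ((b + m : ℕ) : ℝ)) ^ q = 2 ^ m := by
    rw [← Real.rpow_add (by norm_num), ← Real.rpow_mul (by norm_num), ← Real.rpow_add (by norm_num),
      ← Real.rpow_natCast 2 m]
    congr 1
    push_cast
    field_simp
    ring
  rw [hnorm, Real.mul_rpow (by positivity) (norm_nonneg _), ← mul_assoc, hpow]
  have hBq : B ^ q ≤ (16 * K) ^ q * (((1 + |x|) ^ 2)⁻¹) ^ q * Y := by
    calc B ^ q ≤ (16 * K * (((1 + |x|) ^ 2)⁻¹ * Y)) ^ q := by gcongr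
      _ = (16 * K) ^ q * (((1 + |x|) ^ 2)⁻¹) ^ q * Y ^ q := by
        rw [Real.mul_rpow (by positivity) (by positivity), Real.mul_rpow (by positivity) hY0]
        ring
      _ ≤ _ := by
        gcongr
        exact Real.rpow_le_self_of_le_one hY0 hY1 hq.le
  calc 2 ^ m * B ^ q ≤ 2 ^ m * ((16 * K) ^ q * (((1 + |x|) ^ 2)⁻¹) ^ q * Y) := by gcongr
    _ = _ := by ring

theorem FNorm_testFn_le {φ₀ : ℝ → ℂ} {p q K : ℝ} (hq : 1 < q) (hqp : q ≤ p) (hK : 0 ≤ K)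
    {g : ℝ → ℂ} (hg : ∀ x, ‖g x‖ ≤ K * ((1 + |x|) ^ 6)⁻¹) {N : ℕ} (hN : 0 < N) (S : Finset ℕ)
    (hS : ∀ b ∈ S, ∀ b' ∈ S, b < b' → b + 2 * N ≤ b') (hcard : S.card ≤ 4 ^ N) {f : ℝ → ℂ}
    (hf : ∀ l x, LPop φ₀ l f x = ∑ i ∈ S ×ˢ Finset.Icc (N + 1) (2 * N) with i.1 + i.2 = l,
        ((((2:ℝ) ^ (-(i.1:ℝ) / q) : ℝ) : ℂ) * 2 ^ (i.1 + i.2)) * blockSum g i.1 i.2 x) :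
    FNorm φ₀ p q (-1 + 1 / q) f ≤ ENNReal.ofReal
      (((16 * K) ^ p * (4 * (8 ^ (p / q) * ((p / q) ^ (p / q) * Real.exp 8)))) ^ (1 / p) *
        (4 ^ N * N) ^ (1 / q)) := by
  classical
  have hq0 : 0 < q := by linarith
  have hp0 : 0 < p := by linarith
  set r := p / q with hr
  have hr0 : 0 < r := by positivity
  set I := S ×ˢ Finset.Icc (N + 1) (2 * N) with hI
  have hinj : ∀ i ∈ I, ∀ i' ∈ I, i.1 + i.2 = i'.1 + i'.2 → i = i' := by
    intro i hi i' hi' h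
    simp only [hI, Finset.mem_product, Finset.mem_Icc] at hi hi'
    have h1 : i.1 = i'.1 := by
      rcases lt_trichotomy i.1 i'.1 with h2 | h2 | h2
      · have := hS _ hi.1 _ hi'.1 h2; omega
      · exact h2
      · have := hS _ hi'.1 _ hi.1 h2; omega
    exact Prod.ext h1 (by omega)
  set G : ℝ → ℝ := fun x => ∑ b ∈ S, bumpSum N (2 ^ b * x) with hG
  have hG0 : ∀ x, 0 ≤ G x := fun x => Finset.sum_nonneg fun b _ => bumpSum_nonneg N (2 ^ b * x)
  set D : ℝ → ℝ := fun x => (16 * K) ^ q * (((1 + |x|) ^ 2)⁻¹) ^ q with hD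
  have hD0 : ∀ x, 0 ≤ D x := fun x => by positivity
  set T : ℝ → ℕ × ℕ → ℝ := fun x i =>
    2 ^ i.2 * ((1 + 2 ^ i.2 * |2 ^ i.1 * x - round (2 ^ i.1 * x)|) ^ 2)⁻¹ with hT
  have hGT : ∀ x, ∑ i ∈ I, T x i = G x := by
    intro x; rw [hI, Finset.sum_product]; rfl
  have hsq : ∀ x, ∑' k : ℕ, ENNReal.ofReal ((2:ℝ)^((k:ℝ)*(-1 + 1 / q)*q)) *
      (ENNReal.ofReal ‖LPop φ₀ k f x‖)^q ≤ ENNReal.ofReal (D x * G x) := by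
    intro x
    have hk : ∀ k : ℕ, ENNReal.ofReal ((2:ℝ)^((k:ℝ)*(-1 + 1 / q)*q)) *
        (ENNReal.ofReal ‖LPop φ₀ k f x‖)^q
          ≤ ∑ i ∈ I, if k = i.1 + i.2 then ENNReal.ofReal (D x * T x i) else 0 := by
      intro k
      by_cases hk : ∃ i ∈ I, k = i.1 + i.2
      · obtain ⟨i, hi, rfl⟩ := hk
        have hfil : I.filter (fun i' => i'.1 + i'.2 = i.1 + i.2) = {i} := by
          ext i'
          simp only [Finset.mem_filter, Finset.mem_singleton]
          exact ⟨fun h => hinj _ h.1 _ hi h.2, fun h => by subst h; exact ⟨hi, rfl⟩⟩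
        rw [hf, hfil, Finset.sum_singleton, ENNReal.ofReal_rpow_of_nonneg (norm_nonneg _) hq0.le,
          ← ENNReal.ofReal_mul (by positivity)]
        refine le_trans ?_ (Finset.single_le_sum (fun _ _ => zero_le) hi)
        rw [if_pos rfl]
        exact ENNReal.ofReal_le_ofReal (two_rpow_mul_norm_blockSum_rpow_le hK hq hg i.1 i.2 x)
      · have hfil : I.filter (fun i' => i'.1 + i'.2 = k) = ∅ := by
          refine Finset.filter_eq_empty_iff.2 fun i hi h => hk ⟨i, hi, h.symm⟩
        rw [hf, hfil, Finset.sum_empty, norm_zero, ENNReal.ofReal_zero, ENNReal.zero_rpow_of_pos hq0,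
          mul_zero]
        exact zero_le
    refine (ENNReal.tsum_le_tsum hk).trans_eq ?_
    rw [Summable.tsum_finsetSum (fun _ _ => ENNReal.summable)]
    simp only [tsum_ite_eq]
    rw [← ENNReal.ofReal_sum_of_nonneg (fun i _ => mul_nonneg (hD0 x) (by positivity)),
      ← Finset.mul_sum, hGT]
  have hint : ∀ x, (∑' k : ℕ, ENNReal.ofReal ((2:ℝ)^((k:ℝ)*(-1 + 1 / q)*q)) *
      (ENNReal.ofReal ‖LPop φ₀ k f x‖)^q) ^ r ≤ ENNReal.ofReal ((16 * K) ^ p) *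
        (ENNReal.ofReal (((1 + |x|) ^ 2)⁻¹) * ENNReal.ofReal (G x ^ r)) := by
    intro x
    refine (ENNReal.rpow_le_rpow (hsq x) hr0.le).trans ?_
    rw [ENNReal.ofReal_rpow_of_nonneg (mul_nonneg (hD0 x) (hG0 x)) hr0.le,
      ← ENNReal.ofReal_mul (by positivity), ← ENNReal.ofReal_mul (by positivity),
      Real.mul_rpow (hD0 x) (hG0 x)]
    apply ENNReal.ofReal_le_ofReal
    rw [← mul_assoc]
    have hDr : D x ^ r ≤ (16 * K) ^ p * ((1 + |x|) ^ 2)⁻¹ := by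
      simp only [hD]
      rw [Real.mul_rpow (by positivity) (by positivity), ← Real.rpow_mul (by positivity),
        ← Real.rpow_mul (by positivity), show q * r = p by rw [hr]; field_simp]
      gcongr
      refine Real.rpow_le_self_of_le_one (by positivity) ?_ (by linarith)
      exact inv_le_one_of_one_le₀ (one_le_pow₀ (by linarith [abs_nonneg x]))
    have := Real.rpow_nonneg (hG0 x) r
    gcongr
  have hGm : Measurable fun x => ENNReal.ofReal (G x ^ r) := by
    have : Measurable G := by
      refine Finset.measurable_fun_sum _ fun b _ => ?_
      exact (measurable_bumpSum N).comp (by fun_prop)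
    fun_prop
  have hGper : ∀ (x : ℝ) (n : ℤ), ENNReal.ofReal (G (x + n) ^ r) = ENNReal.ofReal (G x ^ r) := by
    intro x n
    congr 2
    simp only [hG]
    refine Finset.sum_congr rfl fun b _ => ?_
    rw [← bumpSum_add_int N (2 ^ b * x) (2 ^ b * n)]
    congr 1
    push_cast
    ring
  rw [FNorm]
  have hfin : ∫⁻ x : ℝ, (∑' k : ℕ, ENNReal.ofReal ((2:ℝ)^((k:ℝ)*(-1 + 1 / q)*q)) *
      (ENNReal.ofReal ‖LPop φ₀ k f x‖)^q) ^ (p / q)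
        ≤ ENNReal.ofReal (((16 * K) ^ p * (4 * (8 ^ r * (r ^ r * Real.exp 8)))) *
          (4 ^ N * N) ^ r) := by
    refine (lintegral_mono hint).trans ?_
    rw [lintegral_const_mul _ (by fun_prop)]
    refine (mul_le_mul_right ((lintegral_weight_mul_periodic_le hGm hGper).trans
      (mul_le_mul_right (lintegral_sum_bumpSum_rpow_le hr0 hN S hS hcard) _)) _).trans ?_
    rw [show (4:ℝ≥0∞) = ENNReal.ofReal 4 by norm_num, ← ENNReal.ofReal_mul (by norm_num),
      ← ENNReal.ofReal_mul (by positivity)]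
    apply ENNReal.ofReal_le_ofReal
    rw [mul_assoc 8, Real.mul_rpow (x := 8) (by norm_num) (by positivity)]
    apply le_of_eq
    ring
  refine (ENNReal.rpow_le_rpow hfin (by positivity)).trans_eq ?_
  rw [ENNReal.ofReal_rpow_of_nonneg (by positivity) (by positivity),
    Real.mul_rpow (by positivity) (by positivity), ← Real.rpow_mul (by positivity),
    show r * (1 / p) = 1 / q by rw [hr]; field_simp]

theorem sum_pow_le_of_injOn {ι : Type*} {ρ : ℝ} (hρ0 : 0 ≤ ρ) (hρ1 : ρ < 1) (T : Finset ι)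
    (n : ι → ℕ) (hn : Set.InjOn n T) : ∑ i ∈ T, ρ ^ n i ≤ (1 - ρ)⁻¹ := by
  classical
  rw [← Finset.sum_image (f := fun m : ℕ => ρ ^ m) hn, ← tsum_geometric_of_lt_one hρ0 hρ1]
  exact (summable_geometric_of_lt_one hρ0 hρ1).sum_le_tsum _ fun _ _ => by positivity

theorem sum_two_rpow_neg_dist_le {ε : ℝ} (hε : 0 < ε) (T : Finset ℕ) (b₀ : ℕ) :
    ∑ b ∈ T, (2:ℝ) ^ (-ε * |(b:ℝ) - b₀|) ≤ 2 * (1 - (2:ℝ) ^ (-ε))⁻¹ := by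
  have hρ1 : (2:ℝ) ^ (-ε) < 1 := Real.rpow_lt_one_of_one_lt_of_neg (by norm_num) (by linarith)
  have hρ0 : (0:ℝ) ≤ 2 ^ (-ε) := by positivity
  rw [← Finset.sum_filter_add_sum_filter_not T (fun b => b < b₀), two_mul]
  apply add_le_add
  · refine le_trans (le_of_eq (Finset.sum_congr rfl fun b hb => ?_))
      (sum_pow_le_of_injOn hρ0 hρ1 _ (fun b => b₀ - b) ?_)
    · have hb := (Finset.mem_filter.1 hb).2
      have hb' : (b:ℝ) < b₀ := by exact_mod_cast hb
      rw [← Real.rpow_natCast, ← Real.rpow_mul (by norm_num), Nat.cast_sub hb.le,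
        abs_of_neg (by linarith), neg_sub]
    · intro b hb b' hb' h
      simp only [Finset.coe_filter, Set.mem_ofPred_eq] at hb hb'
      simp only at h
      omega
  · refine le_trans (le_of_eq (Finset.sum_congr rfl fun b hb => ?_))
      (sum_pow_le_of_injOn hρ0 hρ1 _ (fun b => b - b₀) ?_)
    · have hb := not_lt.1 (Finset.mem_filter.1 hb).2
      have hb' : (b₀:ℝ) ≤ b := by exact_mod_cast hb
      rw [← Real.rpow_natCast, ← Real.rpow_mul (by norm_num), Nat.cast_sub hb,
        abs_of_nonneg (by linarith)]
    · intro b hb b' hb' h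
      simp only [Finset.coe_filter, Set.mem_ofPred_eq] at hb hb'
      simp only at h
      omega

/-- The part of the test potential attached to the lattice `2⁻ᵇℤ`. -/
def potBlock (g : ℝ → ℂ) (N b : ℕ) (x : ℝ) : ℂ :=
  ∑ m ∈ Finset.Icc (N + 1) (2 * N), blockSum g b m x

theorem testPot_eq (g : ℝ → ℂ) (A : ℕ → ℝ) (N : ℕ) (S : Finset ℕ) (x : ℝ) :
    testPot g A N S x = ∑ b ∈ S, A b * potBlock g N b x := by
  rw [testPot, Finset.sum_product]
  simp only [potBlock, Finset.mul_sum]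

theorem norm_blockSum_le_const {g : ℝ → ℂ} {K : ℝ} (hK : 0 ≤ K)
    (hg : ∀ x, ‖g x‖ ≤ K * ((1 + |x|) ^ 6)⁻¹) (b m : ℕ) (x : ℝ) :
    ‖blockSum g b m x‖ ≤ 16 * K * ((1 + 2 ^ m * |2 ^ b * x - round (2 ^ b * x)|) ^ 2)⁻¹ := by
  refine (norm_blockSum_le hK hg b m x).trans ?_
  refine mul_le_mul_of_nonneg_left ?_ (by positivity)
  refine mul_le_of_le_one_left (by positivity) (inv_le_one_of_one_le₀ (one_le_pow₀ ?_))
  linarith [abs_nonneg x]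

theorem norm_blockSum_le_const' {g : ℝ → ℂ} {K : ℝ} (hK : 0 ≤ K)
    (hg : ∀ x, ‖g x‖ ≤ K * ((1 + |x|) ^ 6)⁻¹) (b m : ℕ) (x : ℝ) :
    ‖blockSum g b m x‖ ≤ 16 * K := by
  refine (norm_blockSum_le_const hK hg b m x).trans ?_
  refine mul_le_of_le_one_right (by positivity) (inv_le_one_of_one_le₀ (one_le_pow₀ ?_))
  have : 0 ≤ (2:ℝ) ^ m * |2 ^ b * x - round (2 ^ b * x)| := by positivity
  linarith

theorem norm_potBlock_le {g : ℝ → ℂ} {K : ℝ} (hK : 0 ≤ K)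
    (hg : ∀ x, ‖g x‖ ≤ K * ((1 + |x|) ^ 6)⁻¹) (N b : ℕ) (x : ℝ) :
    ‖potBlock g N b x‖ ≤ 16 * K * N := by
  refine (norm_sum_le_of_le _ fun m _ => norm_blockSum_le_const' hK hg b m x).trans_eq ?_
  rw [Finset.sum_const, Nat.card_Icc, show 2 * N + 1 - (N + 1) = N by omega, nsmul_eq_mul]
  ring

theorem sum_inv_two_pow_sub_le (N : ℕ) :
    ∑ m ∈ Finset.Icc (N + 1) (2 * N), ((2:ℝ)⁻¹) ^ (m - (N + 1)) ≤ 2 := by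
  refine (sum_pow_le_of_injOn (by norm_num) (by norm_num) _ (fun m => m - (N + 1)) ?_).trans_eq
    (by norm_num)
  intro m hm m' hm' h
  simp only [Finset.coe_Icc, Set.mem_Icc] at hm hm'
  simp only at h
  omega

theorem norm_potBlock_le_of_far {g : ℝ → ℂ} {K : ℝ} (hK : 0 ≤ K)
    (hg : ∀ x, ‖g x‖ ≤ K * ((1 + |x|) ^ 6)⁻¹) (N b : ℕ) (x : ℝ)
    (hx : ((2:ℝ) ^ (N + 1))⁻¹ ≤ |2 ^ b * x - round (2 ^ b * x)|) :
    ‖potBlock g N b x‖ ≤ 32 * K := by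
  refine (norm_sum_le_of_le (f := fun m => blockSum g b m x)
    (n := fun m => 16 * K * ((2:ℝ)⁻¹) ^ (m - (N + 1))) _
    fun m hm => (norm_blockSum_le_const hK hg b m x).trans ?_).trans ?_
  · gcongr
    rw [inv_pow]
    apply inv_anti₀ (by positivity)
    have hm := (Finset.mem_Icc.1 hm).1
    have h1 : (2:ℝ) ^ (m - (N + 1)) ≤ 2 ^ m * |2 ^ b * x - round (2 ^ b * x)| := by
      calc (2:ℝ) ^ (m - (N + 1)) = 2 ^ m * ((2:ℝ) ^ (N + 1))⁻¹ := by
            rw [pow_sub₀ _ (by norm_num) hm]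
        _ ≤ _ := by gcongr
    have h0 : (0:ℝ) < 2 ^ (m - (N + 1)) := by positivity
    nlinarith
  · rw [← Finset.mul_sum]
    have := sum_inv_two_pow_sub_le N
    calc _ ≤ 16 * K * 2 := by gcongr
      _ = _ := by ring

theorem norm_blockSum_lattice_sub_le {g : ℝ → ℂ} {K : ℝ} (hK : 0 ≤ K)
    (hg : ∀ x, ‖g x‖ ≤ K * ((1 + |x|) ^ 6)⁻¹) (b m : ℕ) {n : ℕ} (hn : n ≤ 2 ^ b) :
    ‖blockSum g b m (n / 2 ^ b) - g 0‖ ≤ 4 * K * ((2:ℝ) ^ m)⁻¹ := by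
  have harg : ∀ ν : ℕ, (2:ℝ) ^ (b + m) * ((n : ℝ) / 2 ^ b - ν / 2 ^ b)
      = 2 ^ m * ((n : ℝ) - ((ν : ℤ) : ℝ)) := by
    intro ν; rw [pow_add]; push_cast; field_simp
  have hmem : n ∈ Finset.range (2 ^ b + 1) := Finset.mem_range.2 (by omega)
  rw [blockSum, ← Finset.add_sum_erase _ _ hmem, sub_self, mul_zero, add_sub_cancel_left]
  refine (norm_sum_le_of_le (n := fun ν : ℕ => K * ((2:ℝ) ^ m)⁻¹ *
    ((1 + 2 ^ m * |(n : ℝ) - ((ν : ℤ) : ℝ)|) ^ 2)⁻¹) _ fun ν hν => (hg _).trans ?_).trans ?_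
  · rw [harg, abs_mul, abs_of_pos (show (0:ℝ) < 2 ^ m by positivity), mul_assoc]
    gcongr
    set V := 1 + 2 ^ m * |(n : ℝ) - ((ν : ℤ) : ℝ)| with hV
    have hne : (1:ℝ) ≤ |(n : ℝ) - ((ν : ℤ) : ℝ)| := by
      have h1 : (n : ℤ) - ν ≠ 0 := by
        have := Finset.ne_of_mem_erase hν
        omega
      have := Int.one_le_abs h1
      exact_mod_cast this
    have h2m : (1:ℝ) ≤ 2 ^ m := one_le_pow₀ (by norm_num)
    have hV1 : (2:ℝ) ^ m ≤ V := by
      have : (2:ℝ) ^ m * 1 ≤ 2 ^ m * |(n : ℝ) - ((ν : ℤ) : ℝ)| := by gcongr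
      linarith
    rw [← mul_inv]
    apply inv_anti₀ (by positivity)
    calc (2:ℝ) ^ m * V ^ 2 ≤ V * V ^ 2 := by gcongr
      _ = V ^ 3 := by ring
      _ ≤ V ^ 6 := pow_le_pow_right₀ (by linarith) (by norm_num)
  · rw [← Finset.mul_sum]
    have hs := sum_lattice_le (α := 2 ^ m) (by positivity)
      ((Finset.range (2 ^ b + 1)).erase n) (fun n : ℕ => (n : ℤ))
      (fun _ _ _ _ h => by simpa using h) n
    have h2 : ((2:ℝ) ^ m)⁻¹ ≤ 1 := inv_le_one_of_one_le₀ (one_le_pow₀ (by norm_num))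
    calc _ ≤ K * ((2:ℝ) ^ m)⁻¹ * 4 := by gcongr; linarith
      _ = _ := by ring

theorem norm_potBlock_lattice_sub_le {g : ℝ → ℂ} {K : ℝ} (hK : 0 ≤ K)
    (hg : ∀ x, ‖g x‖ ≤ K * ((1 + |x|) ^ 6)⁻¹) (N b : ℕ) {n : ℕ} (hn : n ≤ 2 ^ b) :
    ‖potBlock g N b (n / 2 ^ b) - N * g 0‖ ≤ 4 * K := by
  have h1 : (N : ℂ) * g 0 = ∑ m ∈ Finset.Icc (N + 1) (2 * N), g 0 := by
    rw [Finset.sum_const, Nat.card_Icc, show 2 * N + 1 - (N + 1) = N by omega, nsmul_eq_mul]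
  rw [potBlock, h1, ← Finset.sum_sub_distrib]
  refine (norm_sum_le_of_le (n := fun m => 2 * K * ((2:ℝ)⁻¹) ^ (m - (N + 1))) _
    fun m hm => (norm_blockSum_lattice_sub_le hK hg b m hn).trans ?_).trans ?_
  · have hm := (Finset.mem_Icc.1 hm).1
    have h2 : ((2:ℝ) ^ m)⁻¹ ≤ 2⁻¹ * ((2:ℝ)⁻¹) ^ (m - (N + 1)) := by
      rw [← pow_succ', ← inv_pow]
      exact pow_le_pow_of_le_one (by norm_num) (by norm_num) (by omega)
    calc 4 * K * ((2:ℝ) ^ m)⁻¹ ≤ 4 * K * (2⁻¹ * ((2:ℝ)⁻¹) ^ (m - (N + 1))) := by gcongr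
      _ = _ := by ring
  · rw [← Finset.mul_sum]
    have := sum_inv_two_pow_sub_le N
    calc _ ≤ 2 * K * 2 := by gcongr
      _ = _ := by ring

theorem hasDerivAt_potBlock (θ : SchwartzMap ℝ ℂ) (N b : ℕ) (x : ℝ) :
    HasDerivAt (potBlock θ N b)
      (∑ m ∈ Finset.Icc (N + 1) (2 * N), 2 ^ (b + m) * blockSum (deriv θ) b m x) x := by
  unfold potBlock
  refine HasDerivAt.fun_sum fun m _ => ?_
  unfold blockSum
  rw [Finset.mul_sum]
  refine HasDerivAt.fun_sum fun ν _ => ?_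
  have h1 : HasDerivAt (fun x : ℝ => (2:ℝ) ^ (b + m) * (x - ν / 2 ^ b))
      ((2:ℝ) ^ (b + m) * 1) x := ((hasDerivAt_id x).sub_const _).const_mul _
  have h2 := (θ.differentiable _).hasDerivAt.scomp x h1
  refine h2.congr_deriv ?_
  rw [Complex.real_smul]
  push_cast
  ring

theorem norm_potBlock_sub_le (θ : SchwartzMap ℝ ℂ) {K : ℝ} (hK : 0 ≤ K)
    (hg : ∀ x, ‖deriv θ x‖ ≤ K * ((1 + |x|) ^ 6)⁻¹) (N b : ℕ) (x y : ℝ) :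
    ‖potBlock θ N b x - potBlock θ N b y‖ ≤ 32 * K * 2 ^ (b + 2 * N) * |x - y| := by
  have hd : ∀ z : ℝ, ‖∑ m ∈ Finset.Icc (N + 1) (2 * N), (2:ℂ) ^ (b + m) * blockSum (deriv θ) b m z‖
      ≤ 32 * K * 2 ^ (b + 2 * N) := by
    intro z
    refine (norm_sum_le_of_le (n := fun m => (16 * K * 2 ^ b) * (2:ℝ) ^ m) _ fun m _ => ?_).trans ?_
    · rw [norm_mul, norm_pow, Complex.norm_ofNat, pow_add]
      have := norm_blockSum_le_const' hK hg b m z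
      calc _ ≤ (2:ℝ) ^ b * 2 ^ m * (16 * K) := by gcongr
        _ = _ := by ring
    · rw [← Finset.mul_sum]
      have := sum_Icc_two_pow_le (N + 1) (2 * N)
      calc _ ≤ 16 * K * 2 ^ b * (2 * 2 ^ (2 * N)) := by gcongr
        _ = _ := by rw [pow_add]; ring
  have := Convex.norm_image_sub_le_of_norm_hasDerivWithin_le (s := Set.univ)
    (fun z _ => (hasDerivAt_potBlock θ N b z).hasDerivWithinAt) (fun z _ => hd z) convex_univ
    (Set.mem_univ y) (Set.mem_univ x)
  simpa using this

theorem le_abs_sub_round {t : ℝ} (ht : t ≤ 1 / 2) (n : ℕ) :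
    t ≤ |(n + t : ℝ) - round (n + t : ℝ)| := by
  set k := round ((n : ℝ) + t)
  rcases le_or_gt k n with h | h
  · have h' : (k : ℝ) ≤ n := by exact_mod_cast h
    exact le_trans (by linarith) (le_abs_self _)
  · have h' : (n : ℝ) + 1 ≤ k := by exact_mod_cast h
    exact le_trans (by linarith) (neg_le_abs _)

theorem norm_haarDiff_le_of_bound {G : ℝ → ℂ} {M : ℝ} (hG : ∀ x, ‖G x‖ ≤ M) (j : ℕ) (μ : ℝ) :
    ‖haarDiff G j μ‖ ≤ 4 * M := by
  rw [haarDiff]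
  refine (norm_add_le _ _).trans ?_
  have h1 := norm_sub_le (G (μ / 2 ^ j)) (2 * G ((μ + 1 / 2) / 2 ^ j))
  rw [norm_mul, Complex.norm_ofNat] at h1
  linarith [hG (μ / 2 ^ j), hG ((μ + 1 / 2) / 2 ^ j), hG ((μ + 1) / 2 ^ j)]

theorem norm_haarDiff_le_of_lipschitz {G : ℝ → ℂ} {M : ℝ}
    (hG : ∀ x y, ‖G x - G y‖ ≤ M * |x - y|) (j : ℕ) (μ : ℝ) :
    ‖haarDiff G j μ‖ ≤ M * ((2:ℝ) ^ j)⁻¹ := by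
  have h0 : (0:ℝ) < 2 ^ j := by positivity
  have e : haarDiff G j μ = (G (μ / 2 ^ j) - G ((μ + 1 / 2) / 2 ^ j))
      + (G ((μ + 1) / 2 ^ j) - G ((μ + 1 / 2) / 2 ^ j)) := by rw [haarDiff]; ring
  have h1 := hG (μ / 2 ^ j) ((μ + 1 / 2) / 2 ^ j)
  have h2 := hG ((μ + 1) / 2 ^ j) ((μ + 1 / 2) / 2 ^ j)
  rw [show μ / 2 ^ j - (μ + 1 / 2) / 2 ^ j = -(((2:ℝ) ^ j)⁻¹ / 2) by field_simp; ring, abs_neg,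
    abs_of_pos (by positivity)] at h1
  rw [show (μ + 1) / 2 ^ j - (μ + 1 / 2) / 2 ^ j = ((2:ℝ) ^ j)⁻¹ / 2 by field_simp; ring,
    abs_of_pos (by positivity)] at h2
  rw [e]
  refine (norm_add_le _ _).trans ?_
  linarith

theorem norm_haarDiff_potBlock_sub_le {g : ℝ → ℂ} {K : ℝ} (hK : 0 ≤ K)
    (hg : ∀ x, ‖g x‖ ≤ K * ((1 + |x|) ^ 6)⁻¹) {N b d n : ℕ} (hd : d ≤ N) (hn : n < 2 ^ b) :
    ∃ c : ℝ, 1 ≤ c ∧ c ≤ 2 ∧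
      ‖haarDiff (potBlock g N b) (b + d) (2 ^ d * n) - c * (N * g 0)‖ ≤ 100 * K := by
  have hleft : ((2:ℝ) ^ d * n) / 2 ^ (b + d) = n / 2 ^ b := by rw [pow_add]; field_simp
  have hmid : ‖potBlock g N b (((2:ℝ) ^ d * n + 1 / 2) / 2 ^ (b + d))‖ ≤ 32 * K := by
    apply norm_potBlock_le_of_far hK hg
    have h1 : (2:ℝ) ^ b * (((2:ℝ) ^ d * n + 1 / 2) / 2 ^ (b + d)) = n + ((2:ℝ) ^ (d + 1))⁻¹ := by
      rw [pow_add, pow_add]; field_simp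
    rw [h1]
    refine le_trans ?_ (le_abs_sub_round ?_ n)
    · apply inv_anti₀ (by positivity)
      exact pow_le_pow_right₀ (by norm_num) (by omega)
    · rw [pow_succ, mul_inv, one_div]
      exact mul_le_of_le_one_left (by norm_num) (inv_le_one_of_one_le₀ (one_le_pow₀ (by norm_num)))
  have hl := norm_potBlock_lattice_sub_le hK hg N b hn.le
  rcases Nat.eq_zero_or_pos d with rfl | hd0
  · have hr := norm_potBlock_lattice_sub_le hK hg N b (n := n + 1) hn
    refine ⟨2, by norm_num, le_rfl, ?_⟩
    rw [haarDiff, hleft, show ((2:ℝ) ^ 0 * n + 1) / 2 ^ (b + 0) = ((n + 1 : ℕ) : ℝ) / 2 ^ b by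
      push_cast; simp]
    set L := potBlock g N b (n / 2 ^ b)
    set M := potBlock g N b (((2:ℝ) ^ 0 * n + 1 / 2) / 2 ^ (b + 0))
    set R := potBlock g N b (((n + 1 : ℕ) : ℝ) / 2 ^ b)
    have e : L - 2 * M + R - ((2:ℝ) : ℂ) * (N * g 0)
        = (L - N * g 0) + (R - N * g 0) - 2 * M := by push_cast; ring
    rw [e]
    refine (norm_sub_le _ _).trans ?_
    have := norm_add_le (L - N * g 0) (R - N * g 0)
    rw [norm_mul, Complex.norm_ofNat]
    linarith
  · have hr : ‖potBlock g N b (((2:ℝ) ^ d * n + 1) / 2 ^ (b + d))‖ ≤ 32 * K := by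
      apply norm_potBlock_le_of_far hK hg
      have h1 : (2:ℝ) ^ b * (((2:ℝ) ^ d * n + 1) / 2 ^ (b + d)) = n + ((2:ℝ) ^ d)⁻¹ := by
        rw [pow_add]; field_simp
      rw [h1]
      refine le_trans ?_ (le_abs_sub_round ?_ n)
      · apply inv_anti₀ (by positivity)
        exact pow_le_pow_right₀ (by norm_num) (by omega)
      · rw [one_div]
        apply inv_anti₀ (by positivity)
        exact le_self_pow₀ (by norm_num) (by omega)
    refine ⟨1, le_rfl, by norm_num, ?_⟩
    rw [haarDiff, hleft]
    set L := potBlock g N b (n / 2 ^ b)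
    set M := potBlock g N b (((2:ℝ) ^ d * n + 1 / 2) / 2 ^ (b + d))
    set R := potBlock g N b (((2:ℝ) ^ d * n + 1) / 2 ^ (b + d))
    have e : L - 2 * M + R - ((1:ℝ) : ℂ) * (N * g 0)
        = (L - N * g 0) + R - 2 * M := by push_cast; ring
    rw [e]
    refine (norm_sub_le _ _).trans ?_
    have := norm_add_le (L - N * g 0) R
    rw [norm_mul, Complex.norm_ofNat]
    linarith

theorem haarDiff_testPot (g : ℝ → ℂ) (A : ℕ → ℝ) (N : ℕ) (S : Finset ℕ) (j : ℕ) (μ : ℝ) :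
    haarDiff (testPot g A N S) j μ = ∑ b ∈ S, A b * haarDiff (potBlock g N b) j μ := by
  simp only [haarDiff, testPot_eq, mul_add, mul_sub, Finset.sum_add_distrib,
    Finset.sum_sub_distrib, Finset.mul_sum]
  congr 2
  exact Finset.sum_congr rfl fun _ _ => by ring

theorem natCast_le_two_rpow_four_mul (N : ℕ) : (N : ℝ) ≤ (2:ℝ) ^ (4 * (N:ℝ)) := by
  have h1 : (N:ℝ) ≤ (2:ℝ) ^ N := by exact_mod_cast Nat.lt_two_pow_self.le
  have h2 : (2:ℝ) ^ N ≤ (2:ℝ) ^ (4 * (N:ℝ)) := by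
    rw [← Real.rpow_natCast]
    exact Real.rpow_le_rpow_of_exponent_le (by norm_num) (by linarith [Nat.cast_nonneg (α := ℝ) N])
  linarith

theorem norm_haarDiff_other_block_le (θ : SchwartzMap ℝ ℂ) {K q ε : ℝ} (hK : 0 ≤ K)
    (hε1 : 2 * ε ≤ 1 / q) (hε2 : 2 * ε ≤ 1 - 1 / q)
    (hg : ∀ x, ‖θ x‖ ≤ K * ((1 + |x|) ^ 6)⁻¹) (hg' : ∀ x, ‖deriv θ x‖ ≤ K * ((1 + |x|) ^ 6)⁻¹)
    {N b b' j : ℕ} (hbj : b ≤ j) (hne : b' ≠ b) (hgap : 4 * N ≤ ε * |(b':ℝ) - b|) (μ : ℝ) :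
    (2:ℝ) ^ (-(b':ℝ) / q) * ‖haarDiff (potBlock θ N b') j μ‖
      ≤ (2:ℝ) ^ (-(b:ℝ) / q) * (64 * K) * (2:ℝ) ^ (-ε * |(b':ℝ) - b|) := by
  have hbj' : (b:ℝ) ≤ j := by exact_mod_cast hbj
  rcases lt_or_gt_of_ne hne with h | h
  · have h' : (b':ℝ) < b := by exact_mod_cast h
    rw [abs_of_neg (by linarith)] at hgap ⊢
    have h1 := norm_haarDiff_le_of_lipschitz (norm_potBlock_sub_le θ hK hg' N b') j μ
    have hexp : -(b':ℝ) / q + ((b' + 2 * N : ℕ) : ℝ) + -j ≤ -b / q + -ε * -((b':ℝ) - b) := by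
      have e1 : (2 * ε) * ((b:ℝ) - b') ≤ (1 - 1 / q) * (b - b') :=
        mul_le_mul_of_nonneg_right hε2 (by linarith)
      have e2 : (1 - 1 / q) * ((b:ℝ) - b') = b - b' - b / q + b' / q := by ring
      have e3 : -(b':ℝ) / q = -(b' / q) := by ring
      have e4 : -(b:ℝ) / q = -(b / q) := by ring
      have : (0:ℝ) ≤ N := by positivity
      rw [e3, e4]
      push_cast
      linarith
    have hpow := Real.rpow_le_rpow_of_exponent_le (x := 2) (by norm_num) hexp
    rw [Real.rpow_add (by norm_num), Real.rpow_add (by norm_num), Real.rpow_add (by norm_num),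
      Real.rpow_neg (by norm_num) (j:ℝ), Real.rpow_natCast, Real.rpow_natCast] at hpow
    calc _ ≤ (2:ℝ) ^ (-(b':ℝ) / q) * (32 * K * 2 ^ (b' + 2 * N) * ((2:ℝ) ^ j)⁻¹) := by gcongr
      _ = 32 * K * ((2:ℝ) ^ (-(b':ℝ) / q) * 2 ^ (b' + 2 * N) * ((2:ℝ) ^ j)⁻¹) := by ring
      _ ≤ 32 * K * ((2:ℝ) ^ (-(b:ℝ) / q) * (2:ℝ) ^ (-ε * -((b':ℝ) - b))) := by gcongr
      _ ≤ 64 * K * ((2:ℝ) ^ (-(b:ℝ) / q) * (2:ℝ) ^ (-ε * -((b':ℝ) - b))) := by gcongr; norm_num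
      _ = _ := by ring
  · have h' : (b:ℝ) < b' := by exact_mod_cast h
    rw [abs_of_pos (by linarith)] at hgap ⊢
    have h1 := norm_haarDiff_le_of_bound (norm_potBlock_le hK hg N b') j μ
    have hexp : -(b':ℝ) / q + 4 * N ≤ -b / q + -ε * ((b':ℝ) - b) := by
      have e1 : (2 * ε) * ((b':ℝ) - b) ≤ (1 / q) * (b' - b) :=
        mul_le_mul_of_nonneg_right hε1 (by linarith)
      have e2 : (1 / q) * ((b':ℝ) - b) = b' / q - b / q := by ring
      have e3 : -(b':ℝ) / q = -(b' / q) := by ring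
      have e4 : -(b:ℝ) / q = -(b / q) := by ring
      rw [e3, e4]
      linarith
    have hpow := Real.rpow_le_rpow_of_exponent_le (x := 2) (by norm_num) hexp
    rw [Real.rpow_add (by norm_num), Real.rpow_add (by norm_num)] at hpow
    have hN := natCast_le_two_rpow_four_mul N
    calc _ ≤ (2:ℝ) ^ (-(b':ℝ) / q) * (4 * (16 * K * 2 ^ (4 * (N:ℝ)))) := by
          gcongr; exact h1.trans (by gcongr)
      _ = 64 * K * ((2:ℝ) ^ (-(b':ℝ) / q) * 2 ^ (4 * (N:ℝ))) := by ring
      _ ≤ 64 * K * ((2:ℝ) ^ (-(b:ℝ) / q) * (2:ℝ) ^ (-ε * ((b':ℝ) - b))) := by gcongr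
      _ = _ := by ring

/-- The Haar coefficients of the test function. -/
theorem norm_haarDiff_testPot_sub_le (θ : SchwartzMap ℝ ℂ) {K q ε : ℝ} (hK : 0 ≤ K) (hε : 0 < ε)
    (hε1 : 2 * ε ≤ 1 / q) (hε2 : 2 * ε ≤ 1 - 1 / q)
    (hg : ∀ x, ‖θ x‖ ≤ K * ((1 + |x|) ^ 6)⁻¹) (hg' : ∀ x, ‖deriv θ x‖ ≤ K * ((1 + |x|) ^ 6)⁻¹)
    {N b d n : ℕ} {S : Finset ℕ} (hbS : b ∈ S)
    (hgap : ∀ b' ∈ S, b' ≠ b → 4 * N ≤ ε * |(b':ℝ) - b|) (hd : d ≤ N) (hn : n < 2 ^ b) :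
    ∃ c : ℝ, 1 ≤ c ∧ c ≤ 2 ∧
      ‖haarDiff (testPot θ (fun b => (2:ℝ) ^ (-(b:ℝ) / q)) N S) (b + d) (2 ^ d * n)
          - (((2:ℝ) ^ (-(b:ℝ) / q) : ℝ) : ℂ) * (c * (N * θ 0))‖
        ≤ (2:ℝ) ^ (-(b:ℝ) / q) * (K * (100 + 128 * (1 - (2:ℝ) ^ (-ε))⁻¹)) := by
  obtain ⟨c, hc1, hc2, hc⟩ := norm_haarDiff_potBlock_sub_le hK hg hd hn
  refine ⟨c, hc1, hc2, ?_⟩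
  rw [haarDiff_testPot, ← Finset.add_sum_erase _ _ hbS, add_sub_right_comm, ← mul_sub]
  refine (norm_add_le _ _).trans ?_
  rw [norm_mul, Complex.norm_real, Real.norm_of_nonneg (by positivity)]
  have h2 : ‖∑ b' ∈ S.erase b, (((2:ℝ) ^ (-(b':ℝ) / q) : ℝ) : ℂ) *
      haarDiff (potBlock θ N b') (b + d) (2 ^ d * n)‖
        ≤ (2:ℝ) ^ (-(b:ℝ) / q) * (64 * K) * (2 * (1 - (2:ℝ) ^ (-ε))⁻¹) := by
    refine (norm_sum_le_of_le (n := fun b' : ℕ => (2:ℝ) ^ (-(b:ℝ) / q) * (64 * K) *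
      (2:ℝ) ^ (-ε * |(b':ℝ) - b|)) _ fun b' hb' => ?_).trans ?_
    · rw [norm_mul, Complex.norm_real, Real.norm_of_nonneg (by positivity)]
      have hne := Finset.ne_of_mem_erase hb'
      exact norm_haarDiff_other_block_le θ hK hε1 hε2 hg hg' (by omega) hne
        (hgap b' (Finset.mem_of_mem_erase hb') hne) _
    · rw [← Finset.mul_sum]
      gcongr
      exact sum_two_rpow_neg_dist_le hε _ _
  have h1 : (2:ℝ) ^ (-(b:ℝ) / q) *
      ‖haarDiff (potBlock θ N b) (b + d) (2 ^ d * n) - c * (N * θ 0)‖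
        ≤ (2:ℝ) ^ (-(b:ℝ) / q) * (100 * K) := by gcongr
  refine (add_le_add h1 h2).trans_eq ?_
  ring

theorem sum_far_points_le {K R α : ℝ} (hK : 0 ≤ K) (hR : 4 ≤ R) (hα : 1 ≤ α) (T : Finset ℕ)
    (y₀ : ℝ) (z : ℕ → ℝ) (hz : ∀ n ∈ T, R * (α * |y₀ - n|) / 4 ≤ |z n|)
    (hv : ∀ n ∈ T, 1 / 2 ≤ α * |y₀ - n|) :
    ∑ n ∈ T, K * ((1 + |z n|) ^ 6)⁻¹ ≤ 2 ^ 14 * K * (R ^ 4)⁻¹ := by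
  have hterm : ∀ n ∈ T, K * ((1 + |z n|) ^ 6)⁻¹
      ≤ (2 ^ 12 * K * (R ^ 4)⁻¹) * ((1 + α * |y₀ - ((n : ℤ) : ℝ)|) ^ 2)⁻¹ := by
    intro n hn
    have h1 := hz n hn
    have h2 := hv n hn
    rw [Int.cast_natCast]
    set v := α * |y₀ - n|
    have h3 : R / 8 ≤ 1 + |z n| := by nlinarith
    have h4 : 1 + v ≤ 1 + |z n| := by nlinarith
    have h5 : (R / 8) ^ 4 * (1 + v) ^ 2 ≤ (1 + |z n|) ^ 6 := by
      calc (R / 8) ^ 4 * (1 + v) ^ 2 ≤ (1 + |z n|) ^ 4 * (1 + |z n|) ^ 2 := by gcongr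
        _ = _ := by ring
    have h6 : ((1 + |z n|) ^ 6)⁻¹ ≤ ((R / 8) ^ 4 * (1 + v) ^ 2)⁻¹ :=
      inv_anti₀ (by positivity) h5
    calc K * ((1 + |z n|) ^ 6)⁻¹ ≤ K * ((R / 8) ^ 4 * (1 + v) ^ 2)⁻¹ := by gcongr
      _ = _ := by rw [mul_inv, div_pow]; field_simp; norm_num
  refine (Finset.sum_le_sum hterm).trans ?_
  rw [← Finset.mul_sum]
  have hs := sum_lattice_le (by linarith : 0 < α) T (fun n : ℕ => (n : ℤ))
    (fun _ _ _ _ h => by simpa using h) y₀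
  have hα' : α⁻¹ ≤ 1 := inv_le_one_of_one_le₀ hα
  calc _ ≤ (2 ^ 12 * K * (R ^ 4)⁻¹) * 4 := by gcongr; linarith
    _ = _ := by ring

theorem norm_second_difference_le {G G' G'' : ℝ → ℂ} (h1 : ∀ x, HasDerivAt G (G' x) x)
    (h2 : ∀ x, HasDerivAt G' (G'' x) x) {z h M : ℝ} (hh : 0 ≤ h)
    (hM : ∀ y ∈ Set.Icc (z - 2 * h) z, ‖G'' y‖ ≤ M) :
    ‖G z - 2 * G (z - h) + G (z - 2 * h)‖ ≤ 2 * M * h ^ 2 := by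
  set c := z - h with hc
  have hcs : z - 2 * h = c - h := by rw [hc]; ring
  have hcz : z = c + h := by rw [hc]; ring
  rw [hcs, hcz] at hM
  have hG' : ∀ t ∈ Set.Icc (0:ℝ) h, ‖G' (c + t) - G' (c - t)‖ ≤ M * (2 * h) := by
    intro t ht
    have := Convex.norm_image_sub_le_of_norm_hasDerivWithin_le (s := Set.Icc (c - h) (c + h))
      (fun y _ => (h2 y).hasDerivWithinAt) hM (convex_Icc _ _)
      (x := c - t) (y := c + t) ⟨by linarith [ht.2], by linarith [ht.1]⟩
      ⟨by linarith [ht.1], by linarith [ht.2]⟩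
    refine this.trans ?_
    have hM0 : 0 ≤ M := (norm_nonneg _).trans (hM c ⟨by linarith, by linarith⟩)
    gcongr
    rw [Real.norm_eq_abs, show c + t - (c - t) = 2 * t by ring, abs_of_nonneg (by linarith [ht.1])]
    linarith [ht.2]
  have hd : ∀ t ∈ Set.Icc (0:ℝ) h, HasDerivWithinAt (fun t => G (c + t) + G (c - t))
      (G' (c + t) - G' (c - t)) (Set.Icc (0:ℝ) h) t := by
    intro t _
    have e1 := (h1 (c + t)).scomp t ((hasDerivAt_id t).const_add c)
    have e2 := (h1 (c - t)).scomp t ((hasDerivAt_id t).const_sub c)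
    refine ((e1.add e2).congr_deriv ?_).hasDerivWithinAt
    simp [sub_eq_add_neg]
  have := Convex.norm_image_sub_le_of_norm_hasDerivWithin_le hd hG' (convex_Icc _ _)
    (x := 0) (y := h) ⟨le_rfl, hh⟩ ⟨hh, le_rfl⟩
  simp only [sub_zero, add_zero] at this
  rw [Real.norm_of_nonneg hh] at this
  rw [hcs, hcz]
  have e : G (c + h) - 2 * G c + G (c - h)
      = G (c + h) + G (c - h) - (G c + G c) := by ring
  rw [e]
  refine this.trans_eq (by ring)

theorem haarDiff_kernel (Ξ : ℝ → ℂ) (x : ℝ) (k b d n : ℕ) :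
    haarDiff (fun t => Ξ (2 ^ k * (x - t))) (b + d) (2 ^ d * n)
      = Ξ (2 ^ k * (x - n / 2 ^ b)) - 2 * Ξ (2 ^ k * (x - n / 2 ^ b) - 2 ^ k / 2 ^ (b + d + 1))
        + Ξ (2 ^ k * (x - n / 2 ^ b) - 2 * (2 ^ k / 2 ^ (b + d + 1))) := by
  have h1 : ((2:ℝ) ^ d * n) / 2 ^ (b + d) = n / 2 ^ b := by rw [pow_add]; field_simp
  have h2 : (2:ℝ) ^ k * (x - (2 ^ d * n + 1 / 2) / 2 ^ (b + d))
      = 2 ^ k * (x - n / 2 ^ b) - 2 ^ k / 2 ^ (b + d + 1) := by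
    rw [add_div, h1, pow_succ]; field_simp; ring
  have h3 : (2:ℝ) ^ k * (x - (2 ^ d * n + 1) / 2 ^ (b + d))
      = 2 ^ k * (x - n / 2 ^ b) - 2 * (2 ^ k / 2 ^ (b + d + 1)) := by
    rw [add_div, h1, pow_succ]; field_simp; ring
  rw [haarDiff, h1, h2, h3]

/-- The point `2⁻ᵏu` away from the centre of the dyadic interval of length `2^{-(b+d)}` whose
left endpoint is `n / 2^b`. -/
def evalPoint (b d n k : ℕ) (u : ℝ) : ℝ := n / 2 ^ b + ((2:ℝ) ^ (b + d + 1))⁻¹ + u / 2 ^ k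

theorem evalPoint_arg (b₀ d₀ n₀ C b d n : ℕ) (hj : b + d ≤ b₀ + d₀) (s : ℕ) (u : ℝ) :
    2 ^ (b₀ + d₀ + C) * (evalPoint b₀ d₀ n₀ (b₀ + d₀ + C) u - n / 2 ^ b)
        - s * (2 ^ (b₀ + d₀ + C) / 2 ^ (b + d + 1))
      = 2 ^ C / 2 * (((2 ^ (d₀ + 1) * n₀ + 1 - s * 2 ^ (b₀ + d₀ - (b + d))
          - 2 ^ (b₀ + d₀ - b + 1) * n : ℤ)) : ℝ) + u := by
  obtain ⟨m, hm⟩ := Nat.exists_eq_add_of_le hj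
  rw [evalPoint, hm, show b + d + m - (b + d) = m by omega, show b + d + m - b = d + m by omega]
  have h0 : (2:ℝ) ^ (b + d + m) = 2 ^ b₀ * 2 ^ d₀ := by rw [← hm, pow_add]
  push_cast
  have e1 : (2:ℝ) ^ (b + d + m + C) * (n₀ / 2 ^ b₀ + ((2:ℝ) ^ (b + d + m + 1))⁻¹
      + u / 2 ^ (b + d + m + C) - n / 2 ^ b)
      = 2 ^ (b + d + m) * 2 ^ C * (n₀ / 2 ^ b₀) + 2 ^ C / 2
        + u - 2 ^ (b + d + m) * 2 ^ C * (n / 2 ^ b) := by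
    rw [pow_add (2:ℝ) (b + d + m) C, pow_succ]; field_simp
  have e2 : (2:ℝ) ^ (b + d + m) * 2 ^ C * (n / 2 ^ b) = 2 ^ C / 2 * (2 ^ (d + m + 1) * n) := by
    rw [pow_add, pow_add, pow_add, pow_add]; field_simp
  have e3 : (s:ℝ) * (2 ^ (b + d + m + C) / 2 ^ (b + d + 1)) = 2 ^ C / 2 * (s * 2 ^ m) := by
    rw [pow_add, pow_add (2:ℝ) (b + d) m, pow_succ]; field_simp
  rw [e1, e2, e3, h0, pow_succ (2:ℝ) d₀]
  field_simp
  ring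

theorem abs_int_div_two_ge {m : ℤ} (hm : m ≠ 0) : (1:ℝ) / 2 ≤ |(m:ℝ)| / 2 := by
  have : (1:ℝ) ≤ |(m:ℝ)| := by exact_mod_cast Int.one_le_abs hm
  linarith

theorem sum_kernel_values_le {Ξ : ℝ → ℂ} {K : ℝ} (hK : 0 ≤ K)
    (hΞ : ∀ y, ‖Ξ y‖ ≤ K * ((1 + |y|) ^ 6)⁻¹) {b₀ d₀ n₀ C b d : ℕ} (hC : 2 ≤ C)
    (hj : b + d ≤ b₀ + d₀) (s : ℕ) {u : ℝ} (hu : |u| ≤ 2 ^ C / 16) (T : Finset ℕ)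
    (hT : ∀ n ∈ T, (2 ^ (d₀ + 1) * n₀ + 1 - s * 2 ^ (b₀ + d₀ - (b + d))
          - 2 ^ (b₀ + d₀ - b + 1) * n : ℤ) ≠ 0) :
    ∑ n ∈ T, ‖Ξ (2 ^ (b₀ + d₀ + C) * (evalPoint b₀ d₀ n₀ (b₀ + d₀ + C) u - n / 2 ^ b)
        - s * (2 ^ (b₀ + d₀ + C) / 2 ^ (b + d + 1)))‖ ≤ 2 ^ 14 * K * ((2 ^ C) ^ 4)⁻¹ := by
  have hR : (4:ℝ) ≤ 2 ^ C := by
    calc (4:ℝ) = 2 ^ 2 := by norm_num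
      _ ≤ 2 ^ C := pow_le_pow_right₀ (by norm_num) hC
  set y₀ : ℝ := (2 ^ (d₀ + 1) * n₀ + 1 - s * 2 ^ (b₀ + d₀ - (b + d))) / 2 ^ (b₀ + d₀ - b + 1)
    with hy₀
  have hv : ∀ n : ℕ, (2:ℝ) ^ (b₀ + d₀ - b) * |y₀ - n|
      = |((2 ^ (d₀ + 1) * n₀ + 1 - s * 2 ^ (b₀ + d₀ - (b + d))
          - 2 ^ (b₀ + d₀ - b + 1) * n : ℤ) : ℝ)| / 2 := by
    intro n
    have e : ((2 ^ (d₀ + 1) * n₀ + 1 - s * 2 ^ (b₀ + d₀ - (b + d))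
          - 2 ^ (b₀ + d₀ - b + 1) * n : ℤ) : ℝ) = 2 ^ (b₀ + d₀ - b + 1) * (y₀ - n) := by
      rw [hy₀]; push_cast; field_simp
    rw [e, abs_mul, abs_of_pos (by positivity : (0:ℝ) < 2 ^ (b₀ + d₀ - b + 1)), pow_succ]
    ring
  refine (Finset.sum_le_sum fun n _ => hΞ _).trans ?_
  refine sum_far_points_le hK hR (α := (2:ℝ) ^ (b₀ + d₀ - b)) (one_le_pow₀ (by norm_num)) T y₀ _
    (fun n hn => ?_) (fun n hn => ?_)
  · rw [hv n, evalPoint_arg b₀ d₀ n₀ C b d n hj s u]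
    have h1 := abs_int_div_two_ge (hT n hn)
    set M : ℝ := ((2 ^ (d₀ + 1) * n₀ + 1 - s * 2 ^ (b₀ + d₀ - (b + d))
          - 2 ^ (b₀ + d₀ - b + 1) * n : ℤ) : ℝ)
    have h2 : |(2:ℝ) ^ C / 2 * M| - |u| ≤ |2 ^ C / 2 * M + u| := by
      have := abs_sub_abs_le_abs_sub (2 ^ C / 2 * M) (-u)
      rwa [abs_neg, sub_neg_eq_add] at this
    rw [abs_mul, abs_of_pos (by positivity : (0:ℝ) < 2 ^ C / 2)] at h2
    nlinarith
  · rw [hv n]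
    exact abs_int_div_two_ge (hT n hn)

theorem norm_haarDiff_kernel_le (Ξ : ℝ → ℂ) (x : ℝ) (k b d n : ℕ) :
    ‖haarDiff (fun t => Ξ (2 ^ k * (x - t))) (b + d) (2 ^ d * n)‖
      ≤ ‖Ξ (2 ^ k * (x - n / 2 ^ b) - (0:ℕ) * (2 ^ k / 2 ^ (b + d + 1)))‖
        + 2 * ‖Ξ (2 ^ k * (x - n / 2 ^ b) - (1:ℕ) * (2 ^ k / 2 ^ (b + d + 1)))‖
        + ‖Ξ (2 ^ k * (x - n / 2 ^ b) - (2:ℕ) * (2 ^ k / 2 ^ (b + d + 1)))‖ := by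
  rw [haarDiff_kernel]
  push_cast
  rw [zero_mul, sub_zero, one_mul]
  refine (norm_add_le _ _).trans (add_le_add_left ((norm_sub_le _ _).trans ?_) _)
  rw [norm_mul, Complex.norm_ofNat]

theorem sum_haarDiff_kernel_coarse_le {Ξ : ℝ → ℂ} {K : ℝ} (hK : 0 ≤ K)
    (hΞ : ∀ y, ‖Ξ y‖ ≤ K * ((1 + |y|) ^ 6)⁻¹) {b₀ d₀ n₀ C b d : ℕ} (hC : 2 ≤ C)
    (hj : b + d < b₀ + d₀) {u : ℝ} (hu : |u| ≤ 2 ^ C / 16) (T : Finset ℕ) :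
    ∑ n ∈ T, ‖haarDiff (fun t => Ξ (2 ^ (b₀ + d₀ + C) *
        (evalPoint b₀ d₀ n₀ (b₀ + d₀ + C) u - t))) (b + d) (2 ^ d * n)‖
      ≤ 2 ^ 16 * K * ((2 ^ C) ^ 4)⁻¹ := by
  have key : ∀ s : ℕ, _ := fun s => sum_kernel_values_le (n₀ := n₀) hK hΞ hC hj.le s hu T (by
    intro n _ h0
    obtain ⟨m, hm⟩ := Nat.exists_eq_add_of_lt hj
    rw [show b₀ + d₀ - (b + d) = m + 1 by omega] at h0
    have h1 : (2 * (2 ^ d₀ * n₀ - s * 2 ^ m - 2 ^ (b₀ + d₀ - b) * n) + 1 : ℤ) = 0 := by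
      rw [← h0]; ring
    omega)
  refine (Finset.sum_le_sum fun n _ => norm_haarDiff_kernel_le Ξ _ _ b d n).trans ?_
  rw [Finset.sum_add_distrib, Finset.sum_add_distrib, ← Finset.mul_sum]
  linarith [key 0, key 1, key 2]

theorem sum_haarDiff_kernel_same_le {Ξ : ℝ → ℂ} {K : ℝ} (hK : 0 ≤ K)
    (hΞ : ∀ y, ‖Ξ y‖ ≤ K * ((1 + |y|) ^ 6)⁻¹) {b₀ d₀ n₀ C : ℕ} (hC : 2 ≤ C)
    {u : ℝ} (hu : |u| ≤ 2 ^ C / 16) (T : Finset ℕ) (hT : n₀ ∉ T) :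
    ∑ n ∈ T, ‖haarDiff (fun t => Ξ (2 ^ (b₀ + d₀ + C) *
        (evalPoint b₀ d₀ n₀ (b₀ + d₀ + C) u - t))) (b₀ + d₀) (2 ^ d₀ * n)‖
      ≤ 2 ^ 16 * K * ((2 ^ C) ^ 4)⁻¹ := by
  have key : ∀ s : ℕ, s ≤ 2 → _ := fun s hs => sum_kernel_values_le (n₀ := n₀) (b₀ := b₀)
    (d₀ := d₀) hK hΞ hC le_rfl s hu T (by
    intro n hn h0
    rw [show b₀ + d₀ - (b₀ + d₀) = 0 by omega, show b₀ + d₀ - b₀ = d₀ by omega] at h0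
    have h1 : (2 * (2 ^ d₀ * ((n₀:ℤ) - n)) + 1 - s : ℤ) = 0 := by
      rw [← h0]; ring
    have hs1 : s = 1 := by omega
    subst hs1
    have h2 : (2 ^ d₀ * ((n₀:ℤ) - n)) = 0 := by push_cast at h1; linarith
    rcases mul_eq_zero.1 h2 with h | h
    · exact absurd h (by positivity)
    · have : n₀ = n := by omega
      exact hT (this ▸ hn))
  refine (Finset.sum_le_sum fun n _ => norm_haarDiff_kernel_le Ξ _ _ b₀ d₀ n).trans ?_
  rw [Finset.sum_add_distrib, Finset.sum_add_distrib, ← Finset.mul_sum]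
  linarith [key 0 (by norm_num), key 1 (by norm_num), key 2 le_rfl]

theorem norm_haarDiff_kernel_diag_le {Ξ : ℝ → ℂ} {K : ℝ} (hK : 0 ≤ K)
    (hΞ : ∀ y, ‖Ξ y‖ ≤ K * ((1 + |y|) ^ 6)⁻¹) {b₀ d₀ n₀ C : ℕ} (hC : 2 ≤ C)
    {u : ℝ} (hu : |u| ≤ 2 ^ C / 16) :
    ‖haarDiff (fun t => Ξ (2 ^ (b₀ + d₀ + C) *
        (evalPoint b₀ d₀ n₀ (b₀ + d₀ + C) u - t))) (b₀ + d₀) (2 ^ d₀ * n₀) + 2 * Ξ u‖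
      ≤ 2 ^ 16 * K * ((2 ^ C) ^ 4)⁻¹ := by
  have key : ∀ s : ℕ, s ≠ 1 → _ := fun s hs => sum_kernel_values_le (n₀ := n₀) (b₀ := b₀)
    (d₀ := d₀) (b := b₀) (d := d₀) hK hΞ hC le_rfl s hu {n₀} (by
    intro n hn h0
    rw [Finset.mem_singleton] at hn
    rw [show b₀ + d₀ - (b₀ + d₀) = 0 by omega, show b₀ + d₀ - b₀ = d₀ by omega, hn] at h0
    have h1 : (1 - s : ℤ) = 0 := by
      rw [← h0]; ring
    omega)
  have k0 := key 0 (by norm_num)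
  have k2 := key 2 (by norm_num)
  have h1 := evalPoint_arg b₀ d₀ n₀ C b₀ d₀ n₀ le_rfl 1 u
  rw [show b₀ + d₀ - (b₀ + d₀) = 0 by omega, show b₀ + d₀ - b₀ = d₀ by omega] at h1
  rw [haarDiff_kernel]
  push_cast at h1 k0 k2
  rw [Finset.sum_singleton] at k0 k2
  rw [zero_mul, sub_zero] at k0
  have h1' : (2:ℝ) ^ (b₀ + d₀ + C) * (evalPoint b₀ d₀ n₀ (b₀ + d₀ + C) u - n₀ / 2 ^ b₀)
        - (2 ^ (b₀ + d₀ + C) / 2 ^ (b₀ + d₀ + 1)) = u := by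
    rw [one_mul] at h1
    rw [h1]; ring
  rw [h1']
  have e : ∀ a b c : ℂ, a - 2 * b + c + 2 * b = a + c := fun a b c => by ring
  rw [e]
  have hp : 0 ≤ K * (((2:ℝ) ^ C) ^ 4)⁻¹ := by positivity
  refine (norm_add_le _ _).trans ?_
  linarith

theorem sum_haarDiff_kernel_fine_le {Ξ Ξ' Ξ'' : ℝ → ℂ} (h1 : ∀ x, HasDerivAt Ξ (Ξ' x) x)
    (h2 : ∀ x, HasDerivAt Ξ' (Ξ'' x) x) {K : ℝ} (hK : 0 ≤ K)
    (hΞ : ∀ y, ‖Ξ'' y‖ ≤ K * ((1 + |y|) ^ 6)⁻¹) {b₀ d₀ n₀ C d : ℕ} (hC : 2 ≤ C)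
    (hd : d₀ + 2 ≤ d) {u : ℝ} (hu : |u| ≤ 2 ^ C / 16) (T : Finset ℕ) :
    ∑ n ∈ T, ‖haarDiff (fun t => Ξ (2 ^ (b₀ + d₀ + C) *
        (evalPoint b₀ d₀ n₀ (b₀ + d₀ + C) u - t))) (b₀ + d) (2 ^ d * n)‖
      ≤ 2 ^ 13 * K * ((2 ^ C) ^ 2)⁻¹ * (2 ^ d₀ / 2 ^ d) ^ 2 := by
  have hR : (4:ℝ) ≤ 2 ^ C := by
    calc (4:ℝ) = 2 ^ 2 := by norm_num
      _ ≤ 2 ^ C := pow_le_pow_right₀ (by norm_num) hC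
  set h : ℝ := 2 ^ (b₀ + d₀ + C) / 2 ^ (b₀ + d + 1) with hh
  have hh0 : 0 ≤ h := by positivity
  have hheq : h = 2 ^ C * (2 ^ d₀ / 2 ^ d) / 2 := by
    rw [hh, pow_add, pow_add, pow_succ, pow_add]; field_simp
  have hhle : 2 * h ≤ 2 ^ C / 4 := by
    rw [hheq]
    have : (2:ℝ) ^ d₀ / 2 ^ d ≤ 1 / 4 := by
      rw [div_le_div_iff₀ (by positivity) (by norm_num)]
      calc (2:ℝ) ^ d₀ * 4 = 2 ^ (d₀ + 2) := by rw [pow_add]; norm_num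
        _ ≤ 2 ^ d := pow_le_pow_right₀ (by norm_num) hd
        _ = _ := by ring
    nlinarith
  set y₀ : ℝ := n₀ + (2 ^ (d₀ + 1))⁻¹ with hy₀
  set w : ℕ → ℝ := fun n => 2 ^ d₀ * |y₀ - n| with hw
  have hv : ∀ n : ℕ, w n = |((2 ^ (d₀ + 1) * ((n₀:ℤ) - n) + 1 : ℤ) : ℝ)| / 2 := by
    intro n
    have e : ((2 ^ (d₀ + 1) * ((n₀:ℤ) - n) + 1 : ℤ) : ℝ) = 2 ^ (d₀ + 1) * (y₀ - n) := by
      rw [hy₀]; push_cast; field_simp; ring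
    rw [e, abs_mul, abs_of_pos (by positivity : (0:ℝ) < 2 ^ (d₀ + 1)), pow_succ]
    simp only [hw]; ring
  have hw2 : ∀ n, 1 / 2 ≤ w n := by
    intro n
    rw [hv]
    apply abs_int_div_two_ge
    intro h0
    have : (2 * (2 ^ d₀ * ((n₀:ℤ) - n)) + 1 : ℤ) = 0 := by rw [← h0]; ring
    omega
  have hZ : ∀ n : ℕ, (2:ℝ) ^ C * w n - 2 ^ C / 16
      ≤ |2 ^ (b₀ + d₀ + C) * (evalPoint b₀ d₀ n₀ (b₀ + d₀ + C) u - n / 2 ^ b₀)| := by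
    intro n
    have e := evalPoint_arg b₀ d₀ n₀ C b₀ d₀ n le_rfl 0 u
    rw [show b₀ + d₀ - b₀ = d₀ by omega] at e
    push_cast at e
    rw [zero_mul, sub_zero] at e
    rw [e, hv]
    push_cast
    have e2 : (2:ℝ) ^ C / 2 * (2 ^ (d₀ + 1) * n₀ + 1 - 0 * 2 ^ (b₀ + d₀ - (b₀ + d₀))
        - 2 ^ (d₀ + 1) * n) = 2 ^ C / 2 * (2 ^ (d₀ + 1) * (n₀ - n) + 1) := by ring
    rw [e2]
    set M : ℝ := 2 ^ (d₀ + 1) * (n₀ - n) + 1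
    have h2 : |(2:ℝ) ^ C / 2 * M| - |u| ≤ |2 ^ C / 2 * M + u| := by
      have := abs_sub_abs_le_abs_sub (2 ^ C / 2 * M) (-u)
      rwa [abs_neg, sub_neg_eq_add] at this
    rw [abs_mul, abs_of_pos (by positivity : (0:ℝ) < 2 ^ C / 2)] at h2
    linarith
  have hterm : ∀ n ∈ T, ‖haarDiff (fun t => Ξ (2 ^ (b₀ + d₀ + C) *
        (evalPoint b₀ d₀ n₀ (b₀ + d₀ + C) u - t))) (b₀ + d) (2 ^ d * n)‖
      ≤ 2 * h ^ 2 * (K * ((1 + |2 ^ C * w n / 4|) ^ 6)⁻¹) := by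
    intro n _
    rw [haarDiff_kernel]
    refine (norm_second_difference_le h1 h2 hh0
      (M := K * ((1 + |2 ^ C * w n / 4|) ^ 6)⁻¹) ?_).trans_eq (by ring)
    intro y hy
    refine (hΞ y).trans ?_
    have hZn := hZ n
    set Z := 2 ^ (b₀ + d₀ + C) * (evalPoint b₀ d₀ n₀ (b₀ + d₀ + C) u - n / 2 ^ b₀)
    have hyZ : |Z| - |y| ≤ 2 * h := by
      refine (abs_sub_abs_le_abs_sub Z y).trans ?_
      rw [abs_of_nonneg (by linarith [hy.2])]
      linarith [hy.1]
    have hwn := hw2 n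
    have hle : |2 ^ C * w n / 4| ≤ |y| := by
      rw [abs_of_nonneg (by positivity)]
      nlinarith
    gcongr
  refine (Finset.sum_le_sum hterm).trans ?_
  rw [← Finset.mul_sum]
  have hs := sum_far_points_le hK hR (α := (2:ℝ) ^ d₀) (one_le_pow₀ (by norm_num)) T y₀
    (fun n => 2 ^ C * w n / 4) (fun n _ => le_abs_self _) (fun n _ => hw2 n)
  calc _ ≤ 2 * h ^ 2 * (2 ^ 14 * K * (((2:ℝ) ^ C) ^ 4)⁻¹) := by gcongr
    _ = _ := by rw [hheq]; field_simp

theorem sum_haarDiff_kernel_above_le {Ξ Ξ' Ξ'' : ℝ → ℂ} (h1 : ∀ x, HasDerivAt Ξ (Ξ' x) x)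
    (h2 : ∀ x, HasDerivAt Ξ' (Ξ'' x) x) {K : ℝ} (hK : 0 ≤ K)
    (hΞ : ∀ y, ‖Ξ'' y‖ ≤ K * ((1 + |y|) ^ 6)⁻¹) {k b d : ℕ} (hkb : k ≤ b)
    (x : ℝ) (T : Finset ℕ) :
    ∑ n ∈ T, ‖haarDiff (fun t => Ξ (2 ^ k * (x - t))) (b + d) (2 ^ d * n)‖
      ≤ 8 * K * (2 ^ k / 2 ^ (b + d)) ^ 2 * (2 ^ b / 2 ^ k) := by
  set h : ℝ := 2 ^ k / 2 ^ (b + d + 1) with hh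
  have hh0 : 0 ≤ h := by positivity
  have hheq : h = (2 ^ k / 2 ^ (b + d)) / 2 := by rw [hh, pow_succ]; field_simp
  have hhle : 2 * h ≤ 1 := by
    rw [hheq]
    have : (2:ℝ) ^ k / 2 ^ (b + d) ≤ 1 := by
      rw [div_le_one (by positivity)]
      exact pow_le_pow_right₀ (by norm_num) (by omega)
    linarith
  set α : ℝ := 2 ^ k / 2 ^ b with hα
  have hα0 : 0 < α := by positivity
  have hα1 : α ≤ 1 := by
    rw [hα, div_le_one (by positivity)]
    exact pow_le_pow_right₀ (by norm_num) hkb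
  have hterm : ∀ n ∈ T, ‖haarDiff (fun t => Ξ (2 ^ k * (x - t))) (b + d) (2 ^ d * n)‖
      ≤ (8 * K * h ^ 2) * ((1 + α * |2 ^ b * x - ((n:ℤ):ℝ)|) ^ 2)⁻¹ := by
    intro n _
    rw [haarDiff_kernel]
    refine (norm_second_difference_le h1 h2 hh0
      (M := 4 * K * ((1 + α * |2 ^ b * x - ((n:ℤ):ℝ)|) ^ 2)⁻¹) ?_).trans_eq (by ring)
    intro y hy
    refine (hΞ y).trans ?_
    have hZ : |(2:ℝ) ^ k * (x - n / 2 ^ b)| = α * |2 ^ b * x - ((n:ℤ):ℝ)| := by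
      rw [← abs_of_pos hα0, ← abs_mul, hα]
      congr 1
      push_cast
      field_simp
    rw [← hZ]
    set Z := (2:ℝ) ^ k * (x - n / 2 ^ b)
    have hyZ : |Z| - |y| ≤ 1 := by
      refine (abs_sub_abs_le_abs_sub Z y).trans ?_
      rw [abs_of_nonneg (by linarith [hy.2])]
      linarith [hy.1]
    have hy0 := abs_nonneg y
    have h3 : (1 + |Z|) / 2 ≤ 1 + |y| := by linarith
    have h4 : ((1 + |Z|) / 2) ^ 2 ≤ (1 + |y|) ^ 6 := by
      calc ((1 + |Z|) / 2) ^ 2 ≤ (1 + |y|) ^ 2 := by gcongr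
        _ ≤ _ := pow_le_pow_right₀ (by linarith) (by norm_num)
    calc K * ((1 + |y|) ^ 6)⁻¹ ≤ K * (((1 + |Z|) / 2) ^ 2)⁻¹ := by gcongr
      _ = _ := by rw [div_pow, inv_div]; ring
  refine (Finset.sum_le_sum hterm).trans ?_
  rw [← Finset.mul_sum]
  have hs := sum_lattice_le hα0 T (fun n : ℕ => (n : ℤ)) (fun _ _ _ _ h => by simpa using h)
    (2 ^ b * x)
  have hα' : 1 ≤ α⁻¹ := (one_le_inv₀ hα0).2 hα1
  calc _ ≤ (8 * K * h ^ 2) * (4 * α⁻¹) := by gcongr; linarith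
    _ = _ := by rw [hheq, hα]; field_simp; norm_num

/-- The size of the Haar coefficients at level `b + d` of a test function, up to constants. -/
def haarWeight (q : ℝ) (b d : ℕ) : ℝ := (2:ℝ) ^ (((b:ℝ) + d) - b / q)

theorem haarWeight_pos (q : ℝ) (b d : ℕ) : 0 < haarWeight q b d := by
  unfold haarWeight; positivity

theorem two_pow_eq_rpow (n : ℕ) : (2:ℝ) ^ n = (2:ℝ) ^ (n:ℝ) := (Real.rpow_natCast 2 n).symm

theorem mul_two_rpow_le {K c e₁ e₂ : ℝ} (hK : 0 ≤ K) (hc : c ≤ 2 ^ 17) (he : e₁ ≤ e₂) :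
    c * K * (2:ℝ) ^ e₁ ≤ 2 ^ 17 * K * (2:ℝ) ^ e₂ := by
  have := Real.rpow_le_rpow_of_exponent_le (by norm_num : (1:ℝ) ≤ 2) he
  gcongr

theorem sum_ite_add_singleton_le {D : ℕ → ℂ} {w : ℂ} {B : ℝ} (n₀ : ℕ) (T : Finset ℕ)
    (h₁ : ∑ n ∈ T.erase n₀, ‖D n‖ ≤ B) (h₂ : ‖D n₀ + w‖ ≤ B) :
    ∑ n ∈ T, ‖D n + if n = n₀ then w else 0‖ ≤ 2 * B := by
  have hB : 0 ≤ B := (norm_nonneg _).trans h₂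
  have h3 : ∑ n ∈ T.erase n₀, ‖D n + if n = n₀ then w else 0‖ ≤ B := by
    refine (Finset.sum_congr rfl fun n hn => ?_).trans_le h₁
    rw [if_neg (Finset.ne_of_mem_erase hn), add_zero]
  by_cases hn : n₀ ∈ T
  · rw [← Finset.add_sum_erase T _ hn, if_pos rfl]
    linarith
  · rw [Finset.erase_eq_of_notMem hn] at h3
    linarith

theorem haarWeight_mul_sum_kernel_le {Ξ Ξ' Ξ'' : ℝ → ℂ} (h1 : ∀ x, HasDerivAt Ξ (Ξ' x) x)
    (h2 : ∀ x, HasDerivAt Ξ' (Ξ'' x) x) {K : ℝ} (hK : 0 ≤ K)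
    (hΞ : ∀ y, ‖Ξ y‖ ≤ K * ((1 + |y|) ^ 6)⁻¹) (hΞ'' : ∀ y, ‖Ξ'' y‖ ≤ K * ((1 + |y|) ^ 6)⁻¹)
    {q ε : ℝ} (hε : 0 < ε) (hε1 : 2 * ε ≤ 1 / q) (hε2 : 2 * ε ≤ 1 - 1 / q)
    {N C b₀ d₀ n₀ b d : ℕ} (hC : 2 ≤ C) (hCN : C ≤ N) (hd₀ : d₀ ≤ N) (hd : d ≤ N)
    (hsame : b = b₀ → d ≤ d₀ ∨ d₀ + 2 ≤ d) (hgap : b ≠ b₀ → 4 * N ≤ ε * |(b:ℝ) - b₀|)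
    {u : ℝ} (hu : |u| ≤ 2 ^ C / 16) (T : Finset ℕ) :
    haarWeight q b d * ∑ n ∈ T, ‖haarDiff (fun t => Ξ (2 ^ (b₀ + d₀ + C) *
        (evalPoint b₀ d₀ n₀ (b₀ + d₀ + C) u - t))) (b + d) (2 ^ d * n)
          + if b + d = b₀ + d₀ ∧ n = n₀ then 2 * Ξ u else 0‖
      ≤ 2 ^ 17 * K * ((2 ^ C) ^ 2)⁻¹ * (2:ℝ) ^ (-ε * |((b + d : ℕ):ℝ) - (b₀ + d₀ : ℕ)|)
        * haarWeight q b₀ d₀ := by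
  have hε3 : ε ≤ 1 / 4 := by linarith
  have hW := haarWeight_pos q b d
  have hC' : (2:ℝ) ≤ C := by exact_mod_cast hC
  have hCN' : (C:ℝ) ≤ N := by exact_mod_cast hCN
  have hd₀' : (d₀:ℝ) ≤ N := by exact_mod_cast hd₀
  have hd' : (d:ℝ) ≤ N := by exact_mod_cast hd
  have hd₀0 : (0:ℝ) ≤ d₀ := by positivity
  have hd0 : (0:ℝ) ≤ d := by positivity
  have hR2 : (((2:ℝ) ^ C) ^ 2)⁻¹ = (2:ℝ) ^ (-2 * (C:ℝ)) := by
    rw [← pow_mul, two_pow_eq_rpow, ← Real.rpow_neg (by norm_num)]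
    push_cast; ring_nf
  have hR4 : (((2:ℝ) ^ C) ^ 4)⁻¹ = (2:ℝ) ^ (-4 * (C:ℝ)) := by
    rw [← pow_mul, two_pow_eq_rpow, ← Real.rpow_neg (by norm_num)]
    push_cast; ring_nf
  have hRHS : 2 ^ 17 * K * ((2 ^ C) ^ 2)⁻¹ * (2:ℝ) ^ (-ε * |((b + d : ℕ):ℝ) - (b₀ + d₀ : ℕ)|)
        * haarWeight q b₀ d₀ = 2 ^ 17 * K * (2:ℝ) ^ (-2 * (C:ℝ)
          - ε * |((b:ℝ) + d) - (b₀ + d₀)| + (((b₀:ℝ) + d₀) - b₀ / q)) := by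
    rw [hR2, haarWeight, Real.rpow_add (by norm_num), sub_eq_add_neg (-2 * (C:ℝ)),
      Real.rpow_add (by norm_num) (-2 * (C:ℝ)), neg_mul ε]
    push_cast
    ring
  rw [hRHS]
  have hoff : b + d ≠ b₀ + d₀ → (∑ n ∈ T, ‖haarDiff (fun t => Ξ (2 ^ (b₀ + d₀ + C) *
        (evalPoint b₀ d₀ n₀ (b₀ + d₀ + C) u - t))) (b + d) (2 ^ d * n)
          + if b + d = b₀ + d₀ ∧ n = n₀ then 2 * Ξ u else 0‖)
      = ∑ n ∈ T, ‖haarDiff (fun t => Ξ (2 ^ (b₀ + d₀ + C) *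
        (evalPoint b₀ d₀ n₀ (b₀ + d₀ + C) u - t))) (b + d) (2 ^ d * n)‖ := by
    intro hne
    refine Finset.sum_congr rfl fun n _ => ?_
    rw [if_neg (fun h => hne h.1), add_zero]
  have coarse : b + d < b₀ + d₀ → ((b:ℝ) + d) - b / q - 4 * C ≤ -2 * (C:ℝ)
          - ε * |((b:ℝ) + d) - (b₀ + d₀)| + (((b₀:ℝ) + d₀) - b₀ / q) →
      haarWeight q b d * ∑ n ∈ T, ‖haarDiff (fun t => Ξ (2 ^ (b₀ + d₀ + C) *
        (evalPoint b₀ d₀ n₀ (b₀ + d₀ + C) u - t))) (b + d) (2 ^ d * n)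
          + if b + d = b₀ + d₀ ∧ n = n₀ then 2 * Ξ u else 0‖
      ≤ 2 ^ 17 * K * (2:ℝ) ^ (-2 * (C:ℝ)
          - ε * |((b:ℝ) + d) - (b₀ + d₀)| + (((b₀:ℝ) + d₀) - b₀ / q)) := by
    intro hlt hexp
    rw [hoff hlt.ne]
    refine (mul_le_mul_of_nonneg_left
      (sum_haarDiff_kernel_coarse_le hK hΞ hC hlt hu T) hW.le).trans ?_
    refine le_trans (le_of_eq ?_) (mul_two_rpow_le (c := 2 ^ 16) hK (by norm_num) hexp)
    rw [hR4, haarWeight, sub_eq_add_neg _ (4 * (C:ℝ)), Real.rpow_add (by norm_num) _ (-(4 * (C:ℝ))),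
      neg_mul]
    ring
  by_cases hb : b = b₀
  · subst hb
    rcases lt_trichotomy d d₀ with hlt | rfl | hgt
    · refine coarse (by omega) ?_
      have hlt' : (d:ℝ) < d₀ := by exact_mod_cast hlt
      rw [abs_of_neg (by linarith)]
      nlinarith
    · have hs := sum_ite_add_singleton_le n₀ T
        (sum_haarDiff_kernel_same_le (b₀ := b) (d₀ := d) hK hΞ hC hu (T.erase n₀)
          (Finset.notMem_erase n₀ T))
        (norm_haarDiff_kernel_diag_le (b₀ := b) (d₀ := d) hK hΞ hC hu)
      simp only [true_and]
      refine (mul_le_mul_of_nonneg_left hs hW.le).trans ?_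
      refine le_trans (le_of_eq ?_) (mul_two_rpow_le (c := 2 ^ 17)
        (e₁ := (((b:ℝ) + d) - b / q) + -4 * C) hK (by norm_num) ?_)
      · rw [hR4, haarWeight, Real.rpow_add (by norm_num) _ (-4 * (C:ℝ))]
        ring
      · rw [sub_self, abs_zero]; linarith
    · have hd2 : d₀ + 2 ≤ d := by
        rcases hsame rfl with h | h
        · omega
        · exact h
      rw [hoff (by omega)]
      refine (mul_le_mul_of_nonneg_left
        (sum_haarDiff_kernel_fine_le h1 h2 hK hΞ'' hC hd2 hu T) hW.le).trans ?_
      refine le_trans (le_of_eq ?_) (mul_two_rpow_le (c := 2 ^ 13)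
        (e₁ := (((b:ℝ) + d) - b / q) + (-2 * C + 2 * ((d₀:ℝ) - d))) hK (by norm_num) ?_)
      · rw [hR2, haarWeight, Real.rpow_add (by norm_num) _ (-2 * (C:ℝ) + 2 * ((d₀:ℝ) - d)),
          Real.rpow_add (by norm_num) (-2 * (C:ℝ)), two_pow_eq_rpow d, two_pow_eq_rpow d₀,
          ← Real.rpow_sub (by norm_num), mul_comm (2:ℝ) ((d₀:ℝ) - d),
          Real.rpow_mul (by norm_num) ((d₀:ℝ) - d) 2,
          Real.rpow_two]
        ring
      · have hlt' : (d₀:ℝ) + 2 ≤ d := by exact_mod_cast hd2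
        rw [abs_of_nonneg (by linarith)]
        nlinarith
  · have hg := hgap hb
    have hg2 : 16 * (N:ℝ) ≤ |(b:ℝ) - b₀| := by
      have : (0:ℝ) ≤ |(b:ℝ) - b₀| := abs_nonneg _
      nlinarith
    rcases lt_or_gt_of_ne hb with hlt | hgt
    · have hlt' : (b:ℝ) < b₀ := by exact_mod_cast hlt
      rw [abs_of_neg (by linarith)] at hg hg2
      have hlt2 : b + d < b₀ + d₀ := by
        have : (b:ℝ) + d < b₀ + d₀ := by linarith
        exact_mod_cast this
      refine coarse hlt2 ?_
      have hlt3 : (b:ℝ) + d < b₀ + d₀ := by exact_mod_cast hlt2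
      rw [abs_of_neg (by linarith)]
      have e : ((b₀:ℝ) - b) * (2 * ε) ≤ (b₀ - b) * (1 - 1 / q) := by
        apply mul_le_mul_of_nonneg_left hε2; linarith
      have e2 : (b:ℝ) / q = b * (1 / q) := by ring
      have e3 : (b₀:ℝ) / q = b₀ * (1 / q) := by ring
      rw [e2, e3]
      have e4 : ε * (d₀:ℝ) ≤ (1/4) * N := by nlinarith
      have e5 : 0 ≤ ε * (d:ℝ) := by positivity
      nlinarith
    · have hgt' : (b₀:ℝ) < b := by exact_mod_cast hgt
      rw [abs_of_pos (by linarith)] at hg hg2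
      have hgt2 : b₀ + d₀ + C ≤ b := by
        have : (b₀:ℝ) + d₀ + C ≤ b := by linarith
        exact_mod_cast this
      rw [hoff (by omega)]
      refine (mul_le_mul_of_nonneg_left
        (sum_haarDiff_kernel_above_le h1 h2 hK hΞ'' hgt2 _ T) hW.le).trans ?_
      refine le_trans (le_of_eq ?_) (mul_two_rpow_le (c := 8)
        (e₁ := (((b:ℝ) + d) - b / q) + ((((b₀:ℝ) + d₀ + C) - (b + d)) * 2
          + (b - (b₀ + d₀ + C)))) hK (by norm_num) ?_)
      · rw [haarWeight, Real.rpow_add (by norm_num) _ ((((b₀:ℝ) + d₀ + C) - (b + d)) * 2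
          + (b - (b₀ + d₀ + C))), Real.rpow_add (by norm_num) ((((b₀:ℝ) + d₀ + C) - (b + d)) * 2),
          Real.rpow_mul (by norm_num), Real.rpow_two, Real.rpow_sub (by norm_num) ((b₀:ℝ) + d₀ + C),
          Real.rpow_sub (by norm_num) (b:ℝ) ((b₀:ℝ) + d₀ + C), two_pow_eq_rpow b,
          two_pow_eq_rpow (b + d), two_pow_eq_rpow (b₀ + d₀ + C)]
        push_cast
        ring
      · rw [abs_of_pos (by linarith)]
        have e : ((b:ℝ) - b₀) * (2 * ε) ≤ (b - b₀) * (1 / q) := by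
          apply mul_le_mul_of_nonneg_left hε1; linarith
        have e2 : (b:ℝ) / q = b * (1 / q) := by ring
        have e3 : (b₀:ℝ) / q = b₀ * (1 / q) := by ring
        rw [e2, e3]
        have e4 : ε * (d:ℝ) ≤ (1/4) * N := by nlinarith
        have e5 : 0 ≤ ε * (d₀:ℝ) := by positivity
        linarith

/-- Frequencies `j ∈ J` that are organised in widely separated blocks `[β j, β j + N]`, with
distinct frequencies of one block at distance at least two. -/
structure SeparatedLevels (ε : ℝ) (N : ℕ) (J : Finset ℕ) (β : ℕ → ℕ) : Prop where
  le : ∀ j ∈ J, β j ≤ j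
  le_add : ∀ j ∈ J, j ≤ β j + N
  gap_same : ∀ i ∈ J, ∀ j ∈ J, β i = β j → i < j → i + 2 ≤ j
  gap : ∀ i ∈ J, ∀ j ∈ J, β i ≠ β j → 4 * N ≤ ε * |(β i : ℝ) - β j|

/-- The Haar indices `(j, 2^{j - β j} n)` with `j ∈ J` and `0 ≤ n < 2^{β j}`. -/
def haarIndexSet (J : Finset ℕ) (β : ℕ → ℕ) : Finset (ℕ × ℤ) :=
  J.biUnion fun j => (Finset.range (2 ^ β j)).image fun n : ℕ => (j, 2 ^ (j - β j) * (n:ℤ))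

theorem sum_haarIndexSet (J : Finset ℕ) (β : ℕ → ℕ) (g : ℕ × ℤ → ℂ) :
    ∑ e ∈ haarIndexSet J β, g e
      = ∑ j ∈ J, ∑ n ∈ Finset.range (2 ^ β j), g (j, 2 ^ (j - β j) * (n:ℤ)) := by
  rw [haarIndexSet, Finset.sum_biUnion]
  · refine Finset.sum_congr rfl fun j _ => Finset.sum_image ?_
    intro n _ m _ h
    simpa using h
  · intro i _ j _ hij
    rw [Function.onFun, Finset.disjoint_left]
    intro e he he'
    simp only [Finset.mem_image] at he he'
    obtain ⟨n, _, rfl⟩ := he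
    obtain ⟨m, _, hm⟩ := he'
    exact hij (congrArg Prod.fst hm).symm

theorem mem_HFset_haarIndexSet {J : Finset ℕ} {β : ℕ → ℕ} {j : ℕ}
    (hj : j ∈ HFset (haarIndexSet J β)) : j ∈ J := by
  simp only [HFset, haarIndexSet, Finset.mem_image, Finset.mem_biUnion] at hj
  obtain ⟨e, ⟨i, hi, n, _, rfl⟩, rfl⟩ := hj
  exact hi

theorem norm_haarCoeff_testPot_bounds (θ : SchwartzMap ℝ ℂ) {K q ε : ℝ} (hK : 0 ≤ K) (hε : 0 < ε)
    (hε1 : 2 * ε ≤ 1 / q) (hε2 : 2 * ε ≤ 1 - 1 / q)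
    (hg : ∀ x, ‖θ x‖ ≤ K * ((1 + |x|) ^ 6)⁻¹) (hg' : ∀ x, ‖deriv θ x‖ ≤ K * ((1 + |x|) ^ 6)⁻¹)
    {N b d n : ℕ} {S : Finset ℕ} (hbS : b ∈ S)
    (hgap : ∀ b' ∈ S, b' ≠ b → 4 * N ≤ ε * |(b':ℝ) - b|) (hd : d ≤ N) (hn : n < 2 ^ b)
    (hN : K * (100 + 128 * (1 - (2:ℝ) ^ (-ε))⁻¹) ≤ N * ‖θ 0‖ / 2) :
    N * ‖θ 0‖ / 2 * haarWeight q b d ≤ ‖(2:ℂ) ^ (b + d) *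
        haarDiff (testPot θ (fun b => (2:ℝ) ^ (-(b:ℝ) / q)) N S) (b + d) (2 ^ d * n)‖ ∧
      ‖(2:ℂ) ^ (b + d) *
        haarDiff (testPot θ (fun b => (2:ℝ) ^ (-(b:ℝ) / q)) N S) (b + d) (2 ^ d * n)‖
        ≤ 5 / 2 * (N * ‖θ 0‖) * haarWeight q b d := by
  obtain ⟨c, hc1, hc2, hc⟩ := norm_haarDiff_testPot_sub_le θ hK hε hε1 hε2 hg hg' hbS hgap hd hn
  set D := haarDiff (testPot θ (fun b => (2:ℝ) ^ (-(b:ℝ) / q)) N S) (b + d) (2 ^ d * n)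
  set A : ℝ := (2:ℝ) ^ (-(b:ℝ) / q) with hA
  have hA0 : 0 < A := by positivity
  have hW : haarWeight q b d = 2 ^ (b + d) * A := by
    rw [haarWeight, two_pow_eq_rpow, hA, ← Real.rpow_add (by norm_num)]
    push_cast; congr 1; ring
  have hmain : ‖(A:ℂ) * (c * (N * θ 0))‖ = A * (c * (N * ‖θ 0‖)) := by
    rw [norm_mul, norm_mul, norm_mul, Complex.norm_real, Complex.norm_real, Complex.norm_natCast,
      Real.norm_of_nonneg hA0.le, Real.norm_of_nonneg (by linarith)]
  have hX : 0 ≤ N * ‖θ 0‖ := by positivity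
  set X := N * ‖θ 0‖
  have hc' : ‖D - (A:ℂ) * (c * (N * θ 0))‖ ≤ A * (X / 2) := hc.trans (by gcongr)
  have h1 := norm_sub_norm_le ((A:ℂ) * (c * (N * θ 0))) D
  rw [norm_sub_rev, hmain] at h1
  have h2 := norm_sub_norm_le D ((A:ℂ) * (c * (N * θ 0)))
  rw [hmain] at h2
  have hlo : A * X ≤ A * (c * X) := by gcongr; nlinarith
  have hhi : A * (c * X) ≤ A * (2 * X) := by gcongr
  rw [norm_mul, norm_pow, Complex.norm_ofNat, hW]
  have hp : (0:ℝ) < 2 ^ (b + d) := by positivity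
  constructor
  · have : X / 2 * A ≤ ‖D‖ := by linarith
    calc X / 2 * (2 ^ (b + d) * A) = 2 ^ (b + d) * (X / 2 * A) := by ring
      _ ≤ _ := by gcongr
  · have : ‖D‖ ≤ 5 / 2 * X * A := by linarith
    calc 2 ^ (b + d) * ‖D‖ ≤ 2 ^ (b + d) * (5 / 2 * X * A) := by gcongr
      _ = _ := by ring

theorem norm_haarSum_kernel_ge {Ξ Ξ' Ξ'' : ℝ → ℂ} (h1 : ∀ x, HasDerivAt Ξ (Ξ' x) x)
    (h2 : ∀ x, HasDerivAt Ξ' (Ξ'' x) x) {K : ℝ} (hK : 0 ≤ K)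
    (hΞ : ∀ y, ‖Ξ y‖ ≤ K * ((1 + |y|) ^ 6)⁻¹) (hΞ'' : ∀ y, ‖Ξ'' y‖ ≤ K * ((1 + |y|) ^ 6)⁻¹)
    {q ε : ℝ} (hε : 0 < ε) (hε1 : 2 * ε ≤ 1 / q) (hε2 : 2 * ε ≤ 1 - 1 / q)
    {N C : ℕ} (hC : 2 ≤ C) (hCN : C ≤ N) {J : Finset ℕ} {β : ℕ → ℕ}
    (hJ : SeparatedLevels ε N J β) {a : ℕ → ℕ → ℂ} {X c₁ u : ℝ} (hX : 0 ≤ X)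
    (ha : ∀ j ∈ J, ∀ n < 2 ^ β j, ‖a j n‖ ≤ 5 / 2 * X * haarWeight q (β j) (j - β j))
    {j₀ n₀ : ℕ} (hj₀ : j₀ ∈ J) (hn₀ : n₀ < 2 ^ β j₀)
    (ha₀ : X / 2 * haarWeight q (β j₀) (j₀ - β j₀) ≤ ‖a j₀ n₀‖)
    (hu : |u| ≤ 2 ^ C / 16) (hc₁ : c₁ ≤ ‖Ξ u‖)
    (hR : 10 * 2 ^ 17 * K * (((2:ℝ) ^ C) ^ 2)⁻¹ * (1 - (2:ℝ) ^ (-ε))⁻¹ ≤ c₁) :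
    X * c₁ / 2 * haarWeight q (β j₀) (j₀ - β j₀)
      ≤ ‖∑ j ∈ J, ∑ n ∈ Finset.range (2 ^ β j), a j n *
          haarDiff (fun t => Ξ (2 ^ (j₀ + C) * (evalPoint (β j₀) (j₀ - β j₀) n₀ (j₀ + C) u - t))) j
            (2 ^ (j - β j) * n)‖ := by
  set W : ℕ → ℝ := fun j => haarWeight q (β j) (j - β j) with hW
  set D : ℕ → ℕ → ℂ := fun j n => haarDiff (fun t => Ξ (2 ^ (j₀ + C) *
    (evalPoint (β j₀) (j₀ - β j₀) n₀ (j₀ + C) u - t))) j (2 ^ (j - β j) * n) with hD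
  have hW₀ : 0 < W j₀ := haarWeight_pos _ _ _
  have hlev : ∀ j ∈ J, β j + (j - β j) = j := fun j hj => Nat.add_sub_cancel' (hJ.le j hj)
  set y : ℕ → ℕ → ℂ := fun j n => if j = j₀ ∧ n = n₀ then 2 * Ξ u else 0 with hy
  have hbound : ∀ j ∈ J, W j * ∑ n ∈ Finset.range (2 ^ β j), ‖D j n + y j n‖
      ≤ 2 ^ 17 * K * ((2 ^ C) ^ 2)⁻¹ * (2:ℝ) ^ (-ε * |(j:ℝ) - j₀|) * W j₀ := by
    intro j hj
    have hle := hJ.le j hj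
    have hle₀ := hJ.le j₀ hj₀
    have hadd := hJ.le_add j hj
    have hadd₀ := hJ.le_add j₀ hj₀
    have := haarWeight_mul_sum_kernel_le (n₀ := n₀) h1 h2 hK hΞ hΞ'' hε hε1 hε2 hC hCN
      (b₀ := β j₀) (d₀ := j₀ - β j₀) (b := β j) (d := j - β j) (by omega) (by omega)
      (by
        intro hb
        by_cases hlt : j₀ < j
        · have := hJ.gap_same j₀ hj₀ j hj hb.symm hlt
          omega
        · omega)
      (fun hb => hJ.gap j hj j₀ hj₀ hb) hu (Finset.range (2 ^ β j))
    rwa [hlev j hj, hlev j₀ hj₀] at this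
  have hsplit : ∑ j ∈ J, ∑ n ∈ Finset.range (2 ^ β j), a j n * D j n
      = (∑ j ∈ J, ∑ n ∈ Finset.range (2 ^ β j), a j n * (D j n + y j n))
        - a j₀ n₀ * (2 * Ξ u) := by
    have e : ∑ j ∈ J, ∑ n ∈ Finset.range (2 ^ β j), a j n * y j n = a j₀ n₀ * (2 * Ξ u) := by
      rw [Finset.sum_eq_single_of_mem j₀ hj₀, Finset.sum_eq_single_of_mem n₀
        (Finset.mem_range.2 hn₀)]
      · simp [hy]
      · intro n _ hn; simp [hy, hn]
      · intro j _ hj; simp [hy, hj]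
    simp only [mul_add, Finset.sum_add_distrib]
    rw [e]; ring
  have herr : ‖∑ j ∈ J, ∑ n ∈ Finset.range (2 ^ β j), a j n * (D j n + y j n)‖
      ≤ X * c₁ / 2 * W j₀ := by
    calc _ ≤ ∑ j ∈ J, 5 / 2 * X * (2 ^ 17 * K * ((2 ^ C) ^ 2)⁻¹ * W j₀)
          * (2:ℝ) ^ (-ε * |(j:ℝ) - j₀|) := by
          refine norm_sum_le_of_le _ fun j hj => ?_
          calc _ ≤ ∑ n ∈ Finset.range (2 ^ β j), 5 / 2 * X * W j * ‖D j n + y j n‖ := by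
                refine norm_sum_le_of_le _ fun n hn => ?_
                rw [norm_mul]
                gcongr
                exact ha j hj n (Finset.mem_range.1 hn)
            _ = 5 / 2 * X * (W j * ∑ n ∈ Finset.range (2 ^ β j), ‖D j n + y j n‖) := by
                rw [← Finset.mul_sum]; ring
            _ ≤ 5 / 2 * X * (2 ^ 17 * K * ((2 ^ C) ^ 2)⁻¹ * (2:ℝ) ^ (-ε * |(j:ℝ) - j₀|) * W j₀) := by
                exact mul_le_mul_of_nonneg_left (hbound j hj) (by positivity)
            _ = _ := by ring
      _ ≤ 5 / 2 * X * (2 ^ 17 * K * ((2 ^ C) ^ 2)⁻¹ * W j₀) * (2 * (1 - (2:ℝ) ^ (-ε))⁻¹) := by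
          rw [← Finset.mul_sum]
          gcongr
          exact sum_two_rpow_neg_dist_le hε J j₀
      _ = X / 2 * W j₀ * (10 * 2 ^ 17 * K * (((2:ℝ) ^ C) ^ 2)⁻¹ * (1 - (2:ℝ) ^ (-ε))⁻¹) := by ring
      _ ≤ X / 2 * W j₀ * c₁ := by gcongr
      _ = _ := by ring
  have hmain : X * c₁ * W j₀ ≤ ‖a j₀ n₀ * (2 * Ξ u)‖ := by
    rw [norm_mul, norm_mul, Complex.norm_ofNat]
    have h3 : 0 ≤ X / 2 * W j₀ := by positivity
    calc X * c₁ * W j₀ = (X / 2 * W j₀) * (2 * c₁) := by ring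
      _ ≤ (X / 2 * W j₀) * (2 * ‖Ξ u‖) := by gcongr
      _ ≤ _ := by gcongr
  change X * c₁ / 2 * W j₀ ≤ ‖∑ j ∈ J, ∑ n ∈ Finset.range (2 ^ β j), a j n * D j n‖
  rw [hsplit, norm_sub_rev]
  have := norm_sub_norm_le (a j₀ n₀ * (2 * Ξ u))
    (∑ j ∈ J, ∑ n ∈ Finset.range (2 ^ β j), a j n * (D j n + y j n))
  linarith

theorem norm_LPop_haarProj_ge {φ₀ : ℝ → ℂ} {Ξ θ f : SchwartzMap ℝ ℂ}
    (hΞd : ∀ x, HasDerivAt Ξ (𝓕⁻ (fun ξ => φ₀ ξ - φ₀ (2*ξ)) x) x) {K : ℝ} (hK : 0 ≤ K)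
    (hΞ : ∀ y, ‖Ξ y‖ ≤ K * ((1 + |y|) ^ 6)⁻¹)
    (hΞ'' : ∀ y, ‖deriv (deriv Ξ) y‖ ≤ K * ((1 + |y|) ^ 6)⁻¹)
    (hg : ∀ x, ‖θ x‖ ≤ K * ((1 + |x|) ^ 6)⁻¹) (hg' : ∀ x, ‖deriv θ x‖ ≤ K * ((1 + |x|) ^ 6)⁻¹)
    {q ε : ℝ} (hε : 0 < ε) (hε1 : 2 * ε ≤ 1 / q) (hε2 : 2 * ε ≤ 1 - 1 / q)
    {N C : ℕ} (hC : 2 ≤ C) (hCN : C ≤ N) {J : Finset ℕ} {β : ℕ → ℕ}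
    (hJ : SeparatedLevels ε N J β)
    (hf : ∀ x, HasDerivAt (testPot θ (fun b => (2:ℝ) ^ (-(b:ℝ) / q)) N (J.image β)) (f x) x)
    (hN : K * (100 + 128 * (1 - (2:ℝ) ^ (-ε))⁻¹) ≤ N * ‖θ 0‖ / 2) {c₁ u : ℝ}
    {j₀ n₀ : ℕ} (hj₀ : j₀ ∈ J) (hn₀ : n₀ < 2 ^ β j₀)
    (hu : |u| ≤ 2 ^ C / 16) (hc₁ : c₁ ≤ ‖Ξ u‖)
    (hR : 10 * 2 ^ 17 * K * (((2:ℝ) ^ C) ^ 2)⁻¹ * (1 - (2:ℝ) ^ (-ε))⁻¹ ≤ c₁) :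
    N * ‖θ 0‖ * c₁ / 2 * haarWeight q (β j₀) (j₀ - β j₀)
      ≤ ‖LPop φ₀ (j₀ + C) (haarProj (haarIndexSet J β) f)
          (evalPoint (β j₀) (j₀ - β j₀) n₀ (j₀ + C) u)‖ := by
  have hsmooth : ContDiff ℝ (⊤ : ℕ∞) Ξ := Ξ.smooth _
  have hd1 : ∀ x, HasDerivAt Ξ (deriv Ξ x) x := fun x =>
    (hsmooth.differentiable (by simp) x).hasDerivAt
  have hs1 : ContDiff ℝ (⊤ : ℕ∞) (deriv Ξ) :=
    (contDiff_infty_iff_deriv.1 hsmooth).2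
  have hd2 : ∀ x, HasDerivAt (deriv Ξ) (deriv (deriv Ξ) x) x := fun x =>
    (hs1.differentiable (by simp) x).hasDerivAt
  have hΞc : Continuous (𝓕⁻ (fun ξ => φ₀ ξ - φ₀ (2*ξ)) : ℝ → ℂ) := by
    have : (𝓕⁻ (fun ξ => φ₀ ξ - φ₀ (2*ξ)) : ℝ → ℂ) = deriv Ξ := by
      ext x; exact (hΞd x).deriv.symm
    rw [this]; exact hs1.continuous
  have hcoef : ∀ j ∈ J, ∀ n < 2 ^ β j, _ := fun j hj n hn =>
    norm_haarCoeff_testPot_bounds θ (q := q) (b := β j) (d := j - β j) (n := n)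
      (S := J.image β) (N := N) hK hε hε1 hε2 hg hg' (Finset.mem_image_of_mem β hj)
      (by
        intro b' hb' hne
        obtain ⟨i, hi, rfl⟩ := Finset.mem_image.1 hb'
        exact hJ.gap i hi j hj hne)
      (by have := hJ.le_add j hj; omega) hn hN
  have hlev : ∀ j ∈ J, β j + (j - β j) = j := fun j hj => Nat.add_sub_cancel' (hJ.le j hj)
  rw [LPop_haarProj hΞd hΞc hf f.continuous _ (by omega) _, norm_neg, sum_haarIndexSet]
  push_cast
  refine norm_haarSum_kernel_ge hd1 hd2 hK hΞ hΞ'' hε hε1 hε2 hC hCN hJ (by positivity)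
    (fun j hj n hn => ?_) hj₀ hn₀ ?_ hu hc₁ hR
  · have := (hcoef j hj n hn).2
    rwa [hlev j hj] at this
  · have := (hcoef j₀ hj₀ n₀ hn₀).1
    rwa [hlev j₀ hj₀] at this

theorem rpow_lintegral_Icc_le {ψ : ℝ → ℝ≥0∞} (hψ : Measurable ψ) {r : ℝ} (hr : 1 ≤ r) :
    (∫⁻ x in Set.Icc (0:ℝ) 1, ψ x) ^ r ≤ ∫⁻ x, ψ x ^ r := by
  have : IsProbabilityMeasure (volume.restrict (Set.Icc (0:ℝ) 1)) :=
    ⟨by rw [Measure.restrict_apply_univ, Real.volume_Icc, sub_zero, ENNReal.ofReal_one]⟩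
  have h := eLpNorm'_le_eLpNorm'_of_exponent_le (f := ψ) (p := 1) (q := r) (by norm_num) hr
    (volume.restrict (Set.Icc (0:ℝ) 1)) hψ.aestronglyMeasurable
  simp only [eLpNorm', enorm_eq_self, ENNReal.rpow_one, div_one] at h
  calc (∫⁻ x in Set.Icc (0:ℝ) 1, ψ x) ^ r
      ≤ ((∫⁻ x in Set.Icc (0:ℝ) 1, ψ x ^ r) ^ (1 / r)) ^ r :=
        ENNReal.rpow_le_rpow h (by linarith)
    _ = ∫⁻ x in Set.Icc (0:ℝ) 1, ψ x ^ r := by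
        rw [← ENNReal.rpow_mul, one_div_mul_cancel (by linarith), ENNReal.rpow_one]
    _ ≤ _ := setLIntegral_le_lintegral _ _

/-- The set of all `evalPoint b d n (b + d + C) u` with `n < 2^b` and `|u - u₀| ≤ δ`. -/
def evalSet (C : ℕ) (u₀ δ : ℝ) (b d : ℕ) : Set ℝ :=
  ⋃ n ∈ Finset.range (2 ^ b), Metric.closedBall (evalPoint b d n (b + d + C) u₀)
    (δ / 2 ^ (b + d + C))

theorem measurableSet_evalSet (C : ℕ) (u₀ δ : ℝ) (b d : ℕ) : MeasurableSet (evalSet C u₀ δ b d) :=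
  Finset.measurableSet_biUnion _ fun _ _ => measurableSet_closedBall

theorem exists_eq_evalPoint {C b d n : ℕ} {u₀ δ x : ℝ}
    (hx : x ∈ Metric.closedBall (evalPoint b d n (b + d + C) u₀) (δ / 2 ^ (b + d + C))) :
    ∃ u, |u - u₀| ≤ δ ∧ x = evalPoint b d n (b + d + C) u := by
  refine ⟨u₀ + 2 ^ (b + d + C) * (x - evalPoint b d n (b + d + C) u₀), ?_, ?_⟩
  · rw [Metric.mem_closedBall, Real.dist_eq, le_div_iff₀ (by positivity)] at hx
    rw [add_sub_cancel_left, abs_mul, abs_of_pos (by positivity)]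
    linarith
  · simp only [evalPoint]; field_simp; ring

theorem evalPoint_mem_Ioo {C b d n : ℕ} {u : ℝ} (hu : |u| ≤ 2 ^ C / 16) :
    evalPoint b d n (b + d + C) u ∈ Set.Ioo ((n:ℝ) / 2 ^ b) ((n + 1) / 2 ^ b) := by
  have h1 : |u / 2 ^ (b + d + C)| ≤ (2 ^ (b + d))⁻¹ / 16 := by
    rw [abs_div, abs_of_pos (by positivity : (0:ℝ) < 2 ^ (b + d + C)), div_le_iff₀ (by positivity),
      pow_add (2:ℝ) (b + d) C]
    refine hu.trans_eq ?_
    field_simp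
  have h2 : ((2:ℝ) ^ (b + d + 1))⁻¹ = (2 ^ (b + d))⁻¹ / 2 := by rw [pow_succ, mul_inv]; ring
  have h3 : ((2:ℝ) ^ (b + d))⁻¹ ≤ (2 ^ b)⁻¹ :=
    inv_anti₀ (by positivity) (pow_le_pow_right₀ (by norm_num) (by omega))
  have h4 : (0:ℝ) < (2 ^ (b + d))⁻¹ := by positivity
  rw [abs_le] at h1
  rw [evalPoint, h2, add_div, one_div]
  constructor <;> linarith [h1.1, h1.2]

theorem evalSet_subset_Icc {C b d : ℕ} {u₀ δ : ℝ} (hu : |u₀| + δ ≤ 2 ^ C / 16) :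
    evalSet C u₀ δ b d ⊆ Set.Icc 0 1 := by
  intro x hx
  simp only [evalSet, Set.mem_iUnion, Finset.mem_range] at hx
  obtain ⟨n, hn, hx⟩ := hx
  obtain ⟨u, hu', rfl⟩ := exists_eq_evalPoint hx
  have h := evalPoint_mem_Ioo (b := b) (d := d) (n := n) (u := u) (C := C)
    (by linarith [abs_sub_abs_le_abs_sub u u₀])
  have h1 : ((n:ℝ) + 1) / 2 ^ b ≤ 1 := by
    rw [div_le_one (by positivity)]; exact_mod_cast hn
  exact ⟨(by positivity : (0:ℝ) ≤ n / 2 ^ b).trans h.1.le, h.2.le.trans h1⟩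

theorem volume_evalSet {C b d : ℕ} {u₀ δ : ℝ} (hu : |u₀| + δ ≤ 2 ^ C / 16) :
    volume (evalSet C u₀ δ b d) = ENNReal.ofReal (2 ^ b * (2 * (δ / 2 ^ (b + d + C)))) := by
  rw [evalSet, measure_biUnion_finset]
  · simp only [Real.volume_closedBall, Finset.sum_const, Finset.card_range, nsmul_eq_mul]
    rw [ENNReal.ofReal_mul (by positivity : (0:ℝ) ≤ 2 ^ b), ENNReal.ofReal_pow (by norm_num)]
    simp
  · intro n _ m _ hnm
    rw [Function.onFun, Set.disjoint_left]
    intro x hx hx'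
    obtain ⟨u, hu1, rfl⟩ := exists_eq_evalPoint hx
    obtain ⟨u', hu2, he⟩ := exists_eq_evalPoint hx'
    have h1 := evalPoint_mem_Ioo (b := b) (d := d) (n := n) (u := u) (C := C)
      (by linarith [abs_sub_abs_le_abs_sub u u₀])
    have h2 := evalPoint_mem_Ioo (b := b) (d := d) (n := m) (u := u') (C := C)
      (by linarith [abs_sub_abs_le_abs_sub u' u₀])
    rw [← he] at h2
    have h3 : (n:ℝ) < m + 1 := by
      have := h1.1.trans h2.2
      rwa [div_lt_div_iff_of_pos_right (by positivity)] at this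
    have h4 : (m:ℝ) < n + 1 := by
      have := h2.1.trans h1.2
      rwa [div_lt_div_iff_of_pos_right (by positivity)] at this
    norm_cast at h3 h4
    omega
  · exact fun _ _ => measurableSet_closedBall

theorem le_FNorm_of_evalSet {φ₀ g : ℝ → ℂ} {p q : ℝ} (hq : 1 < q) (hqp : q ≤ p)
    {J : Finset ℕ} {β : ℕ → ℕ} (hβ : ∀ j ∈ J, β j ≤ j) {C : ℕ} {m δ u₀ : ℝ} (hm : 0 ≤ m)
    (hδ : 0 < δ) (hu : |u₀| + δ ≤ 2 ^ C / 16)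
    (hg : ∀ j ∈ J, ∀ n < 2 ^ β j, ∀ u, |u - u₀| ≤ δ → m * haarWeight q (β j) (j - β j)
      ≤ ‖LPop φ₀ (j + C) g (evalPoint (β j) (j - β j) n (j + C) u)‖) :
    ENNReal.ofReal (J.card * (m ^ q * (2 * δ) * (2:ℝ) ^ (-(C:ℝ) * q))) ^ (1 / q)
      ≤ FNorm φ₀ p q (-1 + 1 / q) g := by
  set v : ℕ → ℝ≥0∞ := fun j => ENNReal.ofReal ((2:ℝ) ^ (((j + C : ℕ):ℝ) * (-1 + 1 / q) * q)) *
    ENNReal.ofReal (m * haarWeight q (β j) (j - β j)) ^ q with hv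
  set X : ℕ → Set ℝ := fun j => evalSet C u₀ δ (β j) (j - β j) with hX
  set ψ : ℝ → ℝ≥0∞ := fun x => ∑ j ∈ J, (X j).indicator (fun _ => v j) x with hψ
  have hXm : ∀ j, MeasurableSet (X j) := fun j => measurableSet_evalSet _ _ _ _ _
  have hψm : Measurable ψ := Finset.measurable_fun_sum _ fun j _ =>
    measurable_const.indicator (hXm j)
  have hle : ∀ x, ψ x ≤ ∑' k : ℕ, ENNReal.ofReal ((2:ℝ) ^ ((k:ℝ) * (-1 + 1 / q) * q)) *
      (ENNReal.ofReal ‖LPop φ₀ k g x‖) ^ q := by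
    intro x
    set T : ℕ → ℝ≥0∞ := fun k => ENNReal.ofReal ((2:ℝ) ^ ((k:ℝ) * (-1 + 1 / q) * q)) *
      (ENNReal.ofReal ‖LPop φ₀ k g x‖) ^ q
    calc ψ x ≤ ∑ j ∈ J, T (j + C) := by
          refine Finset.sum_le_sum fun j hj => ?_
          by_cases hx : x ∈ X j
          · rw [Set.indicator_of_mem hx]
            simp only [hX, evalSet, Set.mem_iUnion, Finset.mem_range] at hx
            obtain ⟨n, hn, hx⟩ := hx
            obtain ⟨u, hu', rfl⟩ := exists_eq_evalPoint hx
            have := hg j hj n hn u hu'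
            simp only [hv, T, Nat.add_sub_cancel' (hβ j hj)]
            gcongr
          · rw [Set.indicator_of_notMem hx]; exact bot_le
      _ = ∑ k ∈ J.map (addRightEmbedding C), T k := by rw [Finset.sum_map]; rfl
      _ ≤ _ := ENNReal.sum_le_tsum _
  have hint : ∫⁻ x in Set.Icc (0:ℝ) 1, ψ x
      = ENNReal.ofReal (J.card * (m ^ q * (2 * δ) * (2:ℝ) ^ (-(C:ℝ) * q))) := by
    rw [lintegral_finsetSum _ fun j _ => measurable_const.indicator (hXm j)]
    rw [ENNReal.ofReal_mul (by positivity), ENNReal.ofReal_natCast, ← nsmul_eq_mul,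
      ← Finset.sum_const]
    refine Finset.sum_congr rfl fun j hj => ?_
    rw [lintegral_indicator_const (hXm j), Measure.restrict_apply (hXm j),
      Set.inter_eq_left.2 (evalSet_subset_Icc hu), volume_evalSet hu,
      Nat.add_sub_cancel' (hβ j hj)]
    simp only [hv]
    have hW := haarWeight_pos q (β j) (j - β j)
    rw [ENNReal.ofReal_rpow_of_nonneg (by positivity) (by linarith),
      ← ENNReal.ofReal_mul (by positivity), ← ENNReal.ofReal_mul (by positivity)]
    congr 1
    have hjb : ((j - β j : ℕ):ℝ) = j - β j := by rw [Nat.cast_sub (hβ j hj)]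
    have hq0 : q ≠ 0 := by linarith
    rw [Real.mul_rpow hm hW.le, haarWeight, ← Real.rpow_mul (by norm_num), hjb, two_pow_eq_rpow,
      two_pow_eq_rpow, div_eq_mul_inv δ, ← Real.rpow_neg (by norm_num)]
    have e : (2:ℝ) ^ (-(C:ℝ) * q) = (2:ℝ) ^ (((j + C : ℕ):ℝ) * (-1 + 1 / q) * q)
        * (2:ℝ) ^ (((β j:ℝ) + (j - β j) - β j / q) * q) * (2:ℝ) ^ (β j : ℝ)
        * (2:ℝ) ^ (-((j + C : ℕ):ℝ)) := by
      rw [← Real.rpow_add (by norm_num), ← Real.rpow_add (by norm_num),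
        ← Real.rpow_add (by norm_num)]
      congr 1
      push_cast
      field_simp
      ring
    rw [e]
    ring
  have hp : 0 < p := by linarith
  rw [FNorm]
  calc _ = ((∫⁻ x in Set.Icc (0:ℝ) 1, ψ x) ^ (p / q)) ^ (1 / p) := by
        rw [hint, ← ENNReal.rpow_mul]
        congr 1
        field_simp
    _ ≤ (∫⁻ x, ψ x ^ (p / q)) ^ (1 / p) := by
        refine ENNReal.rpow_le_rpow (rpow_lintegral_Icc_le hψm ?_) (by positivity)
        rwa [one_le_div (by linarith)]
    _ ≤ _ := by
        refine ENNReal.rpow_le_rpow (lintegral_mono fun x => ?_) (by positivity)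
        refine ENNReal.rpow_le_rpow (hle x) ?_
        have : 0 < q := by linarith
        positivity

theorem lt_abs_sub_of_disjoint_Icc {N : ℕ} {a a' : ℝ}
    (h : Disjoint (Set.Icc a (a + N)) (Set.Icc a' (a' + N))) : (N:ℝ) < |a - a'| := by
  by_contra! hle
  rw [abs_le] at hle
  have hN : (0:ℝ) ≤ N := Nat.cast_nonneg N
  refine Set.disjoint_left.1 h (show max a a' ∈ _ from ⟨le_max_left _ _, ?_⟩) ⟨le_max_right _ _, ?_⟩
  · exact max_le (by linarith) (by linarith)
  · exact max_le (by linarith) (by linarith)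

theorem natCeil_gap {N L : ℕ} (hN : 1 ≤ N) {a a' : ℝ} (ha : -(N:ℝ) ≤ a)
    (hlt : ⌊a / N⌋ + (L + 3) ≤ ⌊a' / N⌋) : (L:ℝ) * N ≤ (⌈a'⌉₊ : ℝ) - ⌈a⌉₊ := by
  have hN' : (1:ℝ) ≤ N := by exact_mod_cast hN
  have h1 : a / N < ⌊a / N⌋ + 1 := Int.lt_floor_add_one _
  have h2 : (⌊a' / N⌋ : ℝ) ≤ a' / N := Int.floor_le _
  have h3 : ((⌊a / N⌋ : ℝ)) + (L + 3) ≤ ⌊a' / N⌋ := by exact_mod_cast hlt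
  have h4 : a / N + (L + 2) ≤ a' / N := by linarith
  have h5 : a + (L + 2) * N ≤ a' := by
    have := mul_le_mul_of_nonneg_right h4 (by linarith : (0:ℝ) ≤ N)
    rw [add_mul, div_mul_cancel₀ _ (by positivity), div_mul_cancel₀ _ (by positivity)] at this
    exact this
  have h6 : a' ≤ ⌈a'⌉₊ := Nat.le_ceil _
  have h7 : (⌈a⌉₊ : ℝ) ≤ a + N + 1 := by
    rcases le_total 0 a with h | h
    · linarith [Nat.ceil_lt_add_one h]
    · rw [Nat.ceil_eq_zero.2 h]; push_cast; linarith
  nlinarith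

theorem exists_separatedLevels {ε : ℝ} (hε : 0 < ε) {L N : ℕ} (hN : 1 ≤ N) (hL : 4 ≤ ε * L)
    (A : Set ℕ) (a : Fin (4 ^ N) → ℝ)
    (hdisj : ∀ κ κ', κ ≠ κ' → Disjoint (Set.Icc (a κ) (a κ + N)) (Set.Icc (a κ') (a κ' + N)))
    (hmeet : ∀ κ, ∃ j ∈ A, (j:ℝ) ∈ Set.Icc (a κ) (a κ + N)) :
    ∃ (J : Finset ℕ) (β : ℕ → ℕ), (∀ j ∈ J, j ∈ A) ∧ SeparatedLevels ε N J β ∧ J.Nonempty ∧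
      (J.image β).card ≤ 4 ^ N ∧
      ∑ κ, ({j : ℕ | j ∈ A ∧ (j:ℝ) ∈ Set.Icc (a κ) (a κ + N)}.ncard : ℝ)
        ≤ (L + 3) * 2 * J.card := by
  classical
  set B : Fin (4 ^ N) → Finset ℕ := fun κ => (Finset.Icc ⌈a κ⌉₊ (⌈a κ⌉₊ + N)).filter
    fun j => j ∈ A ∧ (j:ℝ) ∈ Set.Icc (a κ) (a κ + N) with hB
  have hmem : ∀ κ j, j ∈ B κ ↔ j ∈ A ∧ (j:ℝ) ∈ Set.Icc (a κ) (a κ + N) := by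
    intro κ j
    simp only [hB, Finset.mem_filter, Finset.mem_Icc, and_iff_right_iff_imp]
    rintro ⟨_, h1, h2⟩
    refine ⟨Nat.ceil_le.2 h1, ?_⟩
    have : (j:ℝ) ≤ ⌈a κ⌉₊ + N := h2.trans (by linarith [Nat.le_ceil (a κ)])
    exact_mod_cast this
  have hrange : ∀ κ, ∀ j ∈ B κ, ⌈a κ⌉₊ ≤ j ∧ j ≤ ⌈a κ⌉₊ + N := fun κ j hj =>
    Finset.mem_Icc.1 (Finset.mem_filter.1 hj).1
  have hncard : ∀ κ, {j : ℕ | j ∈ A ∧ (j:ℝ) ∈ Set.Icc (a κ) (a κ + N)}.ncard = (B κ).card := by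
    intro κ
    rw [← Set.ncard_coe_finset]
    congr 1
    ext j
    exact (hmem κ j).symm
  have huniq : ∀ κ κ' j, j ∈ B κ → j ∈ B κ' → κ = κ' := by
    intro κ κ' j h h'
    by_contra hne
    exact Set.disjoint_left.1 (hdisj κ κ' hne) ((hmem κ j).1 h).2 ((hmem κ' j).1 h').2
  set P : Finset (Fin (4 ^ N) × ℕ) := Finset.univ.biUnion fun κ => (B κ).image fun j => (κ, j)
    with hP
  have hPmem : ∀ x, x ∈ P ↔ x.2 ∈ B x.1 := by
    rintro ⟨κ, j⟩
    simp [hP]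
  have hPcard : P.card = ∑ κ, (B κ).card := by
    rw [hP, Finset.card_biUnion]
    · refine Finset.sum_congr rfl fun κ _ => Finset.card_image_of_injective _ ?_
      exact Prod.mk_right_injective κ
    · intro κ _ κ' _ hne
      rw [Function.onFun, Finset.disjoint_left]
      rintro x hx hx'
      simp only [Finset.mem_image] at hx hx'
      obtain ⟨j, _, rfl⟩ := hx
      obtain ⟨j', _, h⟩ := hx'
      exact hne (congrArg Prod.fst h).symm
  set color : Fin (4 ^ N) × ℕ → ℤ × ℕ := fun x => (⌊a x.1 / N⌋ % (L + 3), x.2 % 2) with hcolor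
  set t : Finset (ℤ × ℕ) := Finset.Ico (0:ℤ) (L + 3) ×ˢ Finset.range 2 with ht
  have htcard : t.card = (L + 3) * 2 := by
    rw [ht, Finset.card_product, Int.card_Ico, Finset.card_range]
    congr 1
  have hmaps : ∀ x ∈ P, color x ∈ t := by
    intro x _
    simp only [hcolor, ht, Finset.mem_product, Finset.mem_Ico, Finset.mem_range]
    exact ⟨⟨Int.emod_nonneg _ (by omega), Int.emod_lt_of_pos _ (by omega)⟩,
      Nat.mod_lt _ (by norm_num)⟩
  have htne : t.Nonempty := by
    rw [← Finset.card_pos, htcard]; omega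
  obtain ⟨y, _, hy⟩ := Finset.exists_le_card_fiber_of_nsmul_le_card_of_maps_to (M := ℝ)
    (b := (P.card : ℝ) / t.card) hmaps htne (by
      rw [nsmul_eq_mul, mul_div_cancel₀]
      rw [htcard]; positivity)
  set F := P.filter fun x => color x = y with hF
  set J := F.image Prod.snd with hJ
  have hJcard : J.card = F.card := by
    refine Finset.card_image_of_injOn ?_
    rintro ⟨κ, j⟩ hx ⟨κ', j'⟩ hx' (rfl : j = j')
    have h1 := (hPmem _).1 (Finset.mem_filter.1 hx).1
    have h2 := (hPmem _).1 (Finset.mem_filter.1 hx').1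
    rw [huniq κ κ' j h1 h2]
  have hJmem : ∀ j ∈ J, ∃ κ, j ∈ B κ ∧ ⌊a κ / N⌋ % (L + 3) = y.1 ∧ j % 2 = y.2 := by
    intro j hj
    obtain ⟨⟨κ, j'⟩, hx, rfl⟩ := Finset.mem_image.1 hj
    obtain ⟨h1, h2⟩ := Finset.mem_filter.1 hx
    exact ⟨κ, (hPmem _).1 h1, congrArg Prod.fst h2, congrArg Prod.snd h2⟩
  set β : ℕ → ℕ := fun j => if h : ∃ κ, j ∈ B κ then ⌈a h.choose⌉₊ else 0 with hβ
  have hβeq : ∀ κ j, j ∈ B κ → β j = ⌈a κ⌉₊ := by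
    intro κ j hj
    have h : ∃ κ, j ∈ B κ := ⟨κ, hj⟩
    simp only [hβ, dif_pos h]
    rw [huniq h.choose κ j h.choose_spec hj]
  have hlow : ∀ κ, -(N:ℝ) ≤ a κ := by
    intro κ
    obtain ⟨j, _, hj⟩ := hmeet κ
    have : (0:ℝ) ≤ j := Nat.cast_nonneg j
    linarith [hj.2]
  have hN' : (0:ℝ) < N := by exact_mod_cast hN
  have hfloor : ∀ κ κ', κ ≠ κ' → ⌊a κ / N⌋ ≠ ⌊a κ' / N⌋ := by
    intro κ κ' hne h
    have h1 := Int.abs_sub_lt_one_of_floor_eq_floor h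
    have h2 := lt_abs_sub_of_disjoint_Icc (hdisj κ κ' hne)
    rw [← sub_div, abs_div, abs_of_pos hN', div_lt_one hN'] at h1
    linarith
  have hsum : ∑ κ, ({j : ℕ | j ∈ A ∧ (j:ℝ) ∈ Set.Icc (a κ) (a κ + N)}.ncard : ℝ)
      ≤ (L + 3) * 2 * J.card := by
    have e : ∑ κ, ({j : ℕ | j ∈ A ∧ (j:ℝ) ∈ Set.Icc (a κ) (a κ + N)}.ncard : ℝ) = P.card := by
      rw [hPcard]; push_cast
      exact Finset.sum_congr rfl fun κ _ => by rw [hncard]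
    rw [e, hJcard]
    rw [htcard, div_le_iff₀ (by positivity)] at hy
    push_cast at hy
    linarith
  refine ⟨J, β, ?_, ⟨?_, ?_, ?_, ?_⟩, ?_, ?_, hsum⟩
  · intro j hj
    obtain ⟨κ, hκ, _⟩ := hJmem j hj
    exact ((hmem κ j).1 hκ).1
  · intro j hj
    obtain ⟨κ, hκ, _⟩ := hJmem j hj
    rw [hβeq κ j hκ]
    exact (hrange κ j hκ).1
  · intro j hj
    obtain ⟨κ, hκ, _⟩ := hJmem j hj
    rw [hβeq κ j hκ]
    exact (hrange κ j hκ).2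
  · intro i hi j hj _ hij
    obtain ⟨_, _, _, h1⟩ := hJmem i hi
    obtain ⟨_, _, _, h2⟩ := hJmem j hj
    omega
  · intro i hi j hj hne
    obtain ⟨κ, hκ, h1, _⟩ := hJmem i hi
    obtain ⟨κ', hκ', h2, _⟩ := hJmem j hj
    rw [hβeq κ i hκ, hβeq κ' j hκ'] at hne ⊢
    have hfl := hfloor κ κ' (fun h => hne (by rw [h]))
    have hmod : ((L:ℤ) + 3) ∣ ⌊a κ / N⌋ - ⌊a κ' / N⌋ := Int.ModEq.dvd (h2.trans h1.symm)
    have hgap : (L:ℝ) * N ≤ |(⌈a κ⌉₊ : ℝ) - ⌈a κ'⌉₊| := by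
      rcases lt_or_gt_of_ne hfl with h | h
      · have hle := Int.le_of_dvd (by omega) ((dvd_sub_comm).1 hmod)
        rw [abs_sub_comm]
        exact (natCeil_gap hN (hlow κ) (by omega)).trans (le_abs_self _)
      · have hle := Int.le_of_dvd (by omega) hmod
        exact (natCeil_gap hN (hlow κ') (by omega)).trans (le_abs_self _)
    calc (4:ℝ) * N ≤ ε * L * N := by gcongr
      _ = ε * (L * N) := by ring
      _ ≤ _ := by gcongr
  · by_contra hempty
    rw [Finset.not_nonempty_iff_eq_empty] at hempty
    rw [hempty, Finset.card_empty, Nat.cast_zero, mul_zero] at hsum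
    have κ₀ : Fin (4 ^ N) := ⟨0, by positivity⟩
    obtain ⟨j, hjA, hj⟩ := hmeet κ₀
    have hpos : (0:ℝ) < ({j : ℕ | j ∈ A ∧ (j:ℝ) ∈ Set.Icc (a κ₀) (a κ₀ + N)}.ncard : ℝ) := by
      rw [hncard]
      exact_mod_cast Finset.card_pos.2 ⟨j, (hmem κ₀ j).2 ⟨hjA, hj⟩⟩
    have := Finset.single_le_sum (f := fun κ =>
      ({j : ℕ | j ∈ A ∧ (j:ℝ) ∈ Set.Icc (a κ) (a κ + N)}.ncard : ℝ))
      (fun κ _ => Nat.cast_nonneg _) (Finset.mem_univ κ₀)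
    linarith
  · have hsub : J.image β ⊆ Finset.univ.image fun κ => ⌈a κ⌉₊ := by
      intro b hb
      obtain ⟨j, hj, rfl⟩ := Finset.mem_image.1 hb
      obtain ⟨κ, hκ, _⟩ := hJmem j hj
      exact Finset.mem_image.2 ⟨κ, Finset.mem_univ _, (hβeq κ j hκ).symm⟩
    calc _ ≤ _ := Finset.card_le_card hsub
      _ ≤ _ := Finset.card_image_le
      _ = _ := by simp

theorem SchwartzMap.exists_pos_norm_bound_of_finset {ι : Type*} (s : Finset ι)
    (θ : ι → SchwartzMap ℝ ℂ) (n : ℕ) :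
    ∃ K > 0, ∀ i ∈ s, ∀ x, ‖θ i x‖ ≤ K * ((1 + |x|) ^ n)⁻¹ := by
  choose K hK hle using fun i => SchwartzMap.exists_norm_mul_pow_le (θ i) n
  refine ⟨1 + ∑ i ∈ s, K i, by
    have := Finset.sum_nonneg (s := s) (fun i _ => (hK i).le); linarith, fun i hi x => ?_⟩
  refine (hle i x).trans ?_
  have := Finset.single_le_sum (f := K) (s := s) (fun i _ => (hK i).le) hi
  gcongr
  linarith

theorem LPop_haarProj_zero (φ₀ : ℝ → ℂ) (k : ℕ) (E : Finset (ℕ × ℤ)) (x : ℝ) :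
    LPop φ₀ k (haarProj E (0 : ℝ → ℂ)) x = 0 := by
  have h : haarProj E (0 : ℝ → ℂ) = 0 := by
    ext y; simp [haarProj]
  rw [h, LPop]
  split_ifs <;> simp [conv]

theorem exists_ball_norm_ge {Ξ : ℝ → ℂ} (hΞ : Continuous Ξ) {u₀ : ℝ} (h : Ξ u₀ ≠ 0) :
    ∃ δ > 0, ∀ u, |u - u₀| ≤ δ → ‖Ξ u₀‖ / 2 ≤ ‖Ξ u‖ := by
  have hlt : ‖Ξ u₀‖ / 2 < ‖Ξ u₀‖ := by have := norm_pos_iff.2 h; linarith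
  have hev := (hΞ.norm.tendsto u₀).eventually (eventually_gt_nhds hlt)
  obtain ⟨δ, hδ, hball⟩ := Metric.eventually_nhds_iff.1 hev
  refine ⟨δ / 2, by linarith, fun u hu => (hball ?_).le⟩
  rw [Real.dist_eq]; linarith

theorem exists_two_pow_scale (X Y : ℝ) {c : ℝ} (hY : 0 ≤ Y) (hc : 0 < c) :
    ∃ C : ℕ, 2 ≤ C ∧ X ≤ (2:ℝ) ^ C / 16 ∧ Y * (((2:ℝ) ^ C) ^ 2)⁻¹ ≤ c := by
  have ht : Filter.Tendsto (fun C : ℕ => (2:ℝ) ^ C) Filter.atTop Filter.atTop :=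
    tendsto_pow_atTop_atTop_of_one_lt (by norm_num)
  obtain ⟨C, h1, h2, h3⟩ := ((ht.eventually_ge_atTop (16 * X)).and
    ((ht.eventually_ge_atTop (Y / c)).and (Filter.eventually_ge_atTop 2))).exists
  refine ⟨C, h3, by linarith, ?_⟩
  have hR : (1:ℝ) ≤ 2 ^ C := one_le_pow₀ (by norm_num)
  rw [div_le_iff₀ hc] at h2
  rw [← div_eq_mul_inv, div_le_iff₀ (by positivity)]
  nlinarith [mul_nonneg hc.le (by linarith : (0:ℝ) ≤ 2 ^ C - 1)]

theorem SeparatedLevels.add_le_of_lt {ε : ℝ} {N : ℕ} {J : Finset ℕ} {β : ℕ → ℕ}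
    (h : SeparatedLevels ε N J β) (hε : ε ≤ 1 / 4) :
    ∀ b ∈ J.image β, ∀ b' ∈ J.image β, b < b' → b + 2 * N ≤ b' := by
  intro b hb b' hb' hlt
  obtain ⟨i, hi, rfl⟩ := Finset.mem_image.1 hb
  obtain ⟨j, hj, rfl⟩ := Finset.mem_image.1 hb'
  have hlt' : (β i:ℝ) < β j := by exact_mod_cast hlt
  have hg := h.gap i hi j hj hlt.ne
  rw [abs_of_neg (by linarith)] at hg
  have : (β i:ℝ) + 2 * N ≤ β j := by nlinarith
  exact_mod_cast this

theorem ratio_bound {q N J P Z t M c₂ δ Λ : ℝ} {C : ℕ} (hq : 1 < q) (hN : 0 < N) (hJ : 0 ≤ J)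
    (hP : 0 < P) (hZ : 0 ≤ Z) (hM : 0 < M) (ht : 0 ≤ t) (hc₂ : 0 ≤ c₂) (hδ : 0 < δ) (hΛ : 0 < Λ)
    (hle : P * Z ≤ Λ * J) :
    t * c₂ / 2 * (2 * δ) ^ (1 / q) * (2:ℝ) ^ (-(C:ℝ)) / (M * Λ ^ (1 / q))
        * N ^ (1 - 1 / q) * Z ^ (1 / q) * (M * (P * N) ^ (1 / q))
      ≤ (J * ((N * t * c₂ / 2) ^ q * (2 * δ) * (2:ℝ) ^ (-(C:ℝ) * q))) ^ (1 / q) := by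
  have hq0 : q ≠ 0 := by linarith
  have e1 : (J * ((N * t * c₂ / 2) ^ q * (2 * δ) * (2:ℝ) ^ (-(C:ℝ) * q))) ^ (1 / q)
      = J ^ (1 / q) * ((N * t * c₂ / 2) * (2 * δ) ^ (1 / q) * (2:ℝ) ^ (-(C:ℝ))) := by
    rw [Real.mul_rpow hJ (by positivity), Real.mul_rpow (by positivity) (by positivity),
      Real.mul_rpow (by positivity) (by positivity), ← Real.rpow_mul (by positivity),
      ← Real.rpow_mul (by norm_num), mul_one_div_cancel hq0, Real.rpow_one, mul_assoc (-(C:ℝ)),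
      mul_one_div_cancel hq0, mul_one]
  have e2 : N ^ (1 - 1 / q) * N ^ (1 / q) = N := by
    rw [← Real.rpow_add hN, sub_add_cancel, Real.rpow_one]
  have h3 : P ^ (1 / q) * Z ^ (1 / q) ≤ Λ ^ (1 / q) * J ^ (1 / q) := by
    rw [← Real.mul_rpow hP.le hZ, ← Real.mul_rpow hΛ.le hJ]
    exact Real.rpow_le_rpow (by positivity) hle (by positivity)
  rw [e1, Real.mul_rpow hP.le hN.le]
  have hΛ' : 0 < Λ ^ (1 / q) := by positivity
  calc _ = t * c₂ / 2 * (2 * δ) ^ (1 / q) * (2:ℝ) ^ (-(C:ℝ)) / Λ ^ (1 / q)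
        * (N ^ (1 - 1 / q) * N ^ (1 / q)) * (P ^ (1 / q) * Z ^ (1 / q)) := by field_simp
    _ ≤ t * c₂ / 2 * (2 * δ) ^ (1 / q) * (2:ℝ) ^ (-(C:ℝ)) / Λ ^ (1 / q)
        * (N ^ (1 - 1 / q) * N ^ (1 / q)) * (Λ ^ (1 / q) * J ^ (1 / q)) := by gcongr
    _ = _ := by rw [e2]; field_simp

/-- Refined endpoint lower bound (Theorem on $Z$): if $4^N$ pairwise disjoint intervals
of length $N$ each meet $A$ and $Z=4^{-N}\sum_\kappa \#(I_\kappa\cap A)$, then some Haar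
projection with frequencies in $A$ has norm $\ge c N^{1-1/q}Z^{1/q}$ on
$F^{-1+1/q}_{p,q}$. -/
theorem haar_projection_refined_endpoint_lower_bound
    (p q : ℝ) (hq : 1 < q) (hqp : q ≤ p)
    (φ₀ : ℝ → ℂ) (hφsmooth : ContDiff ℝ (⊤ : ℕ∞) φ₀) (hφcpt : HasCompactSupport φ₀)
    (hφone : ∀ ξ : ℝ, |ξ| ≤ 4/3 → φ₀ ξ = 1)
    (hφzero : ∀ ξ : ℝ, 3/2 ≤ |ξ| → φ₀ ξ = 0) :
    ∃ c : ℝ, 0 < c ∧ ∃ N₀ : ℕ, ∀ (N : ℕ), N₀ ≤ N → ∀ (A : Set ℕ) (a : Fin (4^N) → ℝ),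
      (∀ κ κ' : Fin (4^N), κ ≠ κ' →
        Disjoint (Set.Icc (a κ) (a κ + N)) (Set.Icc (a κ') (a κ' + N))) →
      (∀ κ : Fin (4^N), ∃ j ∈ A, (j:ℝ) ∈ Set.Icc (a κ) (a κ + N)) →
      ∀ Z : ℝ, Z = (4:ℝ)^(-(N:ℝ)) *
          ∑ κ : Fin (4^N), (({j : ℕ | j ∈ A ∧ (j:ℝ) ∈ Set.Icc (a κ) (a κ + N)}.ncard : ℝ)) →
      ∃ E : Finset (ℕ × ℤ), (∀ j ∈ HFset E, j ∈ A) ∧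
      ∃ f : SchwartzMap ℝ ℂ, f ≠ 0 ∧
        ENNReal.ofReal (c * (N:ℝ)^(1 - 1/q) * Z^(1/q)) *
            FNorm φ₀ p q (-1 + 1/q) f ≤
          FNorm φ₀ p q (-1 + 1/q) (haarProj E f) := by
  have hq0 : 0 < q := by linarith
  have hp0 : 0 < p := by linarith
  obtain ⟨θ, hθ0, hθ⟩ := exists_annular_schwartz
  obtain ⟨Ξ, ⟨u₀, hu₀⟩, hΞd⟩ := exists_primitive_kernel hφsmooth hφcpt hφone hφzero
  obtain ⟨K, hK, hKle⟩ := SchwartzMap.exists_pos_norm_bound_of_finset (Finset.univ : Finset (Fin 4))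
    ![θ, SchwartzMap.derivCLM ℝ ℂ θ, Ξ, SchwartzMap.derivCLM ℝ ℂ (SchwartzMap.derivCLM ℝ ℂ Ξ)] 6
  have hg : ∀ x, ‖θ x‖ ≤ K * ((1 + |x|) ^ 6)⁻¹ := hKle 0 (Finset.mem_univ _)
  have hg' : ∀ x, ‖deriv θ x‖ ≤ K * ((1 + |x|) ^ 6)⁻¹ := hKle 1 (Finset.mem_univ _)
  have hΞ : ∀ x, ‖Ξ x‖ ≤ K * ((1 + |x|) ^ 6)⁻¹ := hKle 2 (Finset.mem_univ _)
  have hΞ'' : ∀ x, ‖deriv (deriv Ξ) x‖ ≤ K * ((1 + |x|) ^ 6)⁻¹ := hKle 3 (Finset.mem_univ _)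
  obtain ⟨δ, hδ, hball⟩ := exists_ball_norm_ge Ξ.continuous hu₀
  set c₁ := ‖Ξ u₀‖ / 2 with hc₁
  have hc₁0 : 0 < c₁ := by have := norm_pos_iff.2 hu₀; positivity
  have ht : 0 < ‖θ 0‖ := norm_pos_iff.2 hθ0
  have h1q : 0 < 1 / q := by positivity
  have h1q' : 0 < 1 - 1 / q := by
    rw [sub_pos, div_lt_one hq0]; exact hq
  set ε := min (1 / q) (1 - 1 / q) / 2 with hε
  have hε0 : 0 < ε := by rw [hε]; exact half_pos (lt_min h1q h1q')
  have hε1 : 2 * ε ≤ 1 / q := by rw [hε]; linarith [min_le_left (1 / q) (1 - 1 / q)]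
  have hε2 : 2 * ε ≤ 1 - 1 / q := by rw [hε]; linarith [min_le_right (1 / q) (1 - 1 / q)]
  have hρ : 0 < (1 - (2:ℝ) ^ (-ε))⁻¹ := by
    rw [inv_pos, sub_pos]
    exact Real.rpow_lt_one_of_one_lt_of_neg (by norm_num) (by linarith)
  obtain ⟨C, hC, hCu, hCR⟩ := exists_two_pow_scale (|u₀| + δ)
    (10 * 2 ^ 17 * K * (1 - (2:ℝ) ^ (-ε))⁻¹) (by positivity) hc₁0
  obtain ⟨L, hL⟩ := exists_nat_ge (4 / ε)
  rw [div_le_iff₀ hε0] at hL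
  obtain ⟨N₁, hN₁⟩ := exists_nat_ge (2 * (K * (100 + 128 * (1 - (2:ℝ) ^ (-ε))⁻¹)) / ‖θ 0‖)
  rw [div_le_iff₀ ht] at hN₁
  set M : ℝ := ((16 * K) ^ p * (4 * (8 ^ (p / q) * ((p / q) ^ (p / q) * exp 8)))) ^ (1 / p) with hM
  have hM0 : 0 < M := by positivity
  set Λ : ℝ := (L + 3) * 2 with hΛ
  have hΛ0 : 0 < Λ := by positivity
  refine ⟨‖θ 0‖ * c₁ / 2 * (2 * δ) ^ (1 / q) * (2:ℝ) ^ (-(C:ℝ)) / (M * Λ ^ (1 / q)),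
    by positivity, max C N₁, ?_⟩
  intro N hN A a hdisj hmeet Z hZ
  have hCN : C ≤ N := (le_max_left _ _).trans hN
  have hN0 : 0 < N := by omega
  have hNK : K * (100 + 128 * (1 - (2:ℝ) ^ (-ε))⁻¹) ≤ N * ‖θ 0‖ / 2 := by
    have : (N₁:ℝ) ≤ N := by exact_mod_cast (le_max_right _ _).trans hN
    nlinarith
  obtain ⟨J, β, hJA, hJ, ⟨j₀, hj₀⟩, hcard, hsum⟩ :=
    exists_separatedLevels hε0 hN0 (by linarith : 4 ≤ ε * L) A a hdisj hmeet
  obtain ⟨f, hfd, hfLP⟩ := exists_testFn hφsmooth hφcpt hφone hφzero hθ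
    (fun b => (2:ℝ) ^ (-(b:ℝ) / q)) N (J.image β)
  have hpt : ∀ j ∈ J, ∀ n < 2 ^ β j, ∀ u, |u - u₀| ≤ δ →
      N * ‖θ 0‖ * c₁ / 2 * haarWeight q (β j) (j - β j)
        ≤ ‖LPop φ₀ (j + C) (haarProj (haarIndexSet J β) f)
          (evalPoint (β j) (j - β j) n (j + C) u)‖ := by
    intro j hj n hn u hu
    refine norm_LPop_haarProj_ge hΞd hK.le hΞ hΞ'' hg hg' hε0 hε1 hε2 hC hCN hJ hfd hNK hj hn
      ?_ (hball u hu) ?_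
    · linarith [abs_sub_abs_le_abs_sub u u₀]
    · refine le_trans (le_of_eq ?_) hCR; ring
  refine ⟨haarIndexSet J β, fun j hj => hJA j (mem_HFset_haarIndexSet hj), f, ?_, ?_⟩
  · rintro rfl
    have h := hpt j₀ hj₀ 0 (by positivity) u₀ (by rw [sub_self, abs_zero]; exact hδ.le)
    rw [FunLike.coe_zero, LPop_haarProj_zero, norm_zero] at h
    have hW := haarWeight_pos q (β j₀) (j₀ - β j₀)
    have : 0 < N * ‖θ 0‖ * c₁ / 2 * haarWeight q (β j₀) (j₀ - β j₀) := by positivity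
    linarith
  have hup := FNorm_testFn_le (φ₀ := φ₀) hq hqp hK.le hg' hN0 (J.image β)
    (hJ.add_le_of_lt (by linarith)) hcard hfLP
  have hlow := le_FNorm_of_evalSet (φ₀ := φ₀) hq hqp hJ.le
    (by positivity : 0 ≤ N * ‖θ 0‖ * c₁ / 2) hδ hCu hpt
  have hZ0 : 0 ≤ Z := by rw [hZ]; positivity
  have hPZ : (4:ℝ) ^ N * Z ≤ Λ * J.card := by
    rw [hZ, ← mul_assoc, Real.rpow_neg (by norm_num), Real.rpow_natCast,
      mul_inv_cancel₀ (by positivity), one_mul]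
    exact hsum
  refine le_trans ?_ hlow
  refine (mul_le_mul_right hup _).trans ?_
  rw [← ENNReal.ofReal_mul (by positivity), ENNReal.ofReal_rpow_of_nonneg (by positivity)
    (by positivity)]
  exact ENNReal.ofReal_le_ofReal (ratio_bound hq (by positivity) (by positivity) (by positivity)
    hZ0 hM0 ht.le hc₁0.le hδ hΛ0 hPZ)
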